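/- Let P be a hereditary property of ordered graphs. Then one of the following holds: (a) |P_n| is bounded, and there exist M, N ∈ ℕ such that |P_n| = M for every n ≥ N; (b) there exist k ∈ ℕ and integers a_0, …, a_k such that |P_n| = Σ_{i=0}^{k} a_i·C(n,i) for all sufficiently large n, and |P_n| ≥ n for every n ∈ ℕ; (c) there exist an integer k ≥ 2 and a polynomial p such that F_{n,k} ≤ |P_n| ≤ p(n)·F_{n,k} for every n ∈ ℕ; or (d) |P_n| ≥ 2^{n-1} for every n ∈ ℕ. -/

import Mathlib

open Finset

/-- `IndSub G H` : `G` is an induced ordered subgraph of `H`, i.e. there is an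
order-preserving injection of the vertices preserving adjacency and non-adjacency. -/
def IndSub {m n : ℕ} (G : SimpleGraph (Fin m)) (H : SimpleGraph (Fin n)) : Prop :=
  ∃ φ : Fin m ↪o Fin n, ∀ i j : Fin m, G.Adj i j ↔ H.Adj (φ i) (φ j)

/-- A hereditary property of ordered graphs: a family of ordered graphs (one set of
graphs on `[n]` for each `n`), closed under taking induced ordered subgraphs.  (Closure
under order-preserving isomorphisms is automatic in this encoding, since the only
order-preserving bijection of `Fin n` is the identity.) -/
structure HerProp where
  mem : ∀ n : ℕ, Set (SimpleGraph (Fin n))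
  hered : ∀ {m n : ℕ} (G : SimpleGraph (Fin m)) (H : SimpleGraph (Fin n)),
    IndSub G H → H ∈ mem n → G ∈ mem m

/-- The speed of a property: `n ↦ |P_n|`. -/
noncomputable def speed (P : HerProp) (n : ℕ) : ℕ := (P.mem n).ncard

/-- Generalized Fibonacci numbers `F_{n,k}` of order `k`:
`F_{0,k} = 1`, `F_{n,k} = F_{n-1,k} + ⋯ + F_{n-k,k}` (terms with negative index are 0). -/
def genFib (k : ℕ) : ℕ → ℕ
  | 0 => 1
  | n + 1 => ∑ i ∈ Finset.range k, if i ≤ n then genFib k (n - i) else 0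
decreasing_by omega

/-- `lHom G ℓ x y` : vertices `x` and `y` are `ℓ`-homogeneous in `G`
(`x ∼_ℓ y`), i.e. they have the same neighbourhoods outside `N_ℓ(x) ∪ N_ℓ(y)`. -/
def lHom {N : ℕ} (G : SimpleGraph (Fin N)) (ℓ : ℕ) (x y : Fin N) : Prop :=
  ∀ v : Fin N, ℓ ≤ ((v : ℤ) - (x : ℤ)).natAbs → ℓ ≤ ((v : ℤ) - (y : ℤ)).natAbs →
    (G.Adj x v ↔ G.Adj y v)

/-- `G` contains a `k`-structure of Type 1. -/
def HasType1 {N : ℕ} (G : SimpleGraph (Fin N)) (k : ℕ) : Prop :=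
  ∃ (y : Fin N) (x : Fin (2 * k) → Fin N), StrictMono x ∧
    ((∀ i, y < x i) ∨ (∀ i, x i < y)) ∧
    ∀ i j : Fin (2 * k), (j : ℕ) = (i : ℕ) + 1 → (G.Adj y (x i) ↔ ¬ G.Adj y (x j))

/-- `G` contains a `k`-structure of Type 2 (2(a) or 2(b)). -/
def HasType2 {N : ℕ} (G : SimpleGraph (Fin N)) (k : ℕ) : Prop :=
  ∃ x y : Fin (2 * k) → Fin N, StrictMono x ∧ (StrictMono y ∨ StrictAnti y) ∧
    (∀ i j, x i < y j) ∧
    ∀ i j : Fin (2 * k), (j : ℕ) = (i : ℕ) + 1 → (G.Adj (x i) (y i) ↔ ¬ G.Adj (x j) (y j))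

/-- `G` contains a `(k,ℓ)`-structure of Type 3. -/
def HasType3 {N : ℕ} (G : SimpleGraph (Fin N)) (k ℓ : ℕ) : Prop :=
  ∃ (x y : Fin (2 * k) → Fin N) (z : Fin (2 * k) → Fin (ℓ - 1) → Fin N),
    (∀ i t, x i < z i t) ∧ (∀ i, StrictMono (z i)) ∧ (∀ i t, z i t < y i) ∧
    (∀ i, x i < y i) ∧
    (∀ i j : Fin (2 * k), (j : ℕ) = (i : ℕ) + 1 → y i < x j) ∧
    ∀ i j : Fin (2 * k), (j : ℕ) = (i : ℕ) + 1 → (G.Adj (x i) (y i) ↔ ¬ G.Adj (x j) (y j))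

/-- `S_n(G)` : the number of pairwise non-isomorphic (as ordered graphs) induced ordered
subgraphs of `G` of order `n`. -/
noncomputable def numSub {N : ℕ} (G : SimpleGraph (Fin N)) (n : ℕ) : ℕ :=
  {H : SimpleGraph (Fin n) | IndSub H G}.ncard
/-- The ordered graph `M^<_I(X,Y)` with `|X| = |Y| = m` (vertices `0,…,m-1` playing the
role of `x_1 < … < x_m` and vertices `m,…,2m-1` the role of `y_1 < … < y_m`). -/
def Mlt (m : ℕ) (I1 I2 I3 I4 : Bool) : SimpleGraph (Fin (2 * m)) :=
  SimpleGraph.fromRel (fun u v =>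
    ((u : ℕ) < m ∧ (v : ℕ) < m ∧ I1 = true) ∨
    (m ≤ (u : ℕ) ∧ m ≤ (v : ℕ) ∧ I4 = true) ∨
    ((u : ℕ) < m ∧ m ≤ (v : ℕ) ∧
      (((u : ℕ) < (v : ℕ) - m ∧ I2 = true) ∨
       ((v : ℕ) - m < (u : ℕ) ∧ I3 = true) ∨
       ((u : ℕ) = (v : ℕ) - m ∧ Even (u : ℕ)))))

/-- The ordered graph `M^>_I(X,Y)`: as `M^<_I(X,Y)` but with the `y`-indices reversed,
i.e. vertex `m + p` plays the role of `y_{m-p}` (so that `y_1 > y_2 > … > y_m`). -/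
def Mgt (m : ℕ) (I1 I2 I3 I4 : Bool) : SimpleGraph (Fin (2 * m)) :=
  SimpleGraph.fromRel (fun u v =>
    ((u : ℕ) < m ∧ (v : ℕ) < m ∧ I1 = true) ∨
    (m ≤ (u : ℕ) ∧ m ≤ (v : ℕ) ∧ I4 = true) ∨
    ((u : ℕ) < m ∧ m ≤ (v : ℕ) ∧
      (((u : ℕ) < 2 * m - 1 - (v : ℕ) ∧ I2 = true) ∨
       (2 * m - 1 - (v : ℕ) < (u : ℕ) ∧ I3 = true) ∨
       ((u : ℕ) = 2 * m - 1 - (v : ℕ) ∧ Even (u : ℕ)))))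

/-- `B` is a set of consecutive vertices which is pairwise 1-homogeneous. -/
def IsHomInterval {N : ℕ} (G : SimpleGraph (Fin N)) (B : Set (Fin N)) : Prop :=
  (∀ x y z : Fin N, x ∈ B → z ∈ B → x ≤ y → y ≤ z → y ∈ B) ∧
  (∀ x ∈ B, ∀ y ∈ B, lHom G 1 x y)

/-- A homogeneous block of `G`: a maximal 1-homogeneous set of consecutive vertices. -/
def IsHomBlock {N : ℕ} (G : SimpleGraph (Fin N)) (B : Set (Fin N)) : Prop :=
  B.Nonempty ∧ IsHomInterval G B ∧ ∀ B' : Set (Fin N), B ⊆ B' → IsHomInterval G B' → B = B'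

/-- `G` has at most `k` homogeneous blocks. -/
def HomBlocksLE {N : ℕ} (G : SimpleGraph (Fin N)) (k : ℕ) : Prop :=
  {B : Set (Fin N) | IsHomBlock G B}.ncard ≤ k

/-- `TailBound G k M` : the homogeneous block sequence `t_1 ≥ t_2 ≥ …` of `G` satisfies
`Σ_{i=k+2}^∞ t_i ≤ M`, i.e. some (equivalently, the largest) `k+1` homogeneous blocks
cover all but at most `M` vertices. -/
def TailBound {N : ℕ} (G : SimpleGraph (Fin N)) (k M : ℕ) : Prop :=
  ∃ S : Finset (Set (Fin N)), S.card ≤ k + 1 ∧ (∀ B ∈ S, IsHomBlock G B) ∧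
    {v : Fin N | ∀ B ∈ S, v ∉ B}.ncard ≤ M

/-- An ordered graph is irreducible if no pair of vertices `u < v` separates its edges. -/
def IrredGraph {N : ℕ} (G : SimpleGraph (Fin N)) : Prop :=
  ¬ ∃ u v : Fin N, u < v ∧
      ∀ i j : Fin N, i < j → G.Adj i j → ((j : ℕ) ≤ (u : ℕ) ∨ (v : ℕ) ≤ (i : ℕ))

/-- `G` is `ℓ`-empty: it has no edges of length at least `ℓ`. -/
def lEmpty {N : ℕ} (G : SimpleGraph (Fin N)) (ℓ : ℕ) : Prop :=
  ∀ u v : Fin N, G.Adj u v → ((u : ℤ) - (v : ℤ)).natAbs < ℓ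

/-- `IsFamSum G sz Gs` : `G = G_1 + … + G_s`, the consecutive sum of the ordered graphs
`Gs 0, …, Gs (s-1)` (of orders `sz 0, …, sz (s-1)`), with no edges between summands. -/
def IsFamSum {N s : ℕ} (G : SimpleGraph (Fin N)) (sz : Fin s → ℕ)
    (Gs : ∀ i, SimpleGraph (Fin (sz i))) : Prop :=
  N = ∑ i, sz i ∧
  ∀ u v : Fin N, G.Adj u v ↔ ∃ (i : Fin s) (x y : Fin (sz i)),
    (Gs i).Adj x y ∧
    (u : ℕ) = (∑ j ∈ Finset.univ.filter (fun j => j < i), sz j) + (x : ℕ) ∧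
    (v : ℕ) = (∑ j ∈ Finset.univ.filter (fun j => j < i), sz j) + (y : ℕ)

/-- `(Gs 0, …, Gs (s-1))` is the irreducible block decomposition of `G`:
`G = G_1 + ⋯ + G_s` with every block nonempty and irreducible.  (Such a
decomposition is unique.) -/
def IsIrredDecomp {N s : ℕ} (G : SimpleGraph (Fin N)) (sz : Fin s → ℕ)
    (Gs : ∀ i, SimpleGraph (Fin (sz i))) : Prop :=
  IsFamSum G sz Gs ∧ (∀ i, 1 ≤ sz i) ∧ ∀ i, IrredGraph (Gs i)

/-- `J_1^{(n)} = K_n`. -/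
def Jgraph1 (n : ℕ) : SimpleGraph (Fin n) := ⊤

/-- `J_2^{(n)}` : single edge `{1,n}`. -/
def Jgraph2 (n : ℕ) : SimpleGraph (Fin n) :=
  SimpleGraph.fromRel (fun u v => (u : ℕ) = 0 ∧ (v : ℕ) = n - 1)

/-- `J_3^{(n)}` : star at the first vertex. -/
def Jgraph3 (n : ℕ) : SimpleGraph (Fin n) :=
  SimpleGraph.fromRel (fun u _ => (u : ℕ) = 0)

/-- `J_4^{(n)}` : star at the last vertex. -/
def Jgraph4 (n : ℕ) : SimpleGraph (Fin n) :=
  SimpleGraph.fromRel (fun _ v => (v : ℕ) = n - 1)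

/-- `L^{(n)}` : the monotone path. -/
def Lgraph (n : ℕ) : SimpleGraph (Fin n) :=
  SimpleGraph.fromRel (fun u v => (v : ℕ) = (u : ℕ) + 1)

/-- `Q_1` : edge set `{13, 24}` on `[4]`. -/
def Qgraph1 : SimpleGraph (Fin 4) :=
  SimpleGraph.fromRel (fun u v => ((u : ℕ) = 0 ∧ (v : ℕ) = 2) ∨ ((u : ℕ) = 1 ∧ (v : ℕ) = 3))

/-- `Q_2` : edge set `{14, 23}` on `[4]`. -/
def Qgraph2 : SimpleGraph (Fin 4) :=
  SimpleGraph.fromRel (fun u v => ((u : ℕ) = 0 ∧ (v : ℕ) = 3) ∨ ((u : ℕ) = 1 ∧ (v : ℕ) = 2))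

/-- `G` is order-isomorphic to a member of the family `𝒥`. -/
def InJ {n : ℕ} (G : SimpleGraph (Fin n)) : Prop :=
  G = Jgraph1 n ∨ G = Jgraph2 n ∨ G = Jgraph3 n ∨ G = Jgraph4 n ∨ G = Lgraph n ∨
  (n = 4 ∧ IndSub G Qgraph1) ∨ (n = 4 ∧ IndSub G Qgraph2)

/-- `G` is order-isomorphic to a member of `𝒥_ℓ`. -/
def InJle (ℓ : ℕ) {n : ℕ} (G : SimpleGraph (Fin n)) : Prop :=
  (n ≤ ℓ ∧ (G = Jgraph1 n ∨ G = Jgraph2 n ∨ G = Jgraph3 n ∨ G = Jgraph4 n ∨ G = Lgraph n)) ∨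
  (4 ≤ ℓ ∧ n = 4 ∧ (IndSub G Qgraph1 ∨ IndSub G Qgraph2))

/-- `A` is a sum `B_1 + ⋯ + B_t` of members of `𝒥_ℓ` which are pairwise comparable in
the induced ordered subgraph order. -/
def InJA (ℓ : ℕ) {n : ℕ} (A : SimpleGraph (Fin n)) : Prop :=
  ∃ (t : ℕ) (sz : Fin t → ℕ) (Bs : ∀ j, SimpleGraph (Fin (sz j))),
    IsFamSum A sz Bs ∧ (∀ j, InJle ℓ (Bs j)) ∧
    ∀ j j', IndSub (Bs j) (Bs j') ∨ IndSub (Bs j') (Bs j)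

/-- `G ∈ 𝒥(k,ℓ)`. -/
def InJkl (k ℓ : ℕ) {n : ℕ} (G : SimpleGraph (Fin n)) : Prop :=
  ∃ (s : ℕ) (sz : Fin s → ℕ) (As : ∀ i, SimpleGraph (Fin (sz i))),
    s ≤ k ∧ IsFamSum G sz As ∧ ∀ i, InJA ℓ (As i)


/-- The ordered graph on `Fin n` given by the upper triangular Boolean function `r`. -/
def toG (n : ℕ) (r : ℕ → ℕ → Bool) : SimpleGraph (Fin n) where
  Adj i j := (i < j ∧ r i j = true) ∨ (j < i ∧ r j i = true)
  symm := ⟨fun i j h => by tauto⟩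
  loopless := ⟨fun i h => by rcases h with h | h <;> exact lt_irrefl _ h.1⟩

/-- the graph `toG n r` belongs to `P`. -/
def Has (P : HerProp) (n : ℕ) (r : ℕ → ℕ → Bool) : Prop := toG n r ∈ P.mem n

/-- agreement of two triangular functions below `n` -/
def Agr (n : ℕ) (r r' : ℕ → ℕ → Bool) : Prop := ∀ i j, i < j → j < n → r i j = r' i j

theorem toG_eq_iff (n : ℕ) (r r' : ℕ → ℕ → Bool) : toG n r = toG n r' ↔ Agr n r r' := by
  constructor
  · intro h i j hij hj
    have h1 : (toG n r).Adj ⟨i, by omega⟩ ⟨j, hj⟩ ↔ (toG n r').Adj ⟨i, by omega⟩ ⟨j, hj⟩ := by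
      rw [h]
    simp only [toG, Fin.mk_lt_mk, hij, true_and, not_lt_of_gt hij, false_and, or_false] at h1
    exact Bool.eq_iff_iff.mpr h1
  · intro h
    ext i j
    simp only [toG]
    constructor
    · rintro (⟨h1, h2⟩ | ⟨h1, h2⟩)
      · left; exact ⟨h1, by rw [← h _ _ h1 j.2]; exact h2⟩
      · right; exact ⟨h1, by rw [← h _ _ h1 i.2]; exact h2⟩
    · rintro (⟨h1, h2⟩ | ⟨h1, h2⟩)
      · left; exact ⟨h1, by rw [h _ _ h1 j.2]; exact h2⟩
      · right; exact ⟨h1, by rw [h _ _ h1 i.2]; exact h2⟩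

theorem exists_toG (n : ℕ) (G : SimpleGraph (Fin n)) : ∃ r, G = toG n r := by
  classical
  refine ⟨fun i j => if h : i < n ∧ j < n then decide (G.Adj ⟨i, h.1⟩ ⟨j, h.2⟩) else false, ?_⟩
  ext i j
  simp only [toG, Fin.is_lt, and_self, dite_true, decide_eq_true_eq, Fin.eta]
  constructor
  · intro h
    rcases lt_trichotomy i j with h1 | h1 | h1
    · left; exact ⟨h1, h⟩
    · subst h1; exact absurd h (G.irrefl)
    · right; exact ⟨h1, h.symm⟩
  · rintro (h | h)
    · exact h.2
    · exact h.2.symm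

theorem Has.sub {P : HerProp} {N : ℕ} {r : ℕ → ℕ → Bool} (h : Has P N r) {n : ℕ}
    {r' : ℕ → ℕ → Bool} (f : ℕ → ℕ) (hf : ∀ i j, i < j → j < n → f i < f j)
    (hN : ∀ i, i < n → f i < N)
    (hr : ∀ i j, i < j → j < n → r' i j = r (f i) (f j)) : Has P n r' := by
  refine P.hered _ _ ?_ h
  refine ⟨OrderEmbedding.ofStrictMono (fun i : Fin n => (⟨f i, hN i i.2⟩ : Fin N)) ?_, ?_⟩
  · intro i j hij
    exact hf i j hij j.2
  · intro i j
    have key : ∀ i j : Fin n, ((⟨f i, hN i i.2⟩ : Fin N) < ⟨f j, hN j j.2⟩) ↔ i < j := by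
      intro i j
      constructor
      · intro h1
        by_contra h2
        rcases lt_or_eq_of_le (not_lt.mp h2) with h3 | h3
        · have := hf j i h3 i.2
          exact absurd h1 (not_lt_of_gt this)
        · subst h3; exact lt_irrefl _ h1
      · intro h1; exact hf i j h1 j.2
    change ((i < j ∧ r' i j = true) ∨ (j < i ∧ r' j i = true)) ↔
      (((⟨f i, hN i i.2⟩ : Fin N) < ⟨f j, hN j j.2⟩ ∧ r (f i) (f j) = true) ∨
       ((⟨f j, hN j j.2⟩ : Fin N) < ⟨f i, hN i i.2⟩ ∧ r (f j) (f i) = true))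
    rw [key, key]
    constructor
    · rintro (⟨h1, h2⟩ | ⟨h1, h2⟩)
      · left; exact ⟨h1, by rw [← hr _ _ h1 j.2]; exact h2⟩
      · right; exact ⟨h1, by rw [← hr _ _ h1 i.2]; exact h2⟩
    · rintro (⟨h1, h2⟩ | ⟨h1, h2⟩)
      · left; exact ⟨h1, by rw [hr _ _ h1 j.2]; exact h2⟩
      · right; exact ⟨h1, by rw [hr _ _ h1 i.2]; exact h2⟩

theorem Has.congr {P : HerProp} {n : ℕ} {r r' : ℕ → ℕ → Bool} (h : Has P n r)
    (h' : Agr n r r') : Has P n r' := by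
  unfold Has at *
  rwa [← (toG_eq_iff n r r').mpr h']

theorem Has.mono {P : HerProp} {n m : ℕ} {r : ℕ → ℕ → Bool} (h : Has P n r)
    (hm : m ≤ n) : Has P m r :=
  h.sub id (fun _ _ h _ => h) (fun i hi => by simp; omega) (fun _ _ _ _ => rfl)

theorem card_le_speed {α : Type*} (A : Finset α) (P : HerProp) (n : ℕ)
    (Q : α → (ℕ → ℕ → Bool) → Prop)
    (hex : ∀ a ∈ A, ∃ r, Has P n r ∧ Q a r)
    (hinj : ∀ a ∈ A, ∀ b ∈ A, ∀ r r', Q a r → Q b r' → Agr n r r' → a = b) :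
    A.card ≤ speed P n := by
  classical
  choose! r hr using hex
  have h1 : (A.image (fun a => toG n (r a))).card = A.card := by
    apply card_image_of_injOn
    intro a ha b hb hab
    exact hinj a ha b hb (r a) (r b) (hr a ha).2 (hr b hb).2 ((toG_eq_iff _ _ _).mp hab)
  rw [← h1, ← Set.ncard_coe_finset]
  apply Set.ncard_le_ncard _ (Set.toFinite _)
  intro G hG
  simp only [coe_image, Set.mem_image, mem_coe] at hG
  obtain ⟨a, ha, rfl⟩ := hG
  exact (hr a ha).1

theorem speed_le_card {α : Type*} (A : Finset α) (P : HerProp) (n : ℕ)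
    (Q : α → (ℕ → ℕ → Bool) → Prop)
    (hex : ∀ r, Has P n r → ∃ a ∈ A, Q a r)
    (hinj : ∀ a ∈ A, ∀ r r', Q a r → Q a r' → Agr n r r') :
    speed P n ≤ A.card := by
  classical
  have : ∀ G ∈ P.mem n, ∃ a ∈ A, ∃ r, G = toG n r ∧ Q a r := by
    intro G hG
    obtain ⟨r, rfl⟩ := exists_toG n G
    obtain ⟨a, ha, hQ⟩ := hex r hG
    exact ⟨a, ha, r, rfl, hQ⟩
  unfold speed
  rcases isEmpty_or_nonempty α with hα | hα
  · have : P.mem n = ∅ := by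
      ext G
      simp only [Set.mem_empty_iff_false, iff_false]
      intro hG
      obtain ⟨a, _⟩ := this G hG
      exact hα.false a
    rw [this]; simp
  choose! f hf using this
  rw [← Set.ncard_coe_finset A]
  apply Set.ncard_le_ncard_of_injOn f
  · intro G hG; exact (hf G hG).1
  · intro G hG G' hG' h
    obtain ⟨h1, r, rfl, h2⟩ := hf G hG
    obtain ⟨h3, r', rfl, h4⟩ := hf G' hG'
    rw [toG_eq_iff]
    apply hinj _ h1 _ _ h2
    have h : f (toG n r) = f (toG n r') := h
    rw [h]; exact h4

/-- enumeration of a finite set of naturals -/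
theorem enum_exists (S : Finset ℕ) : ∃ g : ℕ → ℕ, (∀ i j, i < j → j < S.card → g i < g j) ∧
    (∀ i, i < S.card → g i ∈ S) ∧ (∀ s ∈ S, ∃ i, i < S.card ∧ g i = s) := by
  let e := S.orderIsoOfFin rfl
  refine ⟨fun i => if h : i < S.card then (e ⟨i, h⟩ : ℕ) else 0, ?_, ?_, ?_⟩
  · intro i j hij hj
    simp only [hj, dite_true, lt_trans hij hj]
    have : e ⟨i, lt_trans hij hj⟩ < e ⟨j, hj⟩ := e.strictMono hij
    exact this
  · intro i hi
    simp only [hi, dite_true]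
    exact (e ⟨i, hi⟩).2
  · intro s hs
    refine ⟨e.symm ⟨s, hs⟩, (e.symm ⟨s, hs⟩).2, ?_⟩
    simp

theorem enum_sub (S : Finset ℕ) (m : ℕ) (hm : m ≤ S.card) :
    ∃ g : ℕ → ℕ, (∀ i j, i < j → j < m → g i < g j) ∧ (∀ i, i < m → g i ∈ S) := by
  obtain ⟨g, h1, h2, _⟩ := enum_exists S
  exact ⟨g, fun i j h h' => h1 i j h (by omega), fun i h => h2 i (by omega)⟩

theorem pigeon {κ : Type*} [Fintype κ] (S : Finset ℕ) (f : ℕ → κ) (t : ℕ)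
    (h : Fintype.card κ * t < S.card) :
    ∃ (c : κ) (g : ℕ → ℕ), (∀ i j, i < j → j < t → g i < g j) ∧ (∀ i, i < t → g i ∈ S) ∧
      (∀ i, i < t → f (g i) = c) := by
  classical
  obtain ⟨c, -, hc⟩ := Finset.exists_lt_card_fiber_of_mul_lt_card_of_maps_to
    (s := S) (t := (Finset.univ : Finset κ)) (f := f) (n := t) (fun _ _ => mem_univ _)
    (by simpa using h)
  obtain ⟨g, h1, h2⟩ := enum_sub _ t hc.le
  refine ⟨c, g, h1, fun i hi => (mem_filter.mp (h2 i hi)).1, fun i hi => (mem_filter.mp (h2 i hi)).2⟩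

/-- partial Ramsey: colours depend only on the first index -/
theorem ramsey_pre {κ : Type*} [Fintype κ] (m : ℕ) : ∃ N : ℕ, ∀ (S : Finset ℕ), N ≤ S.card →
    ∀ col : ℕ → ℕ → κ, ∃ (g : ℕ → ℕ) (c : ℕ → κ), (∀ i j, i < j → j < m → g i < g j) ∧
      (∀ i, i < m → g i ∈ S) ∧ (∀ i j, i < j → j < m → col (g i) (g j) = c i) := by
  classical
  induction m with
  | zero =>
    by_cases hκ : Nonempty κ
    · obtain ⟨c⟩ := hκ
      exact ⟨0, fun S _ col => ⟨id, fun _ => c, by omega, by omega, by omega⟩⟩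
    · exact ⟨0, fun S _ col => absurd ⟨col 0 0⟩ hκ⟩
  | succ m ih =>
    obtain ⟨N, hN⟩ := ih
    refine ⟨Fintype.card κ * N + 2, fun S hS col => ?_⟩
    have hne : S.Nonempty := card_pos.mp (by omega)
    set a := S.min' hne with ha
    have haS : a ∈ S := S.min'_mem hne
    have hcard : Fintype.card κ * N < (S.erase a).card := by
      rw [card_erase_of_mem haS]; omega
    obtain ⟨c0, -, hc⟩ := Finset.exists_lt_card_fiber_of_mul_lt_card_of_maps_to
      (s := S.erase a) (t := (Finset.univ : Finset κ)) (f := fun x => col a x) (n := N)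
      (fun _ _ => mem_univ _) (by simpa using hcard)
    obtain ⟨g, c, h1, h2, h3⟩ := hN _ hc.le col
    have hga : ∀ i, i < m → a < g i := by
      intro i hi
      have := h2 i hi
      simp only [mem_filter, mem_erase] at this
      exact lt_of_le_of_ne (S.min'_le _ this.1.2) (Ne.symm this.1.1)
    refine ⟨fun i => if i = 0 then a else g (i - 1), fun i => if i = 0 then c0 else c (i - 1),
      ?_, ?_, ?_⟩
    · intro i j hij hj
      have hj0 : j ≠ 0 := by omega
      by_cases hi0 : i = 0
      · simp only [hi0, hj0, if_true, if_false]
        exact hga _ (by omega)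
      · simp only [hi0, hj0, if_false]
        exact h1 _ _ (by omega) (by omega)
    · intro i hi
      by_cases hi0 : i = 0
      · simp only [hi0, if_true]; exact haS
      · simp only [hi0, if_false]
        have := h2 (i - 1) (by omega)
        simp only [mem_filter, mem_erase] at this
        exact this.1.2
    · intro i j hij hj
      have hj0 : j ≠ 0 := by omega
      by_cases hi0 : i = 0
      · simp only [hi0, hj0, if_true, if_false]
        have := h2 (j - 1) (by omega)
        simp only [mem_filter] at this
        exact this.2
      · simp only [hi0, hj0, if_false]
        exact h3 _ _ (by omega) (by omega)

/-- Ramsey's theorem for pairs. -/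
theorem ramsey (κ : Type*) [Fintype κ] (T : ℕ) : ∃ N : ℕ, ∀ (col : ℕ → ℕ → κ),
    ∃ (g : ℕ → ℕ) (c : κ), (∀ i j, i < j → j < T → g i < g j) ∧
      (∀ i, i < T → g i < N) ∧ (∀ i j, i < j → j < T → col (g i) (g j) = c) := by
  classical
  obtain ⟨N, hN⟩ := ramsey_pre (κ := κ) (Fintype.card κ * T + 1)
  refine ⟨N, fun col => ?_⟩
  obtain ⟨g, c, h1, h2, h3⟩ := hN (range N) (by simp) col
  obtain ⟨c0, g', h4, h5, h6⟩ := pigeon (range (Fintype.card κ * T + 1)) c T (by simp)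
  simp only [mem_range] at h5
  refine ⟨fun i => g (g' i), c0, fun i j hij hj => ?_, fun i hi => ?_, fun i j hij hj => ?_⟩
  · exact h1 _ _ (h4 i j hij hj) (h5 j hj)
  · simpa using h2 _ (h5 i hi)
  · rw [h3 _ _ (h4 i j hij hj) (h5 j hj), h6 i (by omega)]

/-- symmetric lookup -/
def sy (r : ℕ → ℕ → Bool) (i j : ℕ) : Bool := if i < j then r i j else r j i

theorem sy_lt {r : ℕ → ℕ → Bool} {i j : ℕ} (h : i < j) : sy r i j = r i j := by simp [sy, h]
theorem sy_gt {r : ℕ → ℕ → Bool} {i j : ℕ} (h : j < i) : sy r i j = r j i := by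
  simp [sy, not_lt_of_gt h]
theorem sy_comm {r : ℕ → ℕ → Bool} (i j : ℕ) : sy r i j = sy r j i := by
  rcases lt_trichotomy i j with h | h | h
  · rw [sy_lt h, sy_gt h]
  · rw [h]
  · rw [sy_lt h, sy_gt h]

theorem mono_ge {n : ℕ} {f : ℕ → ℕ} (hf : ∀ i j, i < j → j < n → f i < f j) (i : ℕ)
    (hi : i < n) : i ≤ f i := by
  induction i with
  | zero => omega
  | succ i ih => have := hf i (i + 1) (by omega) hi; have := ih (by omega); omega

theorem mono_of_succ {n : ℕ} {f : ℕ → ℕ} (hf : ∀ i, i + 1 < n → f i < f (i + 1)) :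
    ∀ i j, i < j → j < n → f i < f j := by
  intro i j hij hj
  induction j with
  | zero => omega
  | succ j ih =>
    rcases Nat.lt_or_ge i j with h | h
    · exact lt_trans (ih h (by omega)) (hf j hj)
    · have : i = j := by omega
      subst this; exact hf i hj

theorem mono_inj {n : ℕ} {f : ℕ → ℕ} (hf : ∀ i j, i < j → j < n → f i < f j) {i j : ℕ}
    (hi : i < n) (hj : j < n) (h : f i = f j) : i = j := by
  rcases lt_trichotomy i j with h1 | h1 | h1
  · have := hf i j h1 hj; omega
  · exact h1
  · have := hf j i h1 hi; omega

theorem mono_le {n : ℕ} {f : ℕ → ℕ} (hf : ∀ i j, i < j → j < n → f i < f j) {i j : ℕ}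
    (hij : i ≤ j) (hj : j < n) : f i ≤ f j := by
  rcases hij.eq_or_lt with h | h
  · rw [h]
  · exact (hf i j h hj).le

theorem mono_lt_iff {n : ℕ} {f : ℕ → ℕ} (hf : ∀ i j, i < j → j < n → f i < f j) {i j : ℕ}
    (hi : i < n) (hj : j < n) : f i < f j ↔ i < j := by
  constructor
  · intro h
    by_contra h1
    have := mono_le hf (not_lt.mp h1) hi; omega
  · intro h; exact hf i j h hj

theorem bits_le_speed (P : HerProp) (n : ℕ)
    (h : ∀ b : ℕ → Bool, ∃ r, Has P n r ∧ ∀ i, i < n - 1 → r 0 (i + 1) = b i) :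
    2 ^ (n - 1) ≤ speed P n := by
  classical
  have := card_le_speed (range (n - 1)).powerset P n
    (fun V r => ∀ i, i < n - 1 → r 0 (i + 1) = decide (i ∈ V))
    (fun V _ => h (fun i => decide (i ∈ V))) ?_
  · simpa using this
  · intro V hV W hW r r' h1 h2 h3
    simp only [mem_powerset] at hV hW
    ext i
    by_cases hi : i < n - 1
    · have := h1 i hi
      rw [h3 0 (i + 1) (by omega) (by omega), h2 i hi] at this
      simpa using this.symm
    · exact ⟨fun h => absurd (mem_range.mp (hV h)) hi, fun h => absurd (mem_range.mp (hW h)) hi⟩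

theorem bits_le_speed' (P : HerProp) (n : ℕ)
    (h : ∀ b : ℕ → Bool, ∃ r, Has P n r ∧ ∀ i, i < n - 1 → r i (n - 1) = b i) :
    2 ^ (n - 1) ≤ speed P n := by
  classical
  have := card_le_speed (range (n - 1)).powerset P n
    (fun V r => ∀ i, i < n - 1 → r i (n - 1) = decide (i ∈ V))
    (fun V _ => h (fun i => decide (i ∈ V))) ?_
  · simpa using this
  · intro V hV W hW r r' h1 h2 h3
    simp only [mem_powerset] at hV hW
    ext i
    by_cases hi : i < n - 1
    · have := h1 i hi
      rw [h3 i (n - 1) (by omega) (by omega), h2 i hi] at this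
      simpa using this.symm
    · exact ⟨fun h => absurd (mem_range.mp (hV h)) hi, fun h => absurd (mem_range.mp (hW h)) hi⟩

/-- type 1 structure with the centre on the left -/
theorem T1R {P : HerProp} {N : ℕ} {r : ℕ → ℕ → Bool} (h : Has P N r) (n y : ℕ) (hy : y < N)
    (p q : ℕ → ℕ) (hp : ∀ i, i < n - 1 → y < p i ∧ p i < N)
    (hq : ∀ i, i < n - 1 → y < q i ∧ q i < N)
    (hpq : ∀ i, i < n - 1 → r y (p i) ≠ r y (q i))
    (hlt : ∀ i j, i < j → j < n - 1 → p i < p j ∧ p i < q j ∧ q i < p j ∧ q i < q j) :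
    2 ^ (n - 1) ≤ speed P n := by
  apply bits_le_speed
  intro b
  have hx : ∀ i, ∃ x, i < n - 1 → (x = p i ∨ x = q i) ∧ r y x = b i := by
    intro i
    by_cases hi : i < n - 1
    · have := hpq i hi
      by_cases h1 : r y (p i) = b i
      · exact ⟨p i, fun _ => ⟨Or.inl rfl, h1⟩⟩
      · refine ⟨q i, fun _ => ⟨Or.inr rfl, ?_⟩⟩
        revert this h1
        cases r y (p i) <;> cases r y (q i) <;> cases b i <;> simp
    · exact ⟨0, fun h => absurd h hi⟩
  choose x hx using hx
  have hf : ∀ i j, i < j → j < n → (if i = 0 then y else x (i - 1)) <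
      (if j = 0 then y else x (j - 1)) := by
    intro i j hij hj
    have hj0 : j ≠ 0 := by omega
    simp only [hj0, if_false]
    have h1 := (hx (j - 1) (by omega)).1
    have h2 := hp (j - 1) (by omega)
    have h3 := hq (j - 1) (by omega)
    by_cases hi : i = 0
    · simp only [hi, if_true]
      rcases h1 with h1 | h1 <;> rw [h1] <;> omega
    · simp only [hi, if_false]
      have h4 := (hx (i - 1) (by omega)).1
      have h5 := hlt (i - 1) (j - 1) (by omega) (by omega)
      rcases h1 with h1 | h1 <;> rcases h4 with h4 | h4 <;> rw [h1, h4] <;> omega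
  refine ⟨fun i j => r (if i = 0 then y else x (i - 1)) (if j = 0 then y else x (j - 1)),
    h.sub (fun i => if i = 0 then y else x (i - 1)) hf ?_ (fun _ _ _ _ => rfl), ?_⟩
  · intro i hi
    by_cases hi0 : i = 0
    · simpa [hi0] using hy
    · simp only [hi0, if_false]
      have h2 := hp (i - 1) (by omega)
      have h3 := hq (i - 1) (by omega)
      rcases (hx (i - 1) (by omega)).1 with h1 | h1 <;> rw [h1] <;> omega
  · intro i hi
    simpa using (hx i hi).2

/-- type 1 structure with the centre on the right -/
theorem T1L {P : HerProp} {N : ℕ} {r : ℕ → ℕ → Bool} (h : Has P N r) (n y : ℕ) (hy : y < N)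
    (p q : ℕ → ℕ) (hp : ∀ i, i < n - 1 → p i < y)
    (hq : ∀ i, i < n - 1 → q i < y)
    (hpq : ∀ i, i < n - 1 → r (p i) y ≠ r (q i) y)
    (hlt : ∀ i j, i < j → j < n - 1 → p i < p j ∧ p i < q j ∧ q i < p j ∧ q i < q j) :
    2 ^ (n - 1) ≤ speed P n := by
  apply bits_le_speed'
  intro b
  have hx : ∀ i, ∃ x, i < n - 1 → (x = p i ∨ x = q i) ∧ r x y = b i := by
    intro i
    by_cases hi : i < n - 1
    · have := hpq i hi
      by_cases h1 : r (p i) y = b i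
      · exact ⟨p i, fun _ => ⟨Or.inl rfl, h1⟩⟩
      · refine ⟨q i, fun _ => ⟨Or.inr rfl, ?_⟩⟩
        revert this h1
        cases r (p i) y <;> cases r (q i) y <;> cases b i <;> simp
    · exact ⟨0, fun h => absurd h hi⟩
  choose x hx using hx
  have hf : ∀ i j, i < j → j < n → (if i < n - 1 then x i else y) <
      (if j < n - 1 then x j else y) := by
    intro i j hij hj
    have hi0 : i < n - 1 := by omega
    simp only [hi0, if_true]
    have h1 := (hx i (by omega)).1
    have h2 := hp i (by omega)
    have h3 := hq i (by omega)
    by_cases hj : j < n - 1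
    · simp only [hj, if_true]
      have h4 := (hx j (by omega)).1
      have h5 := hlt i j (by omega) (by omega)
      rcases h1 with h1 | h1 <;> rcases h4 with h4 | h4 <;> rw [h1, h4] <;> omega
    · simp only [hj, if_false]
      rcases h1 with h1 | h1 <;> rw [h1] <;> omega
  refine ⟨fun i j => r (if i < n - 1 then x i else y) (if j < n - 1 then x j else y),
    h.sub (fun i => if i < n - 1 then x i else y) hf ?_ (fun _ _ _ _ => rfl), ?_⟩
  · intro i hi
    by_cases hi0 : i < n - 1
    · simp only [hi0, if_true]
      have h2 := hp i (by omega)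
      have h3 := hq i (by omega)
      rcases (hx i (by omega)).1 with h1 | h1 <;> rw [h1] <;> omega
    · simpa [hi0] using hy
  · intro i hi
    simpa [hi] using (hx i hi).2

/-- irreducibility with respect to background colour `e` -/
def Irr (e : Bool) (n : ℕ) (r : ℕ → ℕ → Bool) : Prop :=
  ∀ g, 0 < g → g < n → ∃ i j, i < g ∧ g ≤ j ∧ j < n ∧ r i j ≠ e

theorem Irr.congr {e : Bool} {n : ℕ} {r r' : ℕ → ℕ → Bool} (h : Irr e n r) (h' : Agr n r r') :
    Irr e n r' := by
  intro g h0 hg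
  obtain ⟨i, j, h1, h2, h3, h4⟩ := h g h0 hg
  exact ⟨i, j, h1, h2, h3, by rw [← h' i j (by omega) h3]; exact h4⟩

theorem irr_del (e : Bool) (n : ℕ) (r : ℕ → ℕ → Bool) (h : Irr e (n + 1) r) :
    ∃ f : ℕ → ℕ, (∀ i j, i < j → j < n → f i < f j) ∧ (∀ i, i < n → f i < n + 1) ∧
      Irr e n (fun i j => r (f i) (f j)) := by
  by_cases hn : n < 2
  · exact ⟨id, fun _ _ h _ => h, fun i hi => by simp; omega, fun g h0 h1 => by omega⟩
  classical
  set S := (range (n + 1)).filter (fun j => 0 < j ∧ r 0 j ≠ e) with hS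
  have hne : S.Nonempty := by
    obtain ⟨i, j, h1, h2, h3, h4⟩ := h 1 (by omega) (by omega)
    have : i = 0 := by omega
    subst this
    exact ⟨j, by simp only [hS, mem_filter, mem_range]; exact ⟨h3, by omega, h4⟩⟩
  set r1 := S.max' hne with hr1
  have hr1S : r1 ∈ S := S.max'_mem hne
  have hmax : ∀ j, j < n + 1 → 0 < j → r 0 j ≠ e → j ≤ r1 := by
    intro j h1 h2 h3
    exact S.le_max' _ (by simp only [hS, mem_filter, mem_range]; exact ⟨h1, h2, h3⟩)
  simp only [hS, mem_filter, mem_range] at hr1S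
  by_cases hc : ∃ j, r1 < j ∧ j < n + 1 ∧ 1 < j ∧ r 1 j ≠ e
  · obtain ⟨j1, hj1, hj2, hj3, hj4⟩ := hc
    refine ⟨fun i => i + 1, fun _ _ h _ => by simp; omega, fun i hi => by simp; omega, ?_⟩
    intro g hg0 hg
    obtain ⟨i, j, h1, h2, h3, h4⟩ := h (g + 1) (by omega) (by omega)
    by_cases hi : i = 0
    · subst hi
      have := hmax j h3 (by omega) h4
      refine ⟨0, j1 - 1, hg0, by omega, by omega, ?_⟩
      have e1 : j1 - 1 + 1 = j1 := by omega
      simp only [e1]; exact hj4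
    · refine ⟨i - 1, j - 1, by omega, by omega, by omega, ?_⟩
      have e1 : j - 1 + 1 = j := by omega
      have e2 : i - 1 + 1 = i := by omega
      simp only [e1, e2]; exact h4
  · push Not at hc
    refine ⟨fun i => if i = 0 then 0 else i + 1, fun i j h _ => ?_, fun i hi => ?_, ?_⟩
    · simp only [show j ≠ 0 by omega, if_false]; split_ifs <;> omega
    · simp only []; split_ifs <;> omega
    intro g hg0 hg
    obtain ⟨i, j, h1, h2, h3, h4⟩ := h (g + 1) (by omega) (by omega)
    by_cases hi : i = 1
    · subst hi
      have hj : j ≤ r1 := by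
        by_contra hcon
        exact h4 (hc j (by omega) h3 (by omega))
      refine ⟨0, r1 - 1, hg0, by omega, by omega, ?_⟩
      have e1 : r1 - 1 + 1 = r1 := by omega
      simp only [show r1 - 1 ≠ 0 by omega, if_true, if_false, e1]; exact hr1S.2.2
    · by_cases hi0 : i = 0
      · subst hi0
        refine ⟨0, j - 1, by omega, by omega, by omega, ?_⟩
        have e1 : j - 1 + 1 = j := by omega
        simp only [show j - 1 ≠ 0 by omega, if_true, if_false, e1]; exact h4
      · refine ⟨i - 1, j - 1, by omega, by omega, by omega, ?_⟩
        have e1 : j - 1 + 1 = j := by omega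
        have e2 : i - 1 + 1 = i := by omega
        simp only [show j - 1 ≠ 0 by omega, show i - 1 ≠ 0 by omega, if_false, e1, e2]; exact h4

theorem irr_sub (e : Bool) (m n : ℕ) (hmn : m ≤ n) (r : ℕ → ℕ → Bool) (h : Irr e n r) :
    ∃ f : ℕ → ℕ, (∀ i j, i < j → j < m → f i < f j) ∧ (∀ i, i < m → f i < n) ∧
      Irr e m (fun i j => r (f i) (f j)) := by
  obtain ⟨d, hd⟩ := Nat.exists_eq_add_of_le hmn
  clear hmn
  subst hd
  induction d generalizing r with
  | zero => exact ⟨id, fun _ _ h _ => h, fun i h => h, h⟩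
  | succ d ih =>
    obtain ⟨f, h1, h2, h3⟩ := irr_del e (m + d) r h
    obtain ⟨g, h4, h5, h6⟩ := ih _ h3
    exact ⟨fun i => f (g i), fun i j hij hj => h1 _ _ (h4 i j hij hj) (h5 j hj),
      fun i hi => h2 _ (h5 i hi), h6⟩

/-- repetition of the block `D` of size `K` with background colour `e` -/
def rep (e : Bool) (K : ℕ) (D : ℕ → ℕ → Bool) (i j : ℕ) : Bool :=
  if i / K = j / K then D (i % K) (j % K) else e

/-- concatenation with background colour `e` -/
def cat (e : Bool) (l : ℕ) (L H : ℕ → ℕ → Bool) (i j : ℕ) : Bool :=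
  if j < l then L i j else if l ≤ i then H (i - l) (j - l) else e

theorem sumwords (P : HerProp) (e : Bool) (K : ℕ) (D : ℕ → ℕ → Bool)
    {ι : Type} [Fintype ι] (sz : ι → ℕ) (L : ι → ℕ → ℕ → Bool) (f : ι → ℕ → ℕ)
    (hsz : ∀ a, 1 ≤ sz a) (hirr : ∀ a, Irr e (sz a) (L a))
    (hf : ∀ a i j, i < j → j < sz a → f a i < f a j)
    (hfK : ∀ a i, i < sz a → f a i < K)
    (hL : ∀ a i j, i < j → j < sz a → L a i j = D (f a i) (f a j))
    (hdist : ∀ a b, sz a = sz b → Agr (sz a) (L a) (L b) → a = b)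
    (w : ℕ → ℕ) (n : ℕ) (hP : Has P (n * K) (rep e K D)) (hw0 : w 0 ≤ 1)
    (hw : ∀ m, 1 ≤ m → w m ≤ ∑ a ∈ univ.filter (fun a => sz a ≤ m), w (m - sz a)) :
    w n ≤ speed P n := by
  classical
  let E : ℕ → (ℕ → ℕ → Bool) → Prop := fun m r => ∃ g : ℕ → ℕ,
    (∀ i j, i < j → j < m → g i < g j) ∧ (∀ i, i < m → g i < m * K) ∧
    (∀ i j, i < j → j < m → r i j = rep e K D (g i) (g j))
  let S : (m : ℕ) → Finset (SimpleGraph (Fin m)) := fun m =>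
    univ.filter (fun G => ∃ r, G = toG m r ∧ E m r)
  have hS : ∀ m, w m ≤ (S m).card := by
    intro m
    induction m using Nat.strong_induction_on with
    | _ m ih =>
      rcases Nat.eq_zero_or_pos m with rfl | hm
      · refine le_trans hw0 ?_
        rw [Nat.one_le_iff_ne_zero, ← Nat.pos_iff_ne_zero, card_pos]
        refine ⟨toG 0 (fun _ _ => false), ?_⟩
        simp only [S, mem_filter, mem_univ, true_and]
        exact ⟨_, rfl, id, by omega, by omega, by omega⟩
      refine le_trans (hw m hm) ?_
      calc ∑ a ∈ univ.filter (fun a => sz a ≤ m), w (m - sz a)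
          ≤ ∑ a ∈ univ.filter (fun a => sz a ≤ m), (S (m - sz a)).card :=
            sum_le_sum (fun a ha => ih _ (by have := hsz a; omega))
        _ = ((univ.filter (fun a => sz a ≤ m)).sigma (fun a => S (m - sz a))).card :=
            (card_sigma _ _).symm
        _ ≤ (S m).card := by
            have hr : ∀ x : (Σ a, SimpleGraph (Fin (m - sz a))), ∃ r, x.2 = toG (m - sz x.1) r ∧
                (x.2 ∈ S (m - sz x.1) → E (m - sz x.1) r) := by
              intro x
              by_cases hx : x.2 ∈ S (m - sz x.1)
              · obtain ⟨r, h1, h2⟩ := (mem_filter.mp hx).2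
                exact ⟨r, h1, fun _ => h2⟩
              · obtain ⟨r, h1⟩ := exists_toG _ x.2
                exact ⟨r, h1, fun h => absurd h hx⟩
            choose R hR hRE using hr
            apply card_le_card_of_injOn
              (fun x => toG m (cat e (sz x.1) (L x.1) (R x)))
            · intro x hx
              simp only [coe_sigma, Set.mem_sigma_iff, mem_coe, mem_filter, mem_univ,
                true_and] at hx
              obtain ⟨hxm, hxS⟩ := hx
              simp only [S, coe_filter, mem_univ, true_and, Set.mem_ofPred_eq]
              refine ⟨_, rfl, ?_⟩
              obtain ⟨g, h1, h2, h3⟩ := hRE x hxS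
              have hs := hsz x.1
              have hK : 0 < K := lt_of_le_of_lt (Nat.zero_le _) (hfK x.1 0 hs)
              have hmul : K + (m - sz x.1) * K ≤ m * K := by
                calc K + (m - sz x.1) * K = ((m - sz x.1) + 1) * K := by ring
                  _ ≤ m * K := Nat.mul_le_mul_right _ (by omega)
              refine ⟨fun i => if i < sz x.1 then f x.1 i else K + g (i - sz x.1), ?_, ?_, ?_⟩
              · intro i j hij hj
                by_cases hj' : j < sz x.1
                · simp only [hj', lt_trans hij hj', if_true]; exact hf _ _ _ hij hj'
                · simp only [hj', if_false]
                  by_cases hi : i < sz x.1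
                  · simp only [hi, if_true]; have := hfK x.1 i hi; omega
                  · simp only [hi, if_false]
                    have := h1 (i - sz x.1) (j - sz x.1) (by omega) (by omega); omega
              · intro i hi
                by_cases hi' : i < sz x.1
                · simp only [hi', if_true]
                  have := hfK x.1 i hi'
                  omega
                · simp only [hi', if_false]
                  have := h2 (i - sz x.1) (by omega)
                  omega
              · intro i j hij hj
                by_cases hj' : j < sz x.1
                · have hi' := lt_trans hij hj'
                  simp only [cat, hj', hi', if_true]
                  rw [hL _ _ _ hij hj']
                  have k1 := hfK x.1 i hi'
                  have k2 := hfK x.1 j hj'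
                  simp only [rep, Nat.div_eq_of_lt k1, Nat.div_eq_of_lt k2, if_true,
                    Nat.mod_eq_of_lt k1, Nat.mod_eq_of_lt k2]
                · by_cases hi : i < sz x.1
                  · have k1 := hfK x.1 i hi
                    have hi2 : ¬ sz x.1 ≤ i := by omega
                    simp only [cat, hj', hi, hi2, if_true, if_false]
                    simp only [rep, Nat.div_eq_of_lt k1, Nat.add_div_left _ hK]
                    simp
                  · have hi2 : sz x.1 ≤ i := by omega
                    simp only [cat, hj', hi, hi2, if_true, if_false]
                    rw [h3 _ _ (by omega) (by omega)]
                    simp only [rep, Nat.add_div_left _ hK, Nat.add_mod_left]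
                    simp
            · intro x hx y hy hxy
              have hxy' := (toG_eq_iff _ _ _).mp hxy
              simp only [coe_sigma, Set.mem_sigma_iff, mem_coe, mem_filter, mem_univ,
                true_and] at hx hy
              have key : ∀ x y : (Σ a, SimpleGraph (Fin (m - sz a))), sz x.1 ≤ m → sz y.1 ≤ m →
                  Agr m (cat e (sz x.1) (L x.1) (R x)) (cat e (sz y.1) (L y.1) (R y)) →
                  sz y.1 ≤ sz x.1 := by
                intro x y hx hy hxy
                by_contra hcon
                push Not at hcon
                obtain ⟨i, j, h1, h2, h3, h4⟩ := hirr y.1 (sz x.1) (hsz _) hcon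
                have := hxy i j (by omega) (by omega)
                simp only [cat, h3, if_true, not_lt_of_ge h2, if_false, not_le_of_gt h1] at this
                exact h4 this.symm
              have hsxy : sz x.1 = sz y.1 := le_antisymm
                (key y x hy.1 hx.1 (fun i j h h' => (hxy' i j h h').symm)) (key x y hx.1 hy.1 hxy')
              have hab : x.1 = y.1 := by
                apply hdist _ _ hsxy
                intro i j hij hj
                have := hxy' i j hij (by omega)
                simpa only [cat, ← hsxy, hj, if_true] using this
              rcases x with ⟨a, G⟩
              rcases y with ⟨b, H⟩
              simp only at hab
              subst hab
              congr 1
              have hG1 := hR ⟨a, G⟩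
              have hH1 := hR ⟨a, H⟩
              simp only at hG1 hH1
              rw [hG1, hH1]
              apply (toG_eq_iff _ _ _).mpr
              intro i j hij hj
              have := hxy' (i + sz a) (j + sz a) (by omega) (by omega)
              simpa [cat] using this
  refine le_trans (hS n) ?_
  unfold speed
  rw [← Set.ncard_coe_finset]
  apply Set.ncard_le_ncard _ (Set.toFinite _)
  intro G hG
  simp only [S, coe_filter, mem_univ, true_and, Set.mem_ofPred_eq] at hG
  obtain ⟨r, rfl, g, h1, h2, h3⟩ := hG
  exact hP.sub g h1 h2 h3

theorem sum_filter_fin (k m : ℕ) (w : ℕ → ℕ) :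
    ∑ a ∈ (univ : Finset (Fin k)).filter (fun a : Fin k => (a : ℕ) + 1 ≤ m), w (m - ((a : ℕ) + 1)) =
    ∑ i ∈ range k, if i + 1 ≤ m then w (m - (i + 1)) else 0 := by
  rw [sum_filter, Finset.sum_range (fun i => if i + 1 ≤ m then w (m - (i + 1)) else 0)]

theorem irr_sub_fam (e : Bool) (n : ℕ) (r : ℕ → ℕ → Bool) (h : Irr e n r) :
    ∃ f : ℕ → ℕ → ℕ, ∀ m, m ≤ n → (∀ i j, i < j → j < m → f m i < f m j) ∧
      (∀ i, i < m → f m i < n) ∧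
      Irr e m (fun i j => r (f m i) (f m j)) ∧ (m = n → ∀ i, f m i = i) := by
  have : ∀ m, ∃ f : ℕ → ℕ, m ≤ n → (∀ i j, i < j → j < m → f i < f j) ∧ (∀ i, i < m → f i < n) ∧
      Irr e m (fun i j => r (f i) (f j)) ∧ (m = n → ∀ i, f i = i) := by
    intro m
    by_cases hm : m = n
    · subst hm
      exact ⟨id, fun _ => ⟨fun _ _ h _ => h, fun i h => h, h, fun _ _ => rfl⟩⟩
    · by_cases hmn : m ≤ n
      · obtain ⟨f, h1, h2, h3⟩ := irr_sub e m n hmn r h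
        exact ⟨f, fun _ => ⟨h1, h2, h3, fun h => absurd h hm⟩⟩
      · exact ⟨id, fun h => absurd h hmn⟩
  choose f hf using this
  exact ⟨f, hf⟩

theorem genFib_le_speed (P : HerProp) (e : Bool) (k : ℕ) (D : ℕ → ℕ → Bool) (hD : Irr e k D)
    (n : ℕ) (hP : Has P (n * k) (rep e k D)) : genFib k n ≤ speed P n := by
  obtain ⟨f, hf⟩ := irr_sub_fam e k D hD
  refine sumwords P e k D (ι := Fin k) (fun a => (a : ℕ) + 1)
    (fun a i j => D (f (a + 1) i) (f (a + 1) j)) (fun a => f (a + 1)) (fun a => by omega)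
    (fun a => (hf (a + 1) a.2).2.2.1) (fun a => (hf (a + 1) a.2).1)
    (fun a => (hf (a + 1) a.2).2.1) (fun _ _ _ _ _ => rfl) ?_ (genFib k) n hP ?_ ?_
  · intro a b hab _
    exact Fin.ext (by omega)
  · rw [genFib]
  · intro m hm
    obtain ⟨m, rfl⟩ := Nat.exists_eq_succ_of_ne_zero (by omega : m ≠ 0)
    rw [sum_filter_fin, genFib]
    apply sum_le_sum
    intro i hi
    simp only [Nat.succ_eq_add_one, Nat.add_le_add_iff_right, Nat.add_sub_add_right, le_refl]

theorem sum_two_pow (n : ℕ) (hn : 1 ≤ n) : ∑ t ∈ range n, 2 ^ (t - 1) = 2 ^ (n - 1) := by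
  induction n with
  | zero => omega
  | succ n ih =>
    rw [sum_range_succ]
    rcases Nat.eq_zero_or_pos n with rfl | h
    · simp
    · rw [ih h]
      obtain ⟨m, rfl⟩ := Nat.exists_eq_succ_of_ne_zero (by omega : n ≠ 0)
      simp [pow_succ]; ring

theorem genFib_ge (k n : ℕ) (hn : n ≤ k) : 2 ^ (n - 1) ≤ genFib k n := by
  induction n using Nat.strong_induction_on with
  | _ n ih =>
    rcases Nat.eq_zero_or_pos n with rfl | h
    · simp [genFib]
    · rw [← sum_two_pow n h]
      obtain ⟨m, rfl⟩ := Nat.exists_eq_succ_of_ne_zero (by omega : n ≠ 0)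
      rw [genFib, ← sum_range_reflect]
      calc _ ≤ ∑ i ∈ range (m + 1), if i ≤ m then genFib k (m - i) else 0 := by
            apply sum_le_sum
            intro i hi
            simp only [mem_range] at hi
            rw [if_pos (by omega)]
            have := ih (m - i) (by omega) (by omega)
            simpa using this
        _ ≤ _ := sum_le_sum_of_subset (by
            intro x; simp only [mem_range]; omega)

theorem genFib_pos (k n : ℕ) (hk : 1 ≤ k) : 1 ≤ genFib k n := by
  induction n with
  | zero => simp [genFib]
  | succ n ih =>
    rw [genFib]
    refine le_trans ?_ (single_le_sum (f := fun i => if i ≤ n then genFib k (n - i) else 0)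
      (fun _ _ => Nat.zero_le _) (mem_range.mpr (by omega : 0 < k)))
    simpa using ih

theorem two_pow_alt (j n : ℕ) (hj : 1 ≤ j) (hn : 1 ≤ n) :
    2 ^ (n - 1) ≤ (∑ i ∈ range j, if i + 1 ≤ n then 2 ^ (n - (i + 1) - 1) else 0) +
      (if j ≤ n then 2 ^ (n - j - 1) else 0) := by
  by_cases hjn : n < j
  · rw [← sum_two_pow n hn, ← sum_range_reflect]
    refine le_trans ?_ (Nat.le_add_right _ _)
    calc _ ≤ ∑ i ∈ range n, if i + 1 ≤ n then 2 ^ (n - (i + 1) - 1) else 0 := by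
          apply sum_le_sum
          intro i hi
          simp only [mem_range] at hi
          rw [if_pos (by omega)]
          apply Nat.pow_le_pow_right (by norm_num); omega
      _ ≤ _ := sum_le_sum_of_subset (by intro x; simp only [mem_range]; omega)
  · push Not at hjn
    rw [if_pos hjn]
    induction j with
    | zero => omega
    | succ j ih =>
      rw [sum_range_succ, if_pos hjn]
      rcases Nat.eq_zero_or_pos j with rfl | h
      · simp only [range_zero, sum_empty, zero_add]
        obtain ⟨m, rfl⟩ := Nat.exists_eq_succ_of_ne_zero (by omega : n ≠ 0)
        rcases Nat.eq_zero_or_pos m with rfl | h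
        · simp
        · obtain ⟨l, rfl⟩ := Nat.exists_eq_succ_of_ne_zero (by omega : m ≠ 0)
          simp [pow_succ]; omega
      · have h1 := ih h (by omega)
        refine le_trans h1 ?_
        have : 2 ^ (n - j - 1) ≤ 2 ^ (n - (j + 1) - 1) + 2 ^ (n - (j + 1) - 1) := by
          rw [← two_mul, ← pow_succ']
          apply Nat.pow_le_pow_right (by norm_num); omega
        omega

/-- two different irreducible blocks of the same size, alternately repeated -/
theorem alt_le_speed (P : HerProp) (e : Bool) (j : ℕ) (A B : ℕ → ℕ → Bool) (hA : Irr e j A)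
    (hB : Irr e j B) (hAB : ¬ Agr j A B) (n : ℕ)
    (hP : Has P (n * (2 * j)) (rep e (2 * j) (cat e j A B))) : 2 ^ (n - 1) ≤ speed P n := by
  obtain ⟨f, hf⟩ := irr_sub_fam e j A hA
  have hj : 1 ≤ j := by
    by_contra h
    exact hAB (fun i l h1 h2 => by omega)
  refine sumwords P e (2 * j) (cat e j A B) (ι := Fin j ⊕ Unit)
    (fun a => Sum.elim (fun a : Fin j => (a : ℕ) + 1) (fun _ => j) a)
    (fun a => Sum.elim (fun (a : Fin j) i l => A (f (a + 1) i) (f (a + 1) l)) (fun _ => B) a)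
    (fun a => Sum.elim (fun a : Fin j => f (a + 1)) (fun _ i => j + i) a)
    ?_ ?_ ?_ ?_ ?_ ?_ (fun n => 2 ^ (n - 1)) n hP (by simp) ?_
  · rintro (a | a) <;> simp [hj]
  · rintro (a | a)
    · exact (hf (a + 1) a.2).2.2.1
    · exact hB
  · rintro (a | a)
    · exact (hf (a + 1) a.2).1
    · intro i l h _; simpa using h
  · rintro (a | a)
    · intro i hi
      have := (hf (a + 1) a.2).2.1 i hi
      simp only [Sum.elim_inl]; omega
    · intro i hi
      simp only [Sum.elim_inr] at hi ⊢; omega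
  · rintro (a | a)
    · intro i l hil hl
      have := (hf (a + 1) a.2).2.1 l hl
      simp only [Sum.elim_inl, cat, this, if_true]
    · intro i l hil hl
      simp [cat]
  · rintro (a | a) (b | b) h1 h2
    · congr 1; simp only [Sum.elim_inl] at h1; exact Fin.ext (by omega)
    · exfalso
      simp only [Sum.elim_inl, Sum.elim_inr] at h1 h2
      have := (hf (a + 1) a.2).2.2.2 h1
      apply hAB
      intro i l hil hl
      have h3 := h2 i l hil (by omega)
      simpa only [this] using h3
    · exfalso
      simp only [Sum.elim_inl, Sum.elim_inr] at h1 h2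
      have := (hf (b + 1) b.2).2.2.2 h1.symm
      apply hAB
      intro i l hil hl
      have h3 := h2 i l hil (by omega)
      simpa only [this] using h3.symm
    · rfl
  · intro m hm
    refine le_trans (two_pow_alt j m hj hm) ?_
    rw [sum_filter, Fintype.sum_sum_type]
    simp only [Sum.elim_inl, Sum.elim_inr, univ_unique, sum_singleton]
    rw [Finset.sum_range (fun i => if i + 1 ≤ m then 2 ^ (m - (i + 1) - 1) else 0)]
    exact le_refl _

/-- the type 2 model -/
def Mod2 (nest a b c d : Bool) (T : ℕ) (s : ℕ → Bool) (i j : ℕ) : Bool :=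
  if j < T then a else if T ≤ i then d else
    if i < (if nest then 2 * T - 1 - j else j - T) then b else
    if (if nest then 2 * T - 1 - j else j - T) < i then c else s i

/-- labelled graph -/
def Lab (p : ℕ) (a b c d : Bool) (x : ℕ → ℕ) (s : ℕ → Bool) (i j : ℕ) : Bool :=
  if j < p then a else if p ≤ i then d else
    if x i < x j then b else if x j < x i then c else s (x i)

theorem lab_has {P : HerProp} {nest a b c d : Bool} {T : ℕ}
    (hP : ∀ s, Has P (2 * T) (Mod2 nest a b c d T s)) (n p : ℕ) (x : ℕ → ℕ)
    (hx : ∀ i, i < n → x i < T) (h1 : ∀ i j, i < j → j < p → j < n → x i < x j)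
    (h2 : ∀ i j, p ≤ i → i < j → j < n → if nest then x j < x i else x i < x j) (s : ℕ → Bool) :
    Has P n (Lab p a b c d x s) := by
  refine (hP s).sub (fun i => if i < p then x i else if nest then 2 * T - 1 - x i else T + x i)
    ?_ ?_ ?_
  · intro i j hij hj
    have hxi := hx i (by omega)
    have hxj := hx j hj
    by_cases hjp : j < p
    · simp only [hjp, lt_trans hij hjp, if_true]; exact h1 _ _ hij hjp hj
    · by_cases hip : i < p
      · simp only [hjp, hip, if_true, if_false]; split_ifs <;> omega
      · simp only [hjp, hip, if_false]
        have := h2 i j (by omega) hij hj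
        split_ifs at this ⊢ <;> omega
  · intro i hi
    have hxi := hx i hi
    split_ifs <;> omega
  · intro i j hij hj
    have hxi := hx i (by omega)
    have hxj := hx j hj
    by_cases hjp : j < p
    · simp only [Lab, Mod2, hjp, lt_trans hij hjp, if_true, hxj]
    · by_cases hip : i < p
      · simp only [Lab, Mod2, hjp, hip, if_true, if_false]
        cases nest
        · simp [not_le_of_gt hip, not_le_of_gt hxi]
        · have e1 : ¬ (2 * T - 1 - x j < T) := by omega
          have e2 : 2 * T - 1 - (2 * T - 1 - x j) = x j := by omega
          simp [not_le_of_gt hip, not_le_of_gt hxi, e1, e2]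
      · simp only [Lab, Mod2, hjp, hip, if_false]
        have hip' : p ≤ i := by omega
        cases nest
        · simp [hip']
        · have e1 : ¬ (2 * T - 1 - x j < T) := by omega
          have e2 : T ≤ 2 * T - 1 - x i := by omega
          simp [hip', e1, e2]

/-- `x` lists the word `W` of length `n` -/
def WLists (nest : Bool) (n : ℕ) (W : Finset ℕ) (x : ℕ → ℕ) : Prop :=
  (∀ i j, i < j → j < W.card → x i < x j) ∧
  (∀ i j, W.card ≤ i → i < j → j < n → if nest then x j < x i else x i < x j) ∧
  (∀ i, i < W.card → x i ∈ W) ∧ (∀ y ∈ W, ∃ i, i < W.card ∧ x i = y) ∧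
  (∀ i, W.card ≤ i → i < n → x i ∉ W ∧ x i < n) ∧
  (∀ y, y < n → y ∉ W → ∃ i, W.card ≤ i ∧ i < n ∧ x i = y)

theorem lists_exists (nest : Bool) (n : ℕ) (W : Finset ℕ) (hW : W ⊆ range n) :
    ∃ x, WLists nest n W x := by
  obtain ⟨g, g1, g2, g3⟩ := enum_exists W
  obtain ⟨h, h1, h2, h3⟩ := enum_exists (range n \ W)
  have hc : (range n \ W).card = n - W.card := by
    rw [card_sdiff_of_subset hW, card_range]
  have hWn : W.card ≤ n := by simpa using card_le_card hW
  rw [hc] at h1 h2 h3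
  refine ⟨fun i => if i < W.card then g i else if nest then h (n - 1 - i) else h (i - W.card),
    ?_, ?_, ?_, ?_, ?_, ?_⟩
  · intro i j hij hj
    simp only [hj, lt_trans hij hj, if_true]; exact g1 _ _ hij hj
  · intro i j hi hij hj
    have e1 : ¬ i < W.card := by omega
    have e2 : ¬ j < W.card := by omega
    simp only [e1, e2, if_false]
    cases nest
    · simp only [Bool.false_eq_true, if_false]; exact h1 _ _ (by omega) (by omega)
    · simp only [if_true]; exact h1 _ _ (by omega) (by omega)
  · intro i hi
    simp only [hi, if_true]; exact g2 i hi
  · intro y hy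
    obtain ⟨i, hi, hi'⟩ := g3 y hy
    exact ⟨i, hi, by simp only [hi, if_true]; exact hi'⟩
  · intro i hi hin
    have e1 : ¬ i < W.card := by omega
    simp only [e1, if_false]
    cases nest
    · have := h2 (i - W.card) (by omega)
      simp only [mem_sdiff, mem_range] at this
      simpa using this.symm
    · have := h2 (n - 1 - i) (by omega)
      simp only [mem_sdiff, mem_range] at this
      simpa using this.symm
  · intro y hy hyW
    obtain ⟨i, hi, hi'⟩ := h3 y (by simp [hy, hyW])
    cases nest
    · refine ⟨i + W.card, by omega, by omega, ?_⟩
      simp [hi']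
    · refine ⟨n - 1 - i, by omega, by omega, ?_⟩
      have e1 : ¬ n - 1 - i < W.card := by omega
      have e2 : n - 1 - (n - 1 - i) = i := by omega
      simp [e1, e2, hi']

theorem lists_count {nest : Bool} {n : ℕ} {W : Finset ℕ} {x : ℕ → ℕ} (h : WLists nest n W x)
    (i : ℕ) (hi : i < W.card) (hW : W ⊆ range n) :
    x i = i + ((range n).filter (fun j => W.card ≤ j ∧ x j < x i)).card := by
  classical
  obtain ⟨h1, h2, h3, h4, h5, h6⟩ := h
  have hxi : x i < n := mem_range.mp (hW (h3 i hi))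
  have e1 : ((range (x i)).filter (fun y => y ∈ W)) = (range i).image x := by
    ext y
    simp only [mem_filter, mem_range, mem_image]
    constructor
    · rintro ⟨hy, hyW⟩
      obtain ⟨j, hj, rfl⟩ := h4 y hyW
      exact ⟨j, (mono_lt_iff h1 hj hi).mp hy, rfl⟩
    · rintro ⟨j, hj, rfl⟩
      exact ⟨h1 _ _ hj hi, h3 _ (by omega)⟩
  have e2 : ((range (x i)).filter (fun y => y ∉ W)) =
      ((range n).filter (fun j => W.card ≤ j ∧ x j < x i)).image x := by
    ext y
    simp only [mem_filter, mem_range, mem_image]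
    constructor
    · rintro ⟨hy, hyW⟩
      obtain ⟨j, hj, hj', rfl⟩ := h6 y (by omega) hyW
      exact ⟨j, ⟨hj', hj, hy⟩, rfl⟩
    · rintro ⟨j, ⟨hj, hj', hj''⟩, rfl⟩
      exact ⟨hj'', (h5 j hj' hj).1⟩
  have c1 : ((range i).image x).card = i := by
    rw [card_image_of_injOn, card_range]
    intro u hu v hv huv
    simp only [coe_range, Set.mem_Iio] at hu hv
    exact mono_inj h1 (by omega) (by omega) huv
  have c2 : (((range n).filter (fun j => W.card ≤ j ∧ x j < x i)).image x).card =
      ((range n).filter (fun j => W.card ≤ j ∧ x j < x i)).card := by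
    apply card_image_of_injOn
    intro u hu v hv huv
    simp only [coe_filter, mem_range, Set.mem_ofPred_eq] at hu hv
    rcases lt_trichotomy u v with hlt | hlt | hlt
    · have := h2 u v hu.2.1 hlt hv.1
      split_ifs at this <;> omega
    · exact hlt
    · have := h2 v u hv.2.1 hlt hu.1
      split_ifs at this <;> omega
  have := card_filter_add_card_filter_not (s := range (x i)) (fun y => y ∈ W)
  rw [e1, e2, c1, c2, card_range] at this
  omega

theorem half_core {P : HerProp} {nest a b c d : Bool} {T : ℕ}
    (hP : ∀ s, Has P (2 * T) (Mod2 nest a b c d T s)) (n : ℕ) (hT : n ≤ T) (hbc : b ≠ c)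
    (𝓦 : Finset (Finset ℕ)) (h𝓦 : ∀ W ∈ 𝓦, W ⊆ range n)
    (hu : ∀ W ∈ 𝓦, W.card < n → ∀ x, WLists nest n W x → ∃ i, i < W.card ∧
      (if x i < x W.card then b else c) ≠ a) : 𝓦.card ≤ speed P n := by
  classical
  have hval : ∀ W ⊆ range n, ∀ x, WLists nest n W x → ∀ i j, i < W.card → W.card ≤ j → j < n →
      Lab W.card a b c d x (fun _ => false) i j = if x i < x j then b else c := by
    intro W hW x hx i j hi hj hjn
    have hne : x i ≠ x j := by
      intro h
      have h3 := hx.2.2.1 i hi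
      have h4 := (hx.2.2.2.2.1 j hj hjn).1
      rw [h] at h3; exact h4 h3
    have e1 : ¬ j < W.card := by omega
    have e2 : ¬ W.card ≤ i := by omega
    simp only [Lab, e1, e2, if_false]
    split_ifs with k1 k2
    · rfl
    · rfl
    · omega
  apply card_le_speed 𝓦 P n (fun W r => ∃ x, WLists nest n W x ∧
    Agr n r (Lab W.card a b c d x (fun _ => false)))
  · intro W hW
    obtain ⟨x, hx⟩ := lists_exists nest n W (h𝓦 W hW)
    refine ⟨_, lab_has hP n W.card x ?_ ?_ ?_ (fun _ => false), x, hx, fun _ _ _ _ => rfl⟩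
    · intro i hi
      by_cases hi' : i < W.card
      · have := mem_range.mp (h𝓦 W hW (hx.2.2.1 i hi')); omega
      · have := (hx.2.2.2.2.1 i (by omega) hi).2; omega
    · intro i j hij hj _; exact hx.1 i j hij hj
    · exact hx.2.1
  · intro W hW W' hW' r r' ⟨x, hx, hr⟩ ⟨x', hx', hr'⟩ hrr
    have hA : Agr n (Lab W.card a b c d x (fun _ => false))
        (Lab W'.card a b c d x' (fun _ => false)) := by
      intro i j hij hj
      rw [← hr i j hij hj, hrr i j hij hj, hr' i j hij hj]
    have key : ∀ W ∈ 𝓦, ∀ W' ∈ 𝓦, ∀ x x', WLists nest n W x → WLists nest n W' x' →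
        Agr n (Lab W.card a b c d x (fun _ => false))
        (Lab W'.card a b c d x' (fun _ => false)) → W'.card ≤ W.card := by
      intro W hW W' hW' x x' hx hx' hA
      by_contra hcon
      push Not at hcon
      have hc' : W'.card ≤ n := by simpa using card_le_card (h𝓦 W' hW')
      obtain ⟨i, hi, hne⟩ := hu W hW (by omega) x hx
      have h1 := hA i W.card hi (by omega)
      rw [hval W (h𝓦 W hW) x hx i W.card hi le_rfl (by omega)] at h1
      apply hne
      rw [h1]
      simp [Lab, hcon]
    have hcard : W.card = W'.card := le_antisymm
      (key W' hW' W hW x' x hx' hx (fun i j h h' => (hA i j h h').symm))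
      (key W hW W' hW' x x' hx hx' hA)
    have hxx : ∀ i, i < W.card → x i = x' i := by
      intro i hi
      rw [lists_count hx i hi (h𝓦 W hW), lists_count hx' i (by omega) (h𝓦 W' hW')]
      congr 2
      apply filter_congr
      intro j hj
      simp only [mem_range] at hj
      rw [← hcard]
      constructor
      · rintro ⟨hj1, hj2⟩
        refine ⟨hj1, ?_⟩
        have h1 := hA i j (by omega) hj
        rw [hval W (h𝓦 W hW) x hx i j hi hj1 hj,
          hval W' (h𝓦 W' hW') x' hx' i j (by omega) (by omega) hj,
          if_neg (by omega)] at h1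
        by_contra hcon
        have hne : x' i ≠ x' j := by
          intro h
          have h3 := hx'.2.2.1 i (by omega)
          have h4 := (hx'.2.2.2.2.1 j (by omega) hj).1
          rw [h] at h3; exact h4 h3
        rw [if_pos (by omega)] at h1
        exact hbc h1.symm
      · rintro ⟨hj1, hj2⟩
        refine ⟨hj1, ?_⟩
        have h1 := hA i j (by omega) hj
        rw [hval W (h𝓦 W hW) x hx i j hi hj1 hj,
          hval W' (h𝓦 W' hW') x' hx' i j (by omega) (by omega) hj,
          if_neg (by omega : ¬ x' i < x' j)] at h1
        by_contra hcon
        have hne : x i ≠ x j := by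
          intro h
          have h3 := hx.2.2.1 i (by omega)
          have h4 := (hx.2.2.2.2.1 j (by omega) hj).1
          rw [h] at h3; exact h4 h3
        rw [if_pos (by omega)] at h1
        exact hbc h1
    ext y
    constructor
    · intro hy
      obtain ⟨i, hi, rfl⟩ := hx.2.2.2.1 y hy
      rw [hxx i hi]; exact hx'.2.2.1 i (by omega)
    · intro hy
      obtain ⟨i, hi, rfl⟩ := hx'.2.2.2.1 y hy
      rw [← hxx i (by omega)]; exact hx.2.2.1 i (by omega)

theorem T2_half {P : HerProp} {nest a b c d : Bool} {T : ℕ}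
    (hP : ∀ s, Has P (2 * T) (Mod2 nest a b c d T s)) (n : ℕ) (hn : 1 ≤ n) (hT : n ≤ T)
    (hbc : b ≠ c) : 2 ^ (n - 1) ≤ speed P n := by
  classical
  by_cases hab : a = b
  · subst hab
    cases nest
    · -- crossing
      have hcard : (((Ico 1 n).powerset.erase ∅) ∪ {range n}).card = 2 ^ (n - 1) := by
        rw [card_union_of_disjoint, card_erase_of_mem (by simp), card_powerset, Nat.card_Ico,
          card_singleton, Nat.sub_add_cancel (Nat.one_le_two_pow)]
        rw [disjoint_singleton_right]
        simp only [mem_erase, mem_powerset, not_and]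
        intro _ h
        have := h (mem_range.mpr (by omega : 0 < n))
        simp at this
      rw [← hcard]
      apply half_core hP n hT hbc
      · intro W hW
        simp only [mem_union, mem_erase, mem_powerset, mem_singleton] at hW
        rcases hW with hW | hW
        · intro y hy; have := hW.2 hy; simp only [mem_Ico] at this; simp; omega
        · rw [hW]
      · intro W hW hWn x hx
        simp only [mem_union, mem_erase, mem_powerset, mem_singleton] at hW
        rcases hW with hW | hW
        · have hpos : 0 < W.card := card_pos.mpr (nonempty_iff_ne_empty.mpr hW.1)
          have h0 : 0 ∉ W := by intro h; have := hW.2 h; simp at this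
          obtain ⟨i, hi, hi', hi0⟩ := hx.2.2.2.2.2 0 (by omega) h0
          have hxp : x W.card = 0 := by
            rcases hi.eq_or_lt with h | h
            · rw [h]; exact hi0
            · have := hx.2.1 W.card i le_rfl h hi'
              simp only [Bool.false_eq_true, if_false] at this; omega
          refine ⟨0, hpos, ?_⟩
          rw [hxp]; simpa using hbc.symm
        · rw [hW] at hWn; simp at hWn
    · -- nested
      have hcard : ((range (n - 1)).powerset.image (insert (n - 1))).card = 2 ^ (n - 1) := by
        rw [card_image_of_injOn, card_powerset, card_range]
        intro U hU V hV hUV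
        simp only [coe_powerset, Set.mem_preimage, Set.mem_powerset_iff, coe_subset] at hU hV
        have hU' : n - 1 ∉ U := fun h => by have := hU h; simp at this
        have hV' : n - 1 ∉ V := fun h => by have := hV h; simp at this
        have h1 : insert (n - 1) U = insert (n - 1) V := hUV
        rw [← erase_insert hU', ← erase_insert hV', h1]
      rw [← hcard]
      apply half_core hP n hT hbc
      · intro W hW
        simp only [mem_image, mem_powerset] at hW
        obtain ⟨V, hV, rfl⟩ := hW
        intro y hy
        simp only [mem_insert] at hy
        rcases hy with hy | hy
        · simp; omega
        · have := hV hy; simp at this ⊢; omega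
      · intro W hW hWn x hx
        have hmem : n - 1 ∈ W := by
          simp only [mem_image, mem_powerset] at hW
          obtain ⟨V, hV, rfl⟩ := hW
          simp
        obtain ⟨i, hi, hi'⟩ := hx.2.2.2.1 _ hmem
        refine ⟨i, hi, ?_⟩
        have := (hx.2.2.2.2.1 W.card le_rfl hWn).2
        rw [hi', if_neg (by omega)]; exact hbc.symm
  · have hcard : ((Ico 1 n).powerset.image (insert 0)).card = 2 ^ (n - 1) := by
      rw [card_image_of_injOn, card_powerset, Nat.card_Ico]
      intro U hU V hV hUV
      simp only [coe_powerset, Set.mem_preimage, Set.mem_powerset_iff, coe_subset] at hU hV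
      have hU' : 0 ∉ U := fun h => by have := hU h; simp at this
      have hV' : 0 ∉ V := fun h => by have := hV h; simp at this
      have h1 : insert 0 U = insert 0 V := hUV
      rw [← erase_insert hU', ← erase_insert hV', h1]
    rw [← hcard]
    apply half_core hP n hT hbc
    · intro W hW
      simp only [mem_image, mem_powerset] at hW
      obtain ⟨V, hV, rfl⟩ := hW
      intro y hy
      simp only [mem_insert] at hy
      rcases hy with hy | hy
      · simp; omega
      · have := hV hy; simp at this ⊢; omega
    · intro W hW hWn x hx
      have hmem : 0 ∈ W := by
        simp only [mem_image, mem_powerset] at hW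
        obtain ⟨V, hV, rfl⟩ := hW
        simp
      obtain ⟨i, hi, hi'⟩ := hx.2.2.2.1 _ hmem
      refine ⟨i, hi, ?_⟩
      have := (hx.2.2.2.2.1 W.card le_rfl hWn).1
      have hne : x W.card ≠ 0 := fun h => this (by rw [h]; exact hmem)
      rw [hi', if_pos (by omega)]; exact Ne.symm hab

theorem exists_rank_below (T : Finset ℕ) (k : ℕ) (hk : k < T.card) :
    ∃ j ∈ T, (T.filter (fun x => x < j)).card = k := by
  classical
  obtain ⟨g, g1, g2, g3⟩ := enum_exists T
  refine ⟨g k, g2 k hk, ?_⟩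
  have : T.filter (fun x => x < g k) = (range k).image g := by
    ext y
    simp only [mem_filter, mem_image, mem_range]
    constructor
    · rintro ⟨hy, hlt⟩
      obtain ⟨i, hi, rfl⟩ := g3 y hy
      exact ⟨i, (mono_lt_iff g1 hi hk).mp hlt, rfl⟩
    · rintro ⟨i, hi, rfl⟩
      exact ⟨g2 i (by omega), g1 _ _ hi hk⟩
  rw [this, card_image_of_injOn, card_range]
  intro u hu v hv huv
  simp only [coe_range, Set.mem_Iio] at hu hv
  exact mono_inj g1 (by omega) (by omega) huv

theorem exists_rank_above (T : Finset ℕ) (k : ℕ) (hk : k < T.card) :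
    ∃ j ∈ T, (T.filter (fun x => j < x)).card = k := by
  classical
  obtain ⟨j, hj, hc⟩ := exists_rank_below T (T.card - 1 - k) (by omega)
  refine ⟨j, hj, ?_⟩
  have h1 := card_filter_add_card_filter_not (s := T) (fun y => y < j)
  have h2 : T.filter (fun y => ¬ y < j) = insert j (T.filter (fun x => j < x)) := by
    ext y
    simp only [mem_filter, mem_insert]
    constructor
    · rintro ⟨h, h'⟩
      by_cases h'' : y = j
      · left; exact h''
      · right; exact ⟨h, by omega⟩
    · rintro (h | h)
      · subst h; exact ⟨hj, by omega⟩
      · exact ⟨h.1, by omega⟩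
  rw [h2, card_insert_of_notMem (by simp)] at h1
  omega

theorem rank_below_lt (T : Finset ℕ) (j : ℕ) (hj : j ∈ T) :
    (T.filter (fun x => x < j)).card < T.card :=
  card_lt_card ⟨filter_subset _ _, fun h => by have := h hj; simp at this⟩

theorem rank_above_lt (T : Finset ℕ) (j : ℕ) (hj : j ∈ T) :
    (T.filter (fun x => j < x)).card < T.card :=
  card_lt_card ⟨filter_subset _ _, fun h => by have := h hj; simp at this⟩

/-- matched labelled graph facts -/
def Matched (n p : ℕ) (a b d : Bool) (S T : Finset ℕ) (r : ℕ → ℕ → Bool) : Prop :=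
  (∀ i j, i < j → j < p → j < n → r i j = a) ∧
  (∀ i j, p ≤ i → i < j → j < n → r i j = d) ∧
  (∀ i ∈ S, ∃ j ∈ T, r i j ≠ b) ∧ (∀ j ∈ T, ∃ i ∈ S, r i j ≠ b) ∧
  (∀ i j, i < p → p ≤ j → j < n → r i j ≠ b → i ∈ S ∧ j ∈ T) ∧
  (∀ i i' j, i < p → i' < p → p ≤ j → j < n → r i j ≠ b → r i' j ≠ b → i = i') ∧
  (∀ i j j', i < p → p ≤ j → p ≤ j' → j < n → j' < n → r i j ≠ b → r i j' ≠ b → j = j')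

theorem matched_exists {P : HerProp} {nest a b d : Bool} {M : ℕ}
    (hP : ∀ s, Has P (2 * M) (Mod2 nest a b b d M s)) (n p : ℕ) (hM : (2 * n + 1) * (n + 1) ≤ M)
    (hp : p ≤ n) (S T : Finset ℕ) (hS : ∀ i ∈ S, i < p) (hT : ∀ j ∈ T, p ≤ j ∧ j < n)
    (hST : S.card = T.card) : ∃ r, Has P n r ∧ Matched n p a b d S T r := by
  classical
  set cS : ℕ → ℕ := fun i => (S.filter (fun x => x < i)).card with hcS
  set cT : ℕ → ℕ := fun j => if nest then (T.filter (fun x => j < x)).card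
    else (T.filter (fun x => x < j)).card with hcT
  set x : ℕ → ℕ := fun i => if i < p then (2 * n + 1) * cS i + (if i ∈ S then 2 * n else i)
    else (2 * n + 1) * cT i + (if i ∈ T then 2 * n else if nest then n + (n - 1 - i) else i)
    with hx
  have hSn : S.card ≤ n := by
    have : S ⊆ range n := fun i hi => mem_range.mpr (by have := hS i hi; omega)
    simpa using card_le_card this
  have hTn : T.card ≤ n := by omega
  have cS_le : ∀ i, cS i ≤ n := fun i => le_trans (card_le_card (filter_subset _ _)) hSn
  have cT_le : ∀ i, cT i ≤ n := by
    intro i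
    simp only [hcT]
    split_ifs
    · exact le_trans (card_le_card (filter_subset _ _)) hTn
    · exact le_trans (card_le_card (filter_subset _ _)) hTn
  have hxM : ∀ i, i < n → x i < M := by
    intro i hi
    have h1 := Nat.mul_le_mul_left (2 * n + 1) (cS_le i)
    have h2 := Nat.mul_le_mul_left (2 * n + 1) (cT_le i)
    have h3 : (2 * n + 1) * (n + 1) = (2 * n + 1) * n + (2 * n + 1) := by ring
    simp only [hx]
    split_ifs <;> omega
  have cS_mono : ∀ i j, i < j → cS i ≤ cS j := by
    intro i j hij
    apply card_le_card
    intro y hy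
    simp only [mem_filter] at hy ⊢
    exact ⟨hy.1, by omega⟩
  have cS_succ : ∀ i j, i < j → i ∈ S → cS i + 1 ≤ cS j := by
    intro i j hij hi
    have : (insert i (S.filter (fun x => x < i))).card ≤ cS j := by
      apply card_le_card
      intro y hy
      simp only [mem_filter, mem_insert] at hy ⊢
      rcases hy with rfl | hy
      · exact ⟨hi, hij⟩
      · exact ⟨hy.1, by omega⟩
    rwa [card_insert_of_notMem (by simp)] at this
  have h1 : ∀ i j, i < j → j < p → j < n → x i < x j := by
    intro i j hij hj hjn
    simp only [hx, hj, lt_trans hij hj, if_true]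
    by_cases hi : i ∈ S
    · have := Nat.mul_le_mul_left (2 * n + 1) (cS_succ i j hij hi)
      rw [Nat.mul_add] at this
      simp only [hi, if_true]; split_ifs <;> omega
    · have := Nat.mul_le_mul_left (2 * n + 1) (cS_mono i j hij)
      simp only [hi, if_false]; split_ifs <;> omega
  have h2 : ∀ i j, p ≤ i → i < j → j < n → if nest then x j < x i else x i < x j := by
    intro i j hi hij hj
    have e1 : ¬ i < p := by omega
    have e2 : ¬ j < p := by omega
    cases nest
    · simp only [Bool.false_eq_true, if_false, hx, e1, e2, hcT]
      by_cases hiT : i ∈ T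
      · have : (insert i (T.filter (fun x => x < i))).card ≤ (T.filter (fun x => x < j)).card := by
          apply card_le_card
          intro y hy
          simp only [mem_filter, mem_insert] at hy ⊢
          rcases hy with rfl | hy
          · exact ⟨hiT, hij⟩
          · exact ⟨hy.1, by omega⟩
        rw [card_insert_of_notMem (by simp)] at this
        have := Nat.mul_le_mul_left (2 * n + 1) this
        rw [Nat.mul_add] at this
        simp only [hiT, if_true]; split_ifs <;> omega
      · have : (T.filter (fun x => x < i)).card ≤ (T.filter (fun x => x < j)).card := by
          apply card_le_card
          intro y hy
          simp only [mem_filter] at hy ⊢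
          exact ⟨hy.1, by omega⟩
        have := Nat.mul_le_mul_left (2 * n + 1) this
        simp only [hiT, if_false]; split_ifs <;> omega
    · simp only [if_true, hx, e1, e2, if_false, hcT]
      by_cases hjT : j ∈ T
      · have : (insert j (T.filter (fun x => j < x))).card ≤ (T.filter (fun x => i < x)).card := by
          apply card_le_card
          intro y hy
          simp only [mem_filter, mem_insert] at hy ⊢
          rcases hy with rfl | hy
          · exact ⟨hjT, hij⟩
          · exact ⟨hy.1, by omega⟩
        rw [card_insert_of_notMem (by simp)] at this
        have := Nat.mul_le_mul_left (2 * n + 1) this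
        rw [Nat.mul_add] at this
        simp only [hjT, if_true]; split_ifs <;> omega
      · have : (T.filter (fun x => j < x)).card ≤ (T.filter (fun x => i < x)).card := by
          apply card_le_card
          intro y hy
          simp only [mem_filter] at hy ⊢
          exact ⟨hy.1, by omega⟩
        have := Nat.mul_le_mul_left (2 * n + 1) this
        simp only [hjT, if_false]; split_ifs <;> omega
  have heq : ∀ i j, i < p → p ≤ j → j < n → (x i = x j ↔ i ∈ S ∧ j ∈ T ∧ cS i = cT j) := by
    intro i j hi hj hjn
    have e2 : ¬ j < p := by omega
    constructor
    · intro h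
      simp only [hx, hi, e2, if_true, if_false] at h
      have hm := congrArg (· % (2 * n + 1)) h
      simp only [Nat.mul_add_mod] at hm
      have hmod : (if i ∈ S then 2 * n else i) =
          (if j ∈ T then 2 * n else if nest then n + (n - 1 - j) else j) := by
        rw [Nat.mod_eq_of_lt, Nat.mod_eq_of_lt] at hm
        · exact hm
        · split_ifs <;> omega
        · split_ifs <;> omega
      have hiS : i ∈ S ∧ j ∈ T := by
        by_cases k1 : i ∈ S
        · by_cases k2 : j ∈ T
          · exact ⟨k1, k2⟩
          · simp only [k1, k2, if_true, if_false] at hmod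
            split_ifs at hmod <;> omega
        · by_cases k2 : j ∈ T
          · simp only [k1, k2, if_true, if_false] at hmod
            omega
          · simp only [k1, k2, if_false] at hmod
            split_ifs at hmod <;> omega
      refine ⟨hiS.1, hiS.2, ?_⟩
      rw [hmod] at h
      exact Nat.eq_of_mul_eq_mul_left (by omega) (Nat.add_right_cancel h)
    · rintro ⟨k1, k2, k3⟩
      simp only [hx, hi, e2, k1, k2, k3, if_true, if_false]
  have hval : ∀ i j, i < p → p ≤ j → j < n →
      (Lab p a b b d x (fun _ => !b) i j ≠ b ↔ i ∈ S ∧ j ∈ T ∧ cS i = cT j) := by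
    intro i j hi hj hjn
    rw [← heq i j hi hj hjn]
    have e1 : ¬ j < p := by omega
    have e2 : ¬ p ≤ i := by omega
    simp only [Lab, e1, e2, if_false]
    split_ifs with k1 k2
    · simp; omega
    · simp; omega
    · simp; omega
  have hinjT : ∀ j j', p ≤ j → p ≤ j' → j < n → j' < n → x j = x j' → j = j' := by
    intro u v hu hv hun hvn huv
    rcases lt_trichotomy u v with hlt | hlt | hlt
    · have := h2 u v hu hlt hvn
      split_ifs at this <;> omega
    · exact hlt
    · have := h2 v u hv hlt hun
      split_ifs at this <;> omega
  refine ⟨Lab p a b b d x (fun _ => !b), lab_has hP n p x hxM h1 h2 _, ?_, ?_, ?_, ?_, ?_, ?_, ?_⟩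
  · intro i j hij hj _
    simp [Lab, hj]
  · intro i j hi hij hj
    simp [Lab, not_lt_of_ge (le_trans hi hij.le), hi]
  · intro i hi
    have hlt : cS i < T.card := by rw [← hST]; exact rank_below_lt S i hi
    have : ∃ j ∈ T, cT j = cS i := by
      simp only [hcT]
      cases nest
      · simpa using exists_rank_below T _ hlt
      · simpa using exists_rank_above T _ hlt
    obtain ⟨j, hj, hc⟩ := this
    exact ⟨j, hj, (hval i j (hS i hi) (hT j hj).1 (hT j hj).2).mpr ⟨hi, hj, hc.symm⟩⟩
  · intro j hj
    have hlt : cT j < S.card := by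
      rw [hST]; simp only [hcT]
      cases nest
      · simpa using rank_below_lt T j hj
      · simpa using rank_above_lt T j hj
    obtain ⟨i, hi, hc⟩ := exists_rank_below S _ hlt
    exact ⟨i, hi, (hval i j (hS i hi) (hT j hj).1 (hT j hj).2).mpr ⟨hi, hj, hc⟩⟩
  · intro i j hi hj hjn h
    have := (hval i j hi hj hjn).mp h
    exact ⟨this.1, this.2.1⟩
  · intro i i' j hi hi' hj hjn h h'
    have k1 := (heq i j hi hj hjn).mpr ((hval i j hi hj hjn).mp h)
    have k2 := (heq i' j hi' hj hjn).mpr ((hval i' j hi' hj hjn).mp h')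
    rcases lt_trichotomy i i' with hlt | hlt | hlt
    · have := h1 i i' hlt hi' (by omega); omega
    · exact hlt
    · have := h1 i' i hlt hi (by omega); omega
  · intro i j j' hi hj hj' hjn hjn' h h'
    have k1 := (heq i j hi hj hjn).mpr ((hval i j hi hj hjn).mp h)
    have k2 := (heq i j' hi hj' hjn').mpr ((hval i j' hi hj' hjn').mp h')
    exact hinjT j j' hj hj' hjn hjn' (by omega)

theorem matched_ST {n p : ℕ} {a b d : Bool} {S T S' T' : Finset ℕ} {r r' : ℕ → ℕ → Bool}
    (hS : ∀ i ∈ S, i < p) (hT : ∀ j ∈ T, p ≤ j ∧ j < n)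
    (h : Matched n p a b d S T r) (h' : Matched n p a b d S' T' r')
    (hA : Agr n r r') : S ⊆ S' ∧ T ⊆ T' := by
  obtain ⟨_, _, h3, h4, h5, _⟩ := h
  obtain ⟨_, _, h3', h4', h5', _⟩ := h'
  constructor
  · intro i hi
    obtain ⟨j, hj, hne⟩ := h3 i hi
    have h1 := hS i hi
    have h2 := hT j hj
    rw [hA i j (by omega) h2.2] at hne
    exact (h5' i j h1 h2.1 h2.2 hne).1
  · intro j hj
    obtain ⟨i, hi, hne⟩ := h4 j hj
    have h1 := hS i hi
    have h2 := hT j hj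
    rw [hA i j (by omega) h2.2] at hne
    exact (h5' i j h1 h2.1 h2.2 hne).2

theorem matched_core {P : HerProp} {nest a b d : Bool} {M : ℕ}
    (hP : ∀ s, Has P (2 * M) (Mod2 nest a b b d M s)) (n : ℕ) (hM : (2 * n + 1) * (n + 1) ≤ M)
    (𝓤 : Finset (Finset ℕ)) (h𝓤 : ∀ U ∈ 𝓤, U ⊆ range n)
    (hu : ∀ U ∈ 𝓤, ∀ U' ∈ 𝓤, U'.card < U.card → ∀ S T S' T' r r',
      Matched n (n - U.card) a b d S T r → Matched n (n - U'.card) a b d S' T' r' →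
      Agr n r r' → False) : 𝓤.card ≤ speed P n := by
  classical
  have hle : ∀ U ∈ 𝓤, U.card ≤ n := fun U hU => by simpa using card_le_card (h𝓤 U hU)
  apply card_le_speed 𝓤 P n (fun U r => Matched n (n - U.card) a b d
    (U.filter (fun x => x < n - U.card)) (Ico (n - U.card) n \ U) r)
  · intro U hU
    apply matched_exists hP n _ hM (Nat.sub_le _ _)
    · intro i hi; exact (mem_filter.mp hi).2
    · intro j hj; simp only [mem_sdiff, mem_Ico] at hj; exact hj.1
    · have h1 := card_filter_add_card_filter_not (s := U) (fun x => x < n - U.card)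
      have h2 : U.filter (fun x => ¬ x < n - U.card) = Ico (n - U.card) n ∩ U := by
        ext y
        simp only [mem_filter, mem_inter, mem_Ico]
        constructor
        · rintro ⟨k1, k2⟩; have := mem_range.mp (h𝓤 U hU k1); exact ⟨⟨by omega, this⟩, k1⟩
        · rintro ⟨k1, k2⟩; exact ⟨k2, by omega⟩
      have h3 := card_sdiff_add_card_inter (Ico (n - U.card) n) U
      rw [Nat.card_Ico] at h3
      rw [h2] at h1
      have := hle U hU
      omega
  · intro U hU U' hU' r r' h h' hA
    rcases lt_trichotomy U.card U'.card with hlt | heq | hlt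
    · exact (hu U' hU' U hU hlt _ _ _ _ r' r h' h (fun i j k k' => (hA i j k k').symm)).elim
    · rw [← heq] at h'
      have k1 := matched_ST (fun i hi => (mem_filter.mp hi).2)
        (fun j hj => by simp only [mem_sdiff, mem_Ico] at hj; exact hj.1) h h' hA
      have k2 := matched_ST (fun i hi => (mem_filter.mp hi).2)
        (fun j hj => by simp only [mem_sdiff, mem_Ico] at hj; exact hj.1) h' h
        (fun i j k k' => (hA i j k k').symm)
      ext y
      constructor
      · intro hy
        have hyn := mem_range.mp (h𝓤 U hU hy)
        by_cases hyp : y < n - U.card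
        · have := k1.1 (mem_filter.mpr ⟨hy, hyp⟩)
          exact (mem_filter.mp this).1
        · by_contra hcon
          have := k2.2 (mem_sdiff.mpr ⟨mem_Ico.mpr ⟨by omega, hyn⟩, hcon⟩)
          exact (mem_sdiff.mp this).2 hy
      · intro hy
        have hyn := mem_range.mp (h𝓤 U' hU' hy)
        by_cases hyp : y < n - U.card
        · have := k2.1 (mem_filter.mpr ⟨hy, hyp⟩)
          exact (mem_filter.mp this).1
        · by_contra hcon
          have := k1.2 (mem_sdiff.mpr ⟨mem_Ico.mpr ⟨by omega, hyn⟩, hcon⟩)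
          exact (mem_sdiff.mp this).2 hy
    · exact (hu U hU U' hU' hlt _ _ _ _ r r' h h' hA).elim

theorem n_lt_pow (n : ℕ) (hn : 3 ≤ n) : n + 1 ≤ 2 ^ (n - 1) := by
  induction n, hn using Nat.le_induction with
  | base => norm_num
  | succ n hn ih =>
    obtain ⟨m, rfl⟩ := Nat.exists_eq_succ_of_ne_zero (by omega : n ≠ 0)
    simp only [Nat.succ_eq_add_one, Nat.add_sub_cancel, pow_succ] at ih ⊢
    omega

theorem big_card (n : ℕ) (hn : 3 ≤ n) :
    2 ^ (n - 1) ≤ ((range n).powerset.filter (fun U => U.card + 2 ≤ n)).card := by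
  classical
  have h1 := card_filter_add_card_filter_not (s := (range n).powerset) (fun U => U.card + 2 ≤ n)
  have h2 : (range n).powerset.filter (fun U => ¬ U.card + 2 ≤ n) ⊆
      (range n).powersetCard (n - 1) ∪ (range n).powersetCard n := by
    intro U hU
    simp only [mem_filter, mem_powerset] at hU
    have := card_le_card hU.1
    rw [card_range] at this
    simp only [mem_union, mem_powersetCard]
    by_cases h : U.card = n
    · right; exact ⟨hU.1, h⟩
    · left; exact ⟨hU.1, by omega⟩
  have h3 := le_trans (card_le_card h2) (card_union_le _ _)
  rw [card_powersetCard, card_powersetCard, card_range, Nat.choose_self,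
    Nat.choose_symm_of_eq_add (by omega : n = (n - 1) + 1), Nat.choose_one_right] at h3
  rw [card_powerset, card_range] at h1
  have h4 := n_lt_pow n hn
  have h5 : 2 ^ n = 2 ^ (n - 1) + 2 ^ (n - 1) := by
    rw [← two_mul, ← pow_succ']; congr 1; omega
  omega

theorem big_card' (n : ℕ) (hn : 3 ≤ n) :
    2 ^ (n - 1) ≤ ((range n).powerset.filter (fun U => 2 ≤ U.card)).card := by
  classical
  have h1 := card_filter_add_card_filter_not (s := (range n).powerset) (fun U => 2 ≤ U.card)
  have h2 : (range n).powerset.filter (fun U => ¬ 2 ≤ U.card) ⊆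
      (range n).powersetCard 1 ∪ (range n).powersetCard 0 := by
    intro U hU
    simp only [mem_filter, mem_powerset] at hU
    simp only [mem_union, mem_powersetCard]
    by_cases h : U.card = 0
    · right; exact ⟨hU.1, h⟩
    · left; exact ⟨hU.1, by omega⟩
  have h3 := le_trans (card_le_card h2) (card_union_le _ _)
  rw [card_powersetCard, card_powersetCard, card_range, Nat.choose_one_right,
    Nat.choose_zero_right] at h3
  rw [card_powerset, card_range] at h1
  have h4 := n_lt_pow n hn
  have h5 : 2 ^ n = 2 ^ (n - 1) + 2 ^ (n - 1) := by
    rw [← two_mul, ← pow_succ']; congr 1; omega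
  omega

theorem T2_small {P : HerProp} {nest a b c d : Bool} {T : ℕ}
    (hP : ∀ s, Has P (2 * T) (Mod2 nest a b c d T s)) (n : ℕ) (hn : n ≤ 2) (hT : 1 ≤ T) :
    2 ^ (n - 1) ≤ speed P n := by
  apply bits_le_speed
  intro β
  refine ⟨_, lab_has hP n 1 (fun _ => 0) (fun i _ => by omega) (by omega) (by omega) β, ?_⟩
  intro i hi
  have : i = 0 := by omega
  subst this
  simp [Lab]

theorem T2_homog {P : HerProp} {nest b : Bool} {M : ℕ}
    (hP : ∀ s, Has P (2 * M) (Mod2 nest b b b b M s)) (n : ℕ) (hn : 1 ≤ n)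
    (hM : (2 * n + 1) * (n + 1) ≤ M) : 2 ^ (n - 1) ≤ speed P n := by
  classical
  have hcard : (range (n - 1)).powerset.card = 2 ^ (n - 1) := by simp
  rw [← hcard]
  set p : Finset ℕ → ℕ := fun V => n - 1 - V.card with hp
  set S : Finset ℕ → Finset ℕ := fun V => insert (p V - 1) (V.filter (fun u => u < p V - 1))
    with hS
  set T : Finset ℕ → Finset ℕ := fun V => (Ico (p V) n).filter (fun v => v - 1 ∉ V) with hT
  have hTm : ∀ V, ∀ j ∈ T V, p V ≤ j ∧ j < n := by
    intro V j hj
    simp only [hT, mem_filter, mem_Ico] at hj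
    exact hj.1
  have hSm : ∀ V, 1 ≤ p V → ∀ i ∈ S V, i < p V := by
    intro V hV i hi
    simp only [hS, mem_insert, mem_filter] at hi
    omega
  apply card_le_speed _ P n (fun V r =>
    (p V = 0 ∧ ∀ i j, i < j → j < n → r i j = b) ∨
    (1 ≤ p V ∧ Matched n (p V) b b b (S V) (T V) r))
  · intro V hV
    simp only [mem_powerset] at hV
    by_cases h0 : p V = 0
    · obtain ⟨r, hr, hr'⟩ := matched_exists hP n n hM le_rfl ∅ ∅ (by simp) (by simp) rfl
      exact ⟨r, hr, Or.inl ⟨h0, fun i j hij hj => hr'.1 i j hij hj hj⟩⟩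
    · have hpos : 1 ≤ p V := by omega
      obtain ⟨r, hr, hr'⟩ := matched_exists hP n (p V) hM (by simp only [hp]; omega) (S V) (T V)
        (hSm V hpos) (hTm V) (by
          have e1 : (T V).card = ((Ico (p V - 1) (n - 1)) \ V).card := by
            apply card_bij (fun v _ => v - 1)
            · intro v hv
              simp only [hT, mem_filter, mem_Ico, mem_sdiff] at hv ⊢
              exact ⟨by omega, hv.2⟩
            · intro v hv v' hv' h
              simp only [hT, mem_filter, mem_Ico] at hv hv'
              omega
            · intro u hu
              simp only [mem_sdiff, mem_Ico] at hu
              refine ⟨u + 1, ?_, by omega⟩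
              simp only [hT, mem_filter, mem_Ico]
              exact ⟨by omega, by simpa using hu.2⟩
          have e2 : (S V).card = (V.filter (fun u => u < p V - 1)).card + 1 := by
            simp only [hS]
            rw [card_insert_of_notMem (by simp)]
          have h1 := card_filter_add_card_filter_not (s := V) (fun x => x < p V - 1)
          have h2 : V.filter (fun x => ¬ x < p V - 1) = Ico (p V - 1) (n - 1) ∩ V := by
            ext y
            simp only [mem_filter, mem_inter, mem_Ico]
            constructor
            · rintro ⟨k1, k2⟩; have := mem_range.mp (hV k1); exact ⟨⟨by omega, this⟩, k1⟩
            · rintro ⟨k1, k2⟩; exact ⟨k2, by omega⟩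
          have h3 := card_sdiff_add_card_inter (Ico (p V - 1) (n - 1)) V
          rw [Nat.card_Ico] at h3
          rw [h2] at h1
          have := card_le_card hV
          rw [card_range] at this
          simp only [hp] at *
          omega)
      exact ⟨r, hr, Or.inr ⟨hpos, hr'⟩⟩
  · have key0 : ∀ V ∈ (range (n - 1)).powerset, ∀ r, 1 ≤ p V → Matched n (p V) b b b (S V) (T V) r →
        (∃ i j, i < j ∧ j < n ∧ r i j ≠ b ∧ i = p V - 1) := by
      intro V hV r hpos h
      obtain ⟨j, hj, hne⟩ := h.2.2.1 (p V - 1) (by simp [hS])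
      have := hTm V j hj
      exact ⟨p V - 1, j, by omega, this.2, hne, rfl⟩
    have keyp : ∀ V ∈ (range (n - 1)).powerset, ∀ V' ∈ (range (n - 1)).powerset, ∀ r r',
        1 ≤ p V → 1 ≤ p V' →
        Matched n (p V) b b b (S V) (T V) r → Matched n (p V') b b b (S V') (T V') r' →
        Agr n r r' → p V' ≤ p V := by
      intro V hV V' hV' r r' hpos hpos' h h' hA
      by_contra hcon
      obtain ⟨i, j, hij, hj, hne, hi⟩ := key0 V' hV' r' hpos' h'
      rw [← hA i j hij hj] at hne
      exact hne (h.2.1 i j (by omega) hij hj)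
    have keys : ∀ V ∈ (range (n - 1)).powerset, ∀ V' ∈ (range (n - 1)).powerset, ∀ r r',
        1 ≤ p V → p V = p V' →
        Matched n (p V) b b b (S V) (T V) r → Matched n (p V') b b b (S V') (T V') r' →
        Agr n r r' → V ⊆ V' := by
      intro V hV V' hV' r r' hpos hpp h h' hA y hy
      have hyn := mem_range.mp (mem_powerset.mp hV hy)
      have hSm' := hSm V' (by omega)
      have hTm' := hTm V'
      rw [← hpp] at h' hSm' hTm'
      have k1 := matched_ST (hSm V hpos) (hTm V) h h' hA
      have k2 := matched_ST hSm' hTm' h' h (fun i j k k' => (hA i j k k').symm)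
      by_cases hyp : y < p V - 1
      · have : y ∈ S V' := k1.1 (by simp only [hS, mem_insert, mem_filter]; right; exact ⟨hy, hyp⟩)
        simp only [hS, mem_insert, mem_filter] at this
        rcases this with h | h
        · omega
        · exact h.1
      · by_contra hcon
        have : y + 1 ∈ T V := k2.2 (by
          simp only [hT, mem_filter, mem_Ico]
          exact ⟨by omega, by simpa using hcon⟩)
        simp only [hT, mem_filter, mem_Ico] at this
        exact this.2 (by simpa using hy)
    intro V hV V' hV' r r' h h' hA
    have hA' : Agr n r' r := fun i j k k' => (hA i j k k').symm
    have full : ∀ V ∈ (range (n - 1)).powerset, p V = 0 → V = range (n - 1) := by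
      intro V hV h0
      apply eq_of_subset_of_card_le (mem_powerset.mp hV)
      simp only [hp] at h0
      rw [card_range]; omega
    rcases h with ⟨h0, h⟩ | ⟨h0, h⟩ <;> rcases h' with ⟨h0', h'⟩ | ⟨h0', h'⟩
    · rw [full V hV h0, full V' hV' h0']
    · obtain ⟨i, j, hij, hj, hne, -⟩ := key0 V' hV' r' h0' h'
      rw [← hA i j hij hj] at hne
      exact absurd (h i j hij hj) hne
    · obtain ⟨i, j, hij, hj, hne, -⟩ := key0 V hV r h0 h
      rw [hA i j hij hj] at hne
      exact absurd (h' i j hij hj) hne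
    · have hpp : p V = p V' := le_antisymm (keyp V' hV' V hV r' r h0' h0 h' h hA')
        (keyp V hV V' hV' r r' h0 h0' h h' hA)
      exact subset_antisymm (keys V hV V' hV' r r' h0 hpp h h' hA)
        (keys V' hV' V hV r' r h0' hpp.symm h' h hA')

/-- type 2 structures give at least `2^(n-1)` graphs -/
theorem T2 {P : HerProp} {nest a b c d : Bool} {T : ℕ}
    (hP : ∀ s, Has P (2 * T) (Mod2 nest a b c d T s)) (n : ℕ) (hn : 1 ≤ n)
    (hT : (2 * n + 1) * (n + 1) ≤ T) : 2 ^ (n - 1) ≤ speed P n := by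
  classical
  have hnT : n ≤ T := by nlinarith
  by_cases hbc : b = c
  · subst hbc
    by_cases hn2 : n ≤ 2
    · exact T2_small hP n hn2 (by omega)
    by_cases hab : a = b
    · subst hab
      by_cases hd : d = a
      · subst hd; exact T2_homog hP n hn hT
      · refine le_trans (big_card' n (by omega)) (matched_core hP n hT _ ?_ ?_)
        · intro U hU; exact mem_powerset.mp (mem_filter.mp hU).1
        · intro U hU U' hU' hlt S T1 S' T1' r r' h h' hA
          simp only [mem_filter, mem_powerset] at hU hU'
          have c1 := card_le_card hU.1
          rw [card_range] at c1
          have k1 := h.2.1 (n - U'.card - 1) (n - 1) (by omega) (by omega) (by omega)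
          have k2 := h.2.1 (n - U'.card - 1) (n - 2) (by omega) (by omega) (by omega)
          rw [hA _ _ (by omega) (by omega)] at k1 k2
          have := h'.2.2.2.2.2.2 (n - U'.card - 1) (n - 1) (n - 2) (by omega) (by omega) (by omega)
            (by omega) (by omega) (by rw [k1]; exact hd) (by rw [k2]; exact hd)
          omega
    · refine le_trans (big_card n (by omega)) (matched_core hP n hT _ ?_ ?_)
      · intro U hU; exact mem_powerset.mp (mem_filter.mp hU).1
      · intro U hU U' hU' hlt S T1 S' T1' r r' h h' hA
        simp only [mem_filter, mem_powerset] at hU hU'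
        have k1 := h'.1 0 (n - U.card) (by omega) (by omega) (by omega)
        have k2 := h'.1 1 (n - U.card) (by omega) (by omega) (by omega)
        rw [← hA _ _ (by omega) (by omega)] at k1 k2
        have := h.2.2.2.2.2.1 0 1 (n - U.card) (by omega) (by omega) le_rfl (by omega)
          (by rw [k1]; exact hab) (by rw [k2]; exact hab)
        omega
  · exact T2_half hP n hn hnT hbc

/-- no long repetition of an irreducible block of size `k+1` -/
def NoRep (P : HerProp) (k t : ℕ) : Prop :=
  ∀ e B, Irr e (k + 1) B → ¬ Has P (t * (k + 1)) (rep e (k + 1) B)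

/-- a sequence of disjoint blocks repeating an irreducible block is impossible -/
theorem norep_blocks {P : HerProp} {k t N : ℕ} {r : ℕ → ℕ → Bool} (h : Has P N r)
    (hk : NoRep P k t) (e : Bool) (B : ℕ → ℕ → Bool) (hB : Irr e (k + 1) B)
    (X : ℕ → ℕ → ℕ) (hX : ∀ i a b, i < t → a < b → b ≤ k → X i a < X i b)
    (hXX : ∀ i j a b, i < j → j < t → a ≤ k → b ≤ k → X i a < X j b ∧ r (X i a) (X j b) = e)
    (hN : ∀ i a, i < t → a ≤ k → X i a < N)
    (hXB : ∀ i a b, i < t → a < b → b ≤ k → r (X i a) (X i b) = B a b) : False := by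
  apply hk e B hB
  have hmod : ∀ u, u % (k + 1) ≤ k := fun u =>
    Nat.lt_succ_iff.mp (Nat.mod_lt u (Nat.succ_pos k))
  have hdiv : ∀ u, u < t * (k + 1) → u / (k + 1) < t := fun u hu =>
    Nat.div_lt_of_lt_mul (by rwa [mul_comm] at hu)
  have hcase : ∀ u v, u < v → u / (k + 1) < v / (k + 1) ∨
      (u / (k + 1) = v / (k + 1) ∧ u % (k + 1) < v % (k + 1)) := by
    intro u v huv
    have h1 : u / (k + 1) ≤ v / (k + 1) := Nat.div_le_div_right huv.le
    rcases h1.lt_or_eq with h2 | h2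
    · left; exact h2
    · right
      refine ⟨h2, ?_⟩
      have e1 := Nat.div_add_mod u (k + 1)
      have e2 := Nat.div_add_mod v (k + 1)
      rw [h2] at e1
      omega
  refine h.sub (fun u => X (u / (k + 1)) (u % (k + 1))) ?_ ?_ ?_
  · intro u v huv hv
    rcases hcase u v huv with h2 | ⟨h2, h3⟩
    · exact (hXX _ _ _ _ h2 (hdiv v hv) (hmod u) (hmod v)).1
    · simp only [h2]
      exact hX _ _ _ (hdiv v hv) h3 (hmod v)
  · intro u hu
    exact hN _ _ (hdiv u hu) (hmod u)
  · intro u v huv hv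
    rcases hcase u v huv with h2 | ⟨h2, h3⟩
    · simp only [rep, h2.ne, if_false]
      exact (hXX _ _ _ _ h2 (hdiv v hv) (hmod u) (hmod v)).2.symm
    · simp only [rep, h2, if_true]
      exact (hXB _ _ _ (hdiv v hv) h3 (hmod v)).symm

/-- gadget coordinates -/
def Gd (k : ℕ) (v w : ℕ → ℕ) (i α : ℕ) : ℕ := if α ≤ k then v i + α else w i

theorem bool_two {x y e : Bool} (h : x ≠ y) : x ≠ e ∨ y ≠ e := by
  cases x <;> cases y <;> cases e <;> simp at h ⊢

theorem gad_contra {P : HerProp} {k t n0 N : ℕ} {r : ℕ → ℕ → Bool} (hk1 : 1 ≤ k) (hn0 : 1 ≤ n0)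
    (hsp : speed P n0 < 2 ^ (n0 - 1)) (hk : NoRep P k t) (h : Has P N r)
    (T : ℕ) (hT : T = t + (2 * n0 + 1) * (n0 + 1) + 3) (v w : ℕ → ℕ)
    (hv : ∀ i j, i < j → j < T → v i + k < v j)
    (hw : ∀ i, i < T → v i + k < w i ∧ w i < N)
    (hne : ∀ i, i < T → r (v i) (w i) ≠ r (v i + 1) (w i))
    (c1 c2 c3 c4 : Bool) (cr un : ℕ → ℕ → Bool)
    (h1 : ∀ i j, i < j → j < T → decide (w i < v j) = c1)
    (h2 : ∀ i j, i < j → j < T → decide (v j + k < w i) = c2)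
    (h3 : ∀ i j, i < j → j < T → decide (w i < w j) = c3)
    (h4 : ∀ i j, i < j → j < T → decide (w i = w j) = c4)
    (hcr : ∀ i j, i < j → j < T → ∀ α β, α ≤ k + 1 → β ≤ k + 1 →
      sy r (Gd k v w i α) (Gd k v w j β) = cr α β)
    (hun : ∀ i j, i < j → j < T → ∀ α β, α ≤ k + 1 → β ≤ k + 1 →
      r (Gd k v w i α) (Gd k v w i β) = un α β) : False := by
  have hTn : n0 + 2 ≤ T := by nlinarith
  have hT2 : (2 * n0 + 1) * (n0 + 1) ≤ T := by omega
  have hTt : t + 1 ≤ T := by omega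
  have hnot : ¬ 2 ^ (n0 - 1) ≤ speed P n0 := not_le.mpr hsp
  have hGv : ∀ i α, α ≤ k → Gd k v w i α = v i + α := fun i α h => by simp [Gd, h]
  have hGw : ∀ i, Gd k v w i (k + 1) = w i := fun i => by simp [Gd]
  cases hc1 : c1
  · cases hc2 : c2
    · -- impossible
      subst hc1 hc2
      have a1 := h2 0 1 (by omega) (by omega)
      have a2 := h1 0 2 (by omega) (by omega)
      have a3 := hv 1 2 (by omega) (by omega)
      simp only [decide_eq_false_iff_not, not_lt] at a1 a2
      omega
    · subst hc1 hc2
      have hvw : ∀ i j, i < T → j < T → v j + k < w i := by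
        intro i j hi hj
        rcases lt_trichotomy i j with hij | hij | hij
        · have := h2 i j hij hj; simpa using this
        · subst hij; exact (hw i hi).1
        · have := hv j i hij hi; have := (hw i hi).1; omega
      cases hc4 : c4
      · subst hc4
        have hww : ∀ i j, i < T → j < T → i ≠ j → w i ≠ w j := by
          intro i j hi hj hij
          rcases lt_or_gt_of_ne hij with hij | hij
          · have := h4 i j hij hj; simpa using this
          · have := h4 j i hij hi; simp at this; omega
        -- colours
        have ca : ∀ i j α β, i < j → j < T → α ≤ 1 → β ≤ 1 → r (v i + α) (v j + β) = cr α β := by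
          intro i j α β hij hj hα hβ
          have := hcr i j hij hj α β (by omega) (by omega)
          rw [hGv _ _ (by omega), hGv _ _ (by omega), sy_lt] at this
          · exact this
          · have := hv i j hij hj; omega
        have cb : ∀ i j α, i < j → j < T → α ≤ 1 → r (v i + α) (w j) = cr α (k + 1) := by
          intro i j α hij hj hα
          have := hcr i j hij hj α (k + 1) (by omega) (by omega)
          rw [hGv _ _ (by omega), hGw, sy_lt] at this
          · exact this
          · have := hvw j i hj (by omega); omega
        have cc : ∀ i j α, i < j → j < T → α ≤ 1 → r (v j + α) (w i) = cr (k + 1) α := by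
          intro i j α hij hj hα
          have := hcr i j hij hj (k + 1) α (by omega) (by omega)
          rw [hGw, hGv _ _ (by omega), sy_gt] at this
          · exact this
          · have := hvw i j (by omega) hj; omega
        have cd : ∀ i j, i < j → j < T → sy r (w i) (w j) = cr (k + 1) (k + 1) := by
          intro i j hij hj
          have := hcr i j hij hj (k + 1) (k + 1) (by omega) (by omega)
          rwa [hGw, hGw] at this
        have a1 : ∀ α, α ≤ 1 → cr α 0 = cr α 1 := by
          intro α hα
          by_contra hcon
          apply hnot
          apply T1R h n0 (v 0 + α) (by have := hw 0 (by omega); omega) (fun i => v (i + 1) + 0)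
            (fun i => v (i + 1) + 1)
          · intro i hi
            have := hv 0 (i + 1) (by omega) (by omega)
            have := hw (i + 1) (by omega)
            omega
          · intro i hi
            have := hv 0 (i + 1) (by omega) (by omega)
            have := hw (i + 1) (by omega)
            omega
          · intro i hi
            rw [ca 0 (i + 1) α 0 (by omega) (by omega) hα (by omega),
              ca 0 (i + 1) α 1 (by omega) (by omega) hα (by omega)]
            exact hcon
          · intro i j hij hj
            have := hv (i + 1) (j + 1) (by omega) (by omega)
            omega
        have a2 : ∀ β, β ≤ 1 → cr 0 β = cr 1 β := by
          intro β hβ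
          by_contra hcon
          apply hnot
          apply T1L h n0 (v (T - 1) + β) (by have := hw (T - 1) (by omega); omega) (fun i => v i + 0)
            (fun i => v i + 1)
          · intro i hi
            have := hv i (T - 1) (by omega) (by omega)
            omega
          · intro i hi
            have := hv i (T - 1) (by omega) (by omega)
            omega
          · intro i hi
            rw [ca i (T - 1) 0 β (by omega) (by omega) (by omega) hβ,
              ca i (T - 1) 1 β (by omega) (by omega) (by omega) hβ]
            exact hcon
          · intro i j hij hj
            have := hv i j (by omega) (by omega)
            omega
        have b1 : cr 0 (k + 1) = cr 1 (k + 1) := by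
          by_contra hcon
          apply hnot
          apply T1L h n0 (w (T - 1)) (hw (T - 1) (by omega)).2 (fun i => v i + 0)
            (fun i => v i + 1)
          · intro i hi
            have := hvw (T - 1) i (by omega) (by omega)
            omega
          · intro i hi
            have := hvw (T - 1) i (by omega) (by omega)
            omega
          · intro i hi
            rw [cb i (T - 1) 0 (by omega) (by omega) (by omega),
              cb i (T - 1) 1 (by omega) (by omega) (by omega)]
            exact hcon
          · intro i j hij hj
            have := hv i j (by omega) (by omega)
            omega
        have b2 : cr (k + 1) 0 = cr (k + 1) 1 := by
          by_contra hcon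
          apply hnot
          apply T1L h n0 (w 0) (hw 0 (by omega)).2 (fun i => v (i + 1) + 0)
            (fun i => v (i + 1) + 1)
          · intro i hi
            have := hvw 0 (i + 1) (by omega) (by omega)
            omega
          · intro i hi
            have := hvw 0 (i + 1) (by omega) (by omega)
            omega
          · intro i hi
            rw [cc 0 (i + 1) 0 (by omega) (by omega) (by omega),
              cc 0 (i + 1) 1 (by omega) (by omega) (by omega)]
            exact hcon
          · intro i j hij hj
            have := hv (i + 1) (j + 1) (by omega) (by omega)
            omega
        have le1 : ∀ α, α ≤ 1 → α = 0 ∨ α = 1 := fun α h => by omega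
        have ca' : ∀ i j α β, i < j → j < T → α ≤ 1 → β ≤ 1 →
            r (v i + α) (v j + β) = cr 0 0 := by
          intro i j α β hij hj hα hβ
          rw [ca i j α β hij hj hα hβ]
          rcases le1 α hα with rfl | rfl <;> rcases le1 β hβ with rfl | rfl
          · rfl
          · rw [a1 0 (by omega)]
          · rw [a2 0 (by omega)]
          · rw [← a1 1 (by omega), ← a2 0 (by omega)]
        have cb' : ∀ i j α, i < j → j < T → α ≤ 1 → r (v i + α) (w j) = cr 0 (k + 1) := by
          intro i j α hij hj hα
          rw [cb i j α hij hj hα]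
          rcases le1 α hα with rfl | rfl
          · rfl
          · exact b1.symm
        have cc' : ∀ i j α, i < j → j < T → α ≤ 1 → r (v j + α) (w i) = cr (k + 1) 0 := by
          intro i j α hij hj hα
          rw [cc i j α hij hj hα]
          rcases le1 α hα with rfl | rfl
          · rfl
          · exact b2.symm
        apply hnot
        apply T2 (nest := !c3) (a := cr 0 0) (b := cr 0 (k + 1)) (c := cr (k + 1) 0)
          (d := cr (k + 1) (k + 1)) (T := T) _ n0 hn0 hT2
        intro s
        have hα : ∀ i, ∃ α, α ≤ 1 ∧ (i < T → r (v i + α) (w i) = s i) := by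
          intro i
          by_cases hi : i < T
          · have := hne i hi
            by_cases hs : r (v i) (w i) = s i
            · exact ⟨0, by omega, fun _ => hs⟩
            · refine ⟨1, le_rfl, fun _ => ?_⟩
              revert this hs
              cases r (v i) (w i) <;> cases r (v i + 1) (w i) <;> cases s i <;> simp
          · exact ⟨0, by omega, fun h => absurd h hi⟩
        choose α hα1 hα2 using hα
        have idx : ∀ u, T ≤ u → u < 2 * T →
            (if (!c3) = true then 2 * T - 1 - u else u - T) < T := by
          intro u h h'
          split_ifs <;> omega
        have hwmono : ∀ u u', T ≤ u → u < u' → u' < 2 * T →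
            w (if (!c3) = true then 2 * T - 1 - u else u - T) <
            w (if (!c3) = true then 2 * T - 1 - u' else u' - T) := by
          intro u u' hu huu hu'
          cases c3
          · simp only [Bool.not_false, if_true]
            have k1 := h3 (2 * T - 1 - u') (2 * T - 1 - u) (by omega) (by omega)
            have k2 := hww (2 * T - 1 - u') (2 * T - 1 - u) (by omega) (by omega) (by omega)
            simp only [decide_eq_false_iff_not] at k1
            omega
          · simp only [Bool.not_true, Bool.false_eq_true, if_false]
            have k1 := h3 (u - T) (u' - T) (by omega) (by omega)
            simpa using k1
        refine h.sub (fun u => if u < T then v u + α u else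
          w (if (!c3) = true then 2 * T - 1 - u else u - T)) ?_ ?_ ?_
        · intro u u' huu hu'
          have l1 := hα1 u
          have l2 := hα1 u'
          by_cases hu'T : u' < T
          · simp only [hu'T, lt_trans huu hu'T, if_true]
            have := hv u u' huu hu'T; omega
          · by_cases huT : u < T
            · simp only [hu'T, huT, if_true, if_false]
              have := hvw _ u (idx u' (by omega) hu') huT
              omega
            · simp only [hu'T, huT, if_false]
              exact hwmono u u' (by omega) huu hu'
        · intro u hu
          have l1 := hα1 u
          by_cases huT : u < T
          · simp only [huT, if_true]; have := hw u huT; omega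
          · simp only [huT, if_false]; exact (hw _ (idx u (by omega) hu)).2
        · intro u u' huu hu'
          have l1 := hα1 u
          have l2 := hα1 u'
          by_cases hu'T : u' < T
          · simp only [Mod2, hu'T, lt_trans huu hu'T, if_true]
            rw [ca' u u' _ _ huu hu'T l1 l2]
          · by_cases huT : u < T
            · have hi := idx u' (by omega) hu'
              simp only [Mod2, hu'T, huT, if_true, if_false, not_le_of_gt huT]
              set x := (if (!c3) = true then 2 * T - 1 - u' else u' - T) with hx
              rcases lt_trichotomy u x with k1 | k1 | k1
              · rw [if_pos k1, cb' u x _ k1 hi l1]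
              · rw [if_neg (by omega), if_neg (by omega), ← k1, hα2 u huT]
              · rw [if_neg (by omega), if_pos k1, cc' x u _ k1 huT l1]
            · have hi := idx u (by omega) (by omega)
              have hi' := idx u' (by omega) hu'
              have hTu : T ≤ u := by omega
              simp only [Mod2, hu'T, huT, if_true, if_false, hTu]
              rw [← sy_lt (r := r) (hwmono u u' hTu huu hu')]
              have hneq : (if (!c3) = true then 2 * T - 1 - u else u - T) ≠
                  (if (!c3) = true then 2 * T - 1 - u' else u' - T) := by
                split_ifs <;> omega
              rcases lt_or_gt_of_ne hneq with k1 | k1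
              · rw [cd _ _ k1 hi']
              · rw [sy_comm, cd _ _ k1 hi]
      · subst hc4
        have hww : ∀ i, i < T → w i = w 0 := by
          intro i hi
          rcases Nat.eq_zero_or_pos i with rfl | hpos
          · rfl
          · have := h4 0 i hpos hi; simp at this; exact this.symm
        apply hnot
        apply T1L h n0 (w 0) (hw 0 (by omega)).2 v (fun i => v i + 1)
        · intro i hi
          have := hvw 0 i (by omega) (by omega); omega
        · intro i hi
          have := hvw 0 i (by omega) (by omega); omega
        · intro i hi
          rw [← hww i (by omega)]; exact hne i (by omega)
        · intro i j hij hj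
          have := hv i j (by omega) (by omega)
          omega
  · -- local
    subst hc1
    have hwv : ∀ i j, i < j → j < T → w i < v j := by
      intro i j hij hj
      have := h1 i j hij hj; simpa using this
    have hGl : ∀ i α, i < T → α ≤ k + 1 → v i ≤ Gd k v w i α ∧ Gd k v w i α ≤ w i := by
      intro i α hi hα
      have := (hw i hi).1
      simp only [Gd]; split_ifs <;> omega
    have hGG : ∀ i j α β, i < j → j < T → α ≤ k + 1 → β ≤ k + 1 →
        Gd k v w i α < Gd k v w j β := by
      intro i j α β hij hj hα hβ
      have := hGl i α (by omega) hα
      have := hGl j β hj hβ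
      have := hwv i j hij hj
      omega
    have hcr' : ∀ i j α β, i < j → j < T → α ≤ k + 1 → β ≤ k + 1 →
        r (Gd k v w i α) (Gd k v w j β) = cr α β := by
      intro i j α β hij hj hα hβ
      have := hcr i j hij hj α β hα hβ
      rwa [sy_lt (hGG i j α β hij hj hα hβ)] at this
    have a1 : ∀ α β β', α ≤ k + 1 → β ≤ k + 1 → β' ≤ k + 1 → cr α β = cr α β' := by
      intro α β β' hα hβ hβ'
      by_contra hcon
      apply hnot
      apply T1R h n0 (Gd k v w 0 α)
        (lt_of_le_of_lt (hGl 0 α (by omega) hα).2 (hw 0 (by omega)).2)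
        (fun i => Gd k v w (i + 1) β) (fun i => Gd k v w (i + 1) β')
      · intro i hi
        exact ⟨hGG _ _ _ _ (by omega) (by omega) hα hβ,
          lt_of_le_of_lt (hGl _ _ (by omega) hβ).2 (hw _ (by omega)).2⟩
      · intro i hi
        exact ⟨hGG _ _ _ _ (by omega) (by omega) hα hβ',
          lt_of_le_of_lt (hGl _ _ (by omega) hβ').2 (hw _ (by omega)).2⟩
      · intro i hi
        rw [hcr' _ _ _ _ (by omega) (by omega) hα hβ, hcr' _ _ _ _ (by omega) (by omega) hα hβ']
        exact hcon
      · intro i j hij hj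
        exact ⟨hGG _ _ _ _ (by omega) (by omega) hβ hβ, hGG _ _ _ _ (by omega) (by omega) hβ hβ',
          hGG _ _ _ _ (by omega) (by omega) hβ' hβ, hGG _ _ _ _ (by omega) (by omega) hβ' hβ'⟩
    have a2 : ∀ α α' β, α ≤ k + 1 → α' ≤ k + 1 → β ≤ k + 1 → cr α β = cr α' β := by
      intro α α' β hα hα' hβ
      by_contra hcon
      apply hnot
      apply T1L h n0 (Gd k v w (T - 1) β)
        (lt_of_le_of_lt (hGl (T - 1) β (by omega) hβ).2 (hw (T - 1) (by omega)).2)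
        (fun i => Gd k v w i α) (fun i => Gd k v w i α')
      · intro i hi
        exact hGG _ _ _ _ (by omega) (by omega) hα hβ
      · intro i hi
        exact hGG _ _ _ _ (by omega) (by omega) hα' hβ
      · intro i hi
        rw [hcr' _ _ _ _ (by omega) (by omega) hα hβ, hcr' _ _ _ _ (by omega) (by omega) hα' hβ]
        exact hcon
      · intro i j hij hj
        exact ⟨hGG _ _ _ _ (by omega) (by omega) hα hα, hGG _ _ _ _ (by omega) (by omega) hα hα',
          hGG _ _ _ _ (by omega) (by omega) hα' hα, hGG _ _ _ _ (by omega) (by omega) hα' hα'⟩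
    have hcre : ∀ α β, α ≤ k + 1 → β ≤ k + 1 → cr α β = cr 0 0 := by
      intro α β hα hβ
      rw [a1 α β 0 hα hβ (by omega), a2 α 0 0 hα (by omega) (by omega)]
    have hα0 : ∃ α0, α0 ≤ 1 ∧ un α0 (k + 1) ≠ cr 0 0 := by
      have k0 := hun 0 1 (by omega) (by omega) 0 (k + 1) (by omega) le_rfl
      have k1 := hun 0 1 (by omega) (by omega) 1 (k + 1) (by omega) le_rfl
      rw [hGv _ _ (by omega), hGw] at k0 k1
      have := hne 0 (by omega)
      rw [Nat.add_zero] at k0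
      rw [k0, k1] at this
      rcases bool_two (e := cr 0 0) this with hh | hh
      · exact ⟨0, by omega, hh⟩
      · exact ⟨1, le_rfl, hh⟩
    obtain ⟨α0, hα01, hα0⟩ := hα0
    set hh : ℕ → ℕ := fun a => if a = 0 then α0 else a + 1 with hhdef
    have hhle : ∀ a, a ≤ k → hh a ≤ k + 1 := by
      intro a ha; simp only [hhdef]; split_ifs <;> omega
    have hhlt : ∀ a b, a < b → b ≤ k → hh a < hh b := by
      intro a b hab hb; simp only [hhdef]; split_ifs <;> omega
    refine norep_blocks h hk (cr 0 0) (fun a b => un (hh a) (hh b)) ?_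
      (fun i a => Gd k v w i (hh a)) ?_ ?_ ?_ ?_
    · intro g hg0 hg
      refine ⟨0, k, hg0, by omega, by omega, ?_⟩
      have : k ≠ 0 := by omega
      simp only [hhdef, this, if_true, if_false]
      exact hα0
    · intro i a b hi hab hb
      have k1 := hhlt a b hab hb
      have k2 := hhle b hb
      have := (hw i (by omega)).1
      simp only [Gd]; split_ifs <;> omega
    · intro i j a b hij hj ha hb
      have k1 := hhle a ha
      have k2 := hhle b hb
      refine ⟨hGG _ _ _ _ hij (by omega) k1 k2, ?_⟩
      rw [hcr' _ _ _ _ hij (by omega) k1 k2, hcre _ _ k1 k2]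
    · intro i a hi ha
      exact lt_of_le_of_lt (hGl _ _ (by omega) (hhle a ha)).2 (hw _ (by omega)).2
    · intro i a b hi hab hb
      exact hun i (i + 1) (by omega) (by omega) _ _ (hhle a (by omega)) (hhle b hb)

theorem mono_gap {n : ℕ} {f : ℕ → ℕ} (hf : ∀ i j, i < j → j < n → f i < f j) (i d : ℕ)
    (hi : i + d < n) : f i + d ≤ f (i + d) := by
  induction d with
  | zero => simp
  | succ d ih =>
    have := ih (by omega)
    have := hf (i + d) (i + (d + 1)) (by omega) hi
    omega

/-- the number of long right changes is bounded -/
theorem KL {P : HerProp} {k t n0 : ℕ} (hk1 : 1 ≤ k) (hn0 : 1 ≤ n0)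
    (hsp : speed P n0 < 2 ^ (n0 - 1)) (hk : NoRep P k t) :
    ∃ C, ∀ N r, Has P N r → ∀ RC : Finset ℕ,
      (∀ v ∈ RC, ∃ w, v + 1 + k ≤ w ∧ w < N ∧ r v w ≠ r (v + 1) w) → RC.card ≤ C := by
  classical
  obtain ⟨R, hR⟩ := ramsey (Bool × Bool × Bool × Bool × (Fin (k + 2) → Fin (k + 2) → Bool) ×
    (Fin (k + 2) → Fin (k + 2) → Bool)) (t + (2 * n0 + 1) * (n0 + 1) + 3)
  refine ⟨(k + 1) * R, fun N r h RC hRC => ?_⟩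
  by_contra hcon
  rw [not_le] at hcon
  obtain ⟨g, g1, g2, -⟩ := enum_exists RC
  have hex : ∀ i, ∃ w, i < R → g ((k + 1) * i) + 1 + k ≤ w ∧ w < N ∧
      r (g ((k + 1) * i)) w ≠ r (g ((k + 1) * i) + 1) w := by
    intro i
    by_cases hi : i < R
    · have : (k + 1) * i < RC.card := lt_of_le_of_lt (Nat.mul_le_mul_left _ hi.le) hcon
      obtain ⟨w, hw⟩ := hRC _ (g2 _ this)
      exact ⟨w, fun _ => hw⟩
    · exact ⟨0, fun h => absurd h hi⟩
  choose W hW using hex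
  set V : ℕ → ℕ := fun i => g ((k + 1) * i) with hV
  have hVV : ∀ i j, i < j → j < R → V i + k < V j := by
    intro i j hij hj
    have e1 : (k + 1) * i + (k + 1) ≤ (k + 1) * j := by nlinarith
    have e2 : (k + 1) * j < RC.card := lt_of_le_of_lt (Nat.mul_le_mul_left _ hj.le) hcon
    have e3 := mono_gap g1 ((k + 1) * i) (k + 1) (by omega)
    have e4 := mono_le g1 e1 e2
    simp only [hV]
    omega
  obtain ⟨q, ⟨c1, c2, c3, c4, cr, un⟩, q1, q2, q3⟩ := hR (fun i j =>
    (decide (W i < V j), decide (V j + k < W i), decide (W i < W j), decide (W i = W j),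
      fun α β => sy r (Gd k V W i α) (Gd k V W j β), fun α β => r (Gd k V W i α) (Gd k V W i β)))
  have hfin : ∀ α, α ≤ k + 1 → ((Fin.ofNat (k + 2) α : Fin (k + 2)) : ℕ) = α := by
    intro α hα
    simp only [Fin.ofNat]
    exact Nat.mod_eq_of_lt (by omega)
  have hG : ∀ i α, Gd k (fun i => V (q i)) (fun i => W (q i)) i α = Gd k V W (q i) α :=
    fun i α => rfl
  refine gad_contra hk1 hn0 hsp hk h _ rfl (fun i => V (q i)) (fun i => W (q i)) ?_ ?_ ?_
    c1 c2 c3 c4 (fun α β => cr (Fin.ofNat _ α) (Fin.ofNat _ β))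
    (fun α β => un (Fin.ofNat _ α) (Fin.ofNat _ β)) ?_ ?_ ?_ ?_ ?_ ?_
  · intro i j hij hj
    exact hVV _ _ (q1 i j hij hj) (q2 j hj)
  · intro i hi
    have := hW (q i) (q2 i hi)
    simp only [hV]
    exact ⟨by omega, this.2.1⟩
  · intro i hi
    exact (hW (q i) (q2 i hi)).2.2
  · intro i j hij hj; have := q3 i j hij hj; simp only [Prod.mk.injEq] at this; exact this.1
  · intro i j hij hj; have := q3 i j hij hj; simp only [Prod.mk.injEq] at this; exact this.2.1
  · intro i j hij hj; have := q3 i j hij hj; simp only [Prod.mk.injEq] at this; exact this.2.2.1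
  · intro i j hij hj; have := q3 i j hij hj; simp only [Prod.mk.injEq] at this; exact this.2.2.2.1
  · intro i j hij hj α β hα hβ
    have := q3 i j hij hj
    simp only [Prod.mk.injEq] at this
    have := congrFun (congrFun this.2.2.2.2.1 (Fin.ofNat _ α)) (Fin.ofNat _ β)
    simp only [hfin α hα, hfin β hβ] at this
    simpa only [hG] using this
  · intro i j hij hj α β hα hβ
    have := q3 i j hij hj
    simp only [Prod.mk.injEq] at this
    have := congrFun (congrFun this.2.2.2.2.2 (Fin.ofNat _ α)) (Fin.ofNat _ β)
    simp only [hfin α hα, hfin β hβ] at this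
    simpa only [hG] using this

/-- class index of a vertex relative to a set of cuts -/
def clz (Z : Finset ℕ) (v : ℕ) : ℕ := (Z.filter (fun z => z ≤ v)).card

theorem clz_mono (Z : Finset ℕ) {u v : ℕ} (h : u ≤ v) : clz Z u ≤ clz Z v := by
  apply card_le_card
  intro z hz
  simp only [mem_filter] at hz ⊢
  exact ⟨hz.1, by omega⟩

theorem clz_le (Z : Finset ℕ) (u : ℕ) : clz Z u ≤ Z.card := card_le_card (filter_subset _ _)

theorem clz_no {Z : Finset ℕ} {u v : ℕ} (h : clz Z u = clz Z v) {z : ℕ} (hz : z ∈ Z)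
    (h1 : u < z) (h2 : z ≤ v) : False := by
  have hsub : Z.filter (fun z => z ≤ u) ⊆ Z.filter (fun z => z ≤ v) := by
    intro z hz
    simp only [mem_filter] at hz ⊢
    exact ⟨hz.1, by omega⟩
  have := eq_of_subset_of_card_le hsub h.symm.le
  have h3 : z ∈ Z.filter (fun z => z ≤ v) := by simp [hz, h2]
  rw [← this] at h3
  simp at h3
  omega

theorem clz_eq {Z : Finset ℕ} {u v : ℕ} (huv : u ≤ v) (h : ∀ z ∈ Z, u < z → z ≤ v → False) :
    clz Z u = clz Z v := by
  unfold clz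
  congr 1
  ext z
  simp only [mem_filter]
  constructor
  · rintro ⟨h1, h2⟩; exact ⟨h1, by omega⟩
  · rintro ⟨h1, h2⟩
    refine ⟨h1, ?_⟩
    by_contra h3
    exact h z h1 (by omega) h2

theorem clz_sub {Z Z' : Finset ℕ} (hZ : Z ⊆ Z') {u v : ℕ} (h : clz Z' u = clz Z' v) :
    clz Z u = clz Z v := by
  rcases le_total u v with h1 | h1
  · exact clz_eq h1 (fun z hz a b => clz_no h (hZ hz) a b)
  · exact (clz_eq h1 (fun z hz a b => clz_no h.symm (hZ hz) a b)).symm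

theorem clz_mid {Z : Finset ℕ} {u x v : ℕ} (h : clz Z u = clz Z v) (h1 : u ≤ x) (h2 : x ≤ v) :
    clz Z x = clz Z u := by
  have := clz_mono Z h1
  have := clz_mono Z h2
  omega

theorem alt_bound {P : HerProp} {n0 N : ℕ} {r : ℕ → ℕ → Bool} (hn0 : 1 ≤ n0)
    (hsp : speed P n0 < 2 ^ (n0 - 1)) (h : Has P N r) (a : ℕ) (X : Finset ℕ)
    (hX : ∀ w ∈ X, a + 1 < w ∧ w < N ∧ r a (w - 1) ≠ r a w) : X.card ≤ 2 * n0 := by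
  by_contra hcon
  rw [not_le] at hcon
  obtain ⟨g, g1, g2, -⟩ := enum_exists X
  have hh : ∀ i, i < n0 - 1 → a + 1 < g (2 * i) ∧ g (2 * i) < N ∧
      r a (g (2 * i) - 1) ≠ r a (g (2 * i)) := fun i hi => hX _ (g2 _ (by omega))
  apply not_le.mpr hsp
  apply T1R h n0 a (by have := hX _ (g2 0 (by omega)); omega) (fun i => g (2 * i) - 1)
    (fun i => g (2 * i))
  · intro i hi; have := hh i hi; constructor <;> omega
  · intro i hi; have := hh i hi; constructor <;> omega
  · intro i hi; exact (hh i hi).2.2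
  · intro i j hij hj
    have e1 := mono_gap g1 (2 * i) 2 (by omega)
    have e2 := mono_le g1 (i := 2 * i + 2) (j := 2 * j) (by omega) (by omega)
    have := hh i (by omega)
    refine ⟨?_, ?_, ?_, ?_⟩ <;> omega

/-- long pairs are determined by classes -/
theorem classes {P : HerProp} {k t n0 : ℕ} (hk1 : 1 ≤ k) (hn0 : 1 ≤ n0)
    (hsp : speed P n0 < 2 ^ (n0 - 1)) (hk : NoRep P k t) :
    ∃ C, ∀ N r, Has P N r → ∃ (Z : Finset ℕ) (m : ℕ → ℕ → Bool), Z.card ≤ C ∧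
      ∀ u w, u + k ≤ w → w < N → r u w = m (clz Z u) (clz Z w) := by
  classical
  obtain ⟨C, hC⟩ := KL hk1 hn0 hsp hk
  refine ⟨C + (C + 1) * (2 * n0), fun N r h => ?_⟩
  set RC := (range N).filter (fun v => ∃ w, v + 1 + k ≤ w ∧ w < N ∧ r v w ≠ r (v + 1) w) with hRC
  have hRCc : RC.card ≤ C := hC N r h RC (fun v hv => (mem_filter.mp hv).2)
  set Z1 := RC.image (fun v => v + 1) with hZ1
  have hZ1c : Z1.card ≤ C := card_image_le.trans hRCc
  set X : ℕ → Finset ℕ := fun a => (range N).filter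
    (fun w => a + 1 < w ∧ w < N ∧ r a (w - 1) ≠ r a w) with hX
  have hXc : ∀ a, (X a).card ≤ 2 * n0 := fun a =>
    alt_bound hn0 hsp h a (X a) (fun w hw => (mem_filter.mp hw).2)
  set Z2 := (insert 0 Z1).biUnion X with hZ2
  have hZ2c : Z2.card ≤ (C + 1) * (2 * n0) := by
    refine (card_biUnion_le_card_mul _ _ (2 * n0) (fun a _ => hXc a)).trans ?_
    exact Nat.mul_le_mul_right _ ((card_insert_le _ _).trans (by omega))
  set Z := Z1 ∪ Z2 with hZ
  have chain : ∀ u d w, (∀ z ∈ Z1, u < z → z ≤ u + d → False) → u + d + k ≤ w → w < N →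
      r u w = r (u + d) w := by
    intro u d
    induction d with
    | zero => intro w _ _ _; rfl
    | succ d ih =>
      intro w hz hw hN
      rw [ih w (fun z hz1 a b => hz z hz1 a (by omega)) (by omega) hN]
      by_contra hne
      apply hz (u + d + 1) _ (by omega) (by omega)
      rw [hZ1, mem_image]
      refine ⟨u + d, ?_, rfl⟩
      rw [hRC, mem_filter, mem_range]
      exact ⟨by omega, w, by omega, hN, hne⟩
  have chain2 : ∀ a w d, a ∈ insert 0 Z1 → (∀ z ∈ Z2, w < z → z ≤ w + d → False) → a < w →
      w + d < N → r a w = r a (w + d) := by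
    intro a w d
    induction d with
    | zero => intro _ _ _ _; rfl
    | succ d ih =>
      intro ha hz haw hN
      rw [ih ha (fun z hz1 a b => hz z hz1 a (by omega)) haw (by omega)]
      by_contra hne
      apply hz (w + d + 1) _ (by omega) (by omega)
      rw [hZ2, mem_biUnion]
      refine ⟨a, ha, ?_⟩
      rw [hX, mem_filter, mem_range]
      exact ⟨by omega, by omega, by omega, hne⟩
  have start : ∀ u, ∃ a, a ∈ insert 0 Z1 ∧ a ≤ u ∧ (∀ z ∈ Z1, a < z → z ≤ u → False) := by
    intro u
    refine ⟨Nat.findGreatest (fun a => a ∈ insert 0 Z1) u, ?_, Nat.findGreatest_le _, ?_⟩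
    · exact Nat.findGreatest_spec (P := fun a => a ∈ insert 0 Z1) (Nat.zero_le u) (by simp)
    · intro z hz h1 h2
      exact Nat.findGreatest_is_greatest h1 h2 (mem_insert_of_mem hz)
  have hZZ1 : Z1 ⊆ Z := subset_union_left
  have hZZ2 : Z2 ⊆ Z := subset_union_right
  have key0 : ∀ u w u' w', u ≤ u' → clz Z u = clz Z u' → clz Z w = clz Z w' → u + k ≤ w → w < N →
      u' + k ≤ w' → w' < N → r u w = r u' w' := by
    intro u w u' w' huu hu hw h1 h2 h3 h4
    obtain ⟨a, ha, hau, haz⟩ := start u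
    have e1 : r a w = r u w := by
      have := chain a (u - a) w (fun z hz x y => haz z hz x (by omega)) (by omega) h2
      rwa [show a + (u - a) = u by omega] at this
    have e2 : r a w' = r u' w' := by
      have := chain a (u' - a) w' (fun z hz x y => by
        by_cases hzu : z ≤ u
        · exact haz z hz x hzu
        · exact clz_no hu (hZZ1 hz) (not_le.mp hzu) (by omega)) (by omega) h4
      rwa [show a + (u' - a) = u' by omega] at this
    rw [← e1, ← e2]
    rcases le_total w w' with hww | hww
    · have := chain2 a w (w' - w) ha (fun z hz x y => clz_no hw (hZZ2 hz) x (by omega))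
        (by omega) (by omega)
      rwa [show w + (w' - w) = w' by omega] at this
    · have := chain2 a w' (w - w') ha (fun z hz x y => clz_no hw.symm (hZZ2 hz) x (by omega))
        (by omega) (by omega)
      rw [show w' + (w - w') = w by omega] at this
      exact this.symm
  have key : ∀ u w u' w', clz Z u = clz Z u' → clz Z w = clz Z w' → u + k ≤ w → w < N →
      u' + k ≤ w' → w' < N → r u w = r u' w' := by
    intro u w u' w' hu hw h1 h2 h3 h4
    rcases le_total u u' with huu | huu
    · exact key0 u w u' w' huu hu hw h1 h2 h3 h4
    · exact (key0 u' w' u w huu hu.symm hw.symm h3 h4 h1 h2).symm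
  refine ⟨Z, fun c d => decide (∃ u w, clz Z u = c ∧ clz Z w = d ∧ u + k ≤ w ∧ w < N ∧
    r u w = true), ?_, ?_⟩
  · exact (card_union_le _ _).trans (by omega)
  · intro u w h1 h2
    rw [Bool.eq_iff_iff, decide_eq_true_iff]
    constructor
    · intro h3; exact ⟨u, w, rfl, rfl, h1, h2, h3⟩
    · rintro ⟨u', w', e1, e2, h3, h4, h5⟩
      rw [key u w u' w' e1.symm e2.symm h1 h2 h3 h4]; exact h5

/-- an irreducible `(k+1)`-set inside one class -/
def BadX (k N : ℕ) (r : ℕ → ℕ → Bool) (Z : Finset ℕ) (m : ℕ → ℕ → Bool) (X : ℕ → ℕ) : Prop :=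
  (∀ a b, a < b → b ≤ k → X a < X b) ∧ X k < N ∧ clz Z (X k) = clz Z (X 0) ∧
    Irr (m (clz Z (X 0)) (clz Z (X 0))) (k + 1) (fun a b => r (X a) (X b))

theorem BadX.cl {k N : ℕ} {r : ℕ → ℕ → Bool} {Z : Finset ℕ} {m : ℕ → ℕ → Bool} {X : ℕ → ℕ}
    (h : BadX k N r Z m X) (a : ℕ) (ha : a ≤ k) : clz Z (X a) = clz Z (X 0) := by
  obtain ⟨h1, h2, h3, h4⟩ := h
  have h1' : ∀ a b, a < b → b < k + 1 → X a < X b := fun a b x y => h1 a b x (by omega)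
  exact clz_mid h3.symm (mono_le h1' (Nat.zero_le a) (by omega)) (mono_le h1' ha (by omega))

theorem BadX.span {k N : ℕ} {r : ℕ → ℕ → Bool} {Z : Finset ℕ} {m : ℕ → ℕ → Bool} {X : ℕ → ℕ}
    (h : BadX k N r Z m X)
    (hm : ∀ u w, u + k ≤ w → w < N → r u w = m (clz Z u) (clz Z w)) (a : ℕ) (ha : a ≤ k) :
    X 0 ≤ X a ∧ X a ≤ X 0 + k * a ∧ X a < N := by
  have hcl := h.cl
  obtain ⟨h1, h2, h3, h4⟩ := h
  have h1' : ∀ a b, a < b → b < k + 1 → X a < X b := fun a b x y => h1 a b x (by omega)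
  refine ⟨mono_le h1' (Nat.zero_le a) (by omega), ?_,
    lt_of_le_of_lt (mono_le h1' ha (by omega)) h2⟩
  induction a with
  | zero => simp
  | succ a ih =>
    have ih := ih (by omega)
    obtain ⟨i, j, hi, hj, hjk, hne⟩ := h4 (a + 1) (by omega) (by omega)
    have e1 : X i ≤ X a := mono_le h1' (by omega) (by omega)
    have e2 : X (a + 1) ≤ X j := mono_le h1' hj (by omega)
    have e3 : X j ≤ X k := mono_le h1' (by omega) (by omega)
    have e4 : X j < X i + k := by
      by_contra hcon
      apply hne
      simp only
      rw [hm (X i) (X j) (by omega) (by omega), hcl i (by omega), hcl j (by omega)]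
    have : k * (a + 1) = k * a + k := by ring
    have : X (a + 1) < X i + k := by omega
    omega

theorem bad_bound {P : HerProp} {k t : ℕ} (hk : NoRep P k t) (C : ℕ) :
    ∃ C', ∀ N r, Has P N r → ∀ (Z : Finset ℕ) (m : ℕ → ℕ → Bool), Z.card ≤ C →
      (∀ u w, u + k ≤ w → w < N → r u w = m (clz Z u) (clz Z w)) →
      ∀ Q : Finset ℕ, (∀ q ∈ Q, ∃ X, BadX k N r Z m X ∧ X 0 / (k * k + k + 1) = q) →
      Q.card ≤ C' := by
  classical
  refine ⟨Fintype.card (Fin (C + 1) × (Fin (k + 1) → Fin (k + 1) → Bool)) * (2 * t), ?_⟩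
  intro N r h Z m hZ hm Q hQ
  by_contra hcon
  rw [not_le] at hcon
  choose! X hX hXq using hQ
  obtain ⟨⟨c, B⟩, g, g1, g2, g3⟩ := pigeon (κ := Fin (C + 1) × (Fin (k + 1) → Fin (k + 1) → Bool))
    Q (fun q => (Fin.ofNat _ (clz Z (X q 0)), fun a b => r (X q a) (X q b))) (2 * t) hcon
  have hc : ∀ i, i < 2 * t → clz Z (X (g i) 0) = c := by
    intro i hi
    have := g3 i hi
    simp only [Prod.mk.injEq] at this
    have := congrArg Fin.val this.1
    simp only [Fin.ofNat] at this
    rwa [Nat.mod_eq_of_lt] at this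
    have := clz_le Z (X (g i) 0)
    omega
  have hB : ∀ i a b, i < 2 * t → (ha : a < k + 1) → (hb : b < k + 1) →
      r (X (g i) a) (X (g i) b) = B ⟨a, ha⟩ ⟨b, hb⟩ := by
    intro i a b hi ha hb
    have := g3 i hi
    simp only [Prod.mk.injEq] at this
    exact congrFun (congrFun this.2 ⟨a, ha⟩) ⟨b, hb⟩
  rcases Nat.eq_zero_or_pos t with ht | ht
  · subst ht
    simp only [Nat.mul_zero] at hcon
    obtain ⟨q, hq⟩ := card_pos.mp hcon
    have e1 := (hX q hq).2.2.2
    exact hk _ _ e1 (by rw [Nat.zero_mul]; exact h.sub id (fun _ _ _ h => absurd h (by omega)) (fun _ h => absurd h (by omega)) (fun _ _ _ h => absurd h (by omega)))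
  · refine norep_blocks h hk (m c c) (fun a b => if h : a < k + 1 ∧ b < k + 1 then
      B ⟨a, h.1⟩ ⟨b, h.2⟩ else false) ?_ (fun i a => X (g (2 * i)) a) ?_ ?_ ?_ ?_
    · have e1 := (hX (g 0) (g2 0 (by omega))).2.2.2
      rw [hc 0 (by omega)] at e1
      apply e1.congr
      intro a b hab hb
      have ha : a < k + 1 := by omega
      simp only [ha, hb, and_self, dite_true]
      exact hB 0 a b (by omega) ha hb
    · intro i a b hi hab hb
      exact (hX _ (g2 (2 * i) (by omega))).1 a b hab hb
    · intro i j a b hij hj ha hb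
      have s1 := (hX _ (g2 (2 * i) (by omega))).span hm a ha
      have s2 := (hX _ (g2 (2 * j) (by omega))).span hm b hb
      have e1 := mono_gap g1 (2 * i) 2 (by omega)
      have e2 := mono_le g1 (i := 2 * i + 2) (j := 2 * j) (by omega) (by omega)
      have q1 := hXq _ (g2 (2 * i) (by omega))
      have q2 := hXq _ (g2 (2 * j) (by omega))
      set R := k * k + k + 1 with hR
      have m1 := Nat.lt_div_mul_add (a := X (g (2 * i)) 0) (b := R) (by omega)
      have m2 := Nat.div_mul_le_self (X (g (2 * j)) 0) R
      rw [q1] at m1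
      rw [q2] at m2
      have m3 : (g (2 * i) + 2) * R ≤ g (2 * j) * R := Nat.mul_le_mul_right _ (by omega)
      have m4 : (g (2 * i) + 2) * R = g (2 * i) * R + 2 * R := by ring
      have m5 : k * a ≤ k * k := Nat.mul_le_mul_left _ ha
      refine ⟨by omega, ?_⟩
      rw [hm _ _ (by omega) s2.2.2, (hX _ (g2 (2 * i) (by omega))).cl a ha,
        (hX _ (g2 (2 * j) (by omega))).cl b hb, hc _ (by omega), hc _ (by omega)]
    · intro i a hi ha
      exact ((hX _ (g2 (2 * i) (by omega))).span hm a ha).2.2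
    · intro i a b hi hab hb
      have ha : a < k + 1 := by omega
      have hb : b < k + 1 := by omega
      simp only [ha, hb, and_self, dite_true]
      exact hB _ a b (by omega) ha hb

/-- `[s,s+j)` is a part of the partition given by starts `D` -/
def DPart (D : Finset ℕ) (N s j : ℕ) : Prop :=
  s ∈ D ∧ 1 ≤ j ∧ (s + j ∈ D ∨ s + j = N) ∧ ∀ x, s < x → x < s + j → x ∉ D

theorem part_exists {D : Finset ℕ} {N s : ℕ} (hs : s ∈ D) (hsN : s < N) (hD : ∀ d ∈ D, d < N) :
    ∃ j, DPart D N s j ∧ s + j ≤ N := by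
  classical
  have hex : ∃ j, 1 ≤ j ∧ (s + j ∈ D ∨ s + j = N) := ⟨N - s, by omega, Or.inr (by omega)⟩
  refine ⟨Nat.find hex, ⟨hs, (Nat.find_spec hex).1, (Nat.find_spec hex).2, ?_⟩, ?_⟩
  · intro x h1 h2 hx
    have := Nat.find_min hex (m := x - s) (by omega)
    apply this
    refine ⟨by omega, Or.inl ?_⟩
    rwa [show s + (x - s) = x by omega]
  · rcases (Nat.find_spec hex).2 with h | h
    · exact (hD _ h).le
    · exact h.le

theorem part_cover {D : Finset ℕ} {N x : ℕ} (h0 : 0 ∈ D) (hx : x < N) (hD : ∀ d ∈ D, d < N) :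
    ∃ s j, DPart D N s j ∧ s ≤ x ∧ x < s + j ∧ s + j ≤ N := by
  classical
  have h1 : Nat.findGreatest (fun a => a ∈ D) x ∈ D :=
    Nat.findGreatest_spec (P := fun a => a ∈ D) (Nat.zero_le x) h0
  have h2 : Nat.findGreatest (fun a => a ∈ D) x ≤ x := Nat.findGreatest_le x
  obtain ⟨j, hj, hjN⟩ := part_exists h1 (lt_of_le_of_lt h2 hx) hD
  refine ⟨_, j, hj, h2, ?_, hjN⟩
  by_contra hcon
  rw [not_lt] at hcon
  rcases hj.2.2.1 with h3 | h3
  · exact Nat.findGreatest_is_greatest (P := fun a => a ∈ D) (by have := hj.2.1; omega) hcon h3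
  · omega

/-- bad short pairs -/
def Eb (r m : ℕ → ℕ → Bool) (Z V0 : Finset ℕ) (u w : ℕ) : Prop :=
  u < w ∧ u ∉ V0 ∧ w ∉ V0 ∧ r u w ≠ m (clz Z u) (clz Z w)

open Classical in
/-- starts of parts -/
noncomputable def Dst (N : ℕ) (r m : ℕ → ℕ → Bool) (Z V0 : Finset ℕ) : Finset ℕ :=
  (range N).filter (fun g => ∀ u w, Eb r m Z V0 u w → w < N → u < g → g ≤ w → False)

/-- neighbourhoods of a set of points -/
def Nb (S : Finset ℕ) (R : ℕ) : Finset ℕ := S.biUnion (fun c => Icc (c - R) (c + R))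

theorem mem_Nb {S : Finset ℕ} {R x : ℕ} : x ∈ Nb S R ↔ ∃ c ∈ S, c ≤ x + R ∧ x ≤ c + R := by
  simp only [Nb, mem_biUnion, mem_Icc]
  constructor
  · rintro ⟨c, hc, h1, h2⟩; exact ⟨c, hc, by omega, h2⟩
  · rintro ⟨c, hc, h1, h2⟩; exact ⟨c, hc, by omega, h2⟩

theorem card_Nb (S : Finset ℕ) (R : ℕ) : (Nb S R).card ≤ S.card * (2 * R + 1) := by
  apply card_biUnion_le_card_mul
  intro c _
  simp; omega

theorem Eb_short {k N : ℕ} {r m : ℕ → ℕ → Bool} {Z V0 : Finset ℕ}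
    (hm : ∀ u w, u + k ≤ w → w < N → r u w = m (clz Z u) (clz Z w)) {u w : ℕ}
    (h : Eb r m Z V0 u w) (hw : w < N) : w < u + k := by
  by_contra hcon
  exact h.2.2.2 (hm u w (by omega) hw)

theorem Eb_mid {k N R : ℕ} {r m : ℕ → ℕ → Bool} {Z S : Finset ℕ} (hZS : Z ⊆ S) (hR : k ≤ R)
    (hm : ∀ u w, u + k ≤ w → w < N → r u w = m (clz Z u) (clz Z w)) {u w : ℕ}
    (h : Eb r m Z (Nb S R) u w) (hw : w < N) :
    clz Z u = clz Z w ∧ ∀ x, u ≤ x → x ≤ w → x ∉ Nb S R := by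
  have hs := Eb_short hm h hw
  obtain ⟨h1, h2, h3, h4⟩ := h
  have nb : ∀ x, u ≤ x → x ≤ w → x ∉ Nb S R := by
    intro x hux hxw hx
    obtain ⟨c, hc, c1, c2⟩ := mem_Nb.mp hx
    have a1 : ¬ (c ≤ u + R ∧ u ≤ c + R) := fun hh => h2 (mem_Nb.mpr ⟨c, hc, hh⟩)
    have a2 : ¬ (c ≤ w + R ∧ w ≤ c + R) := fun hh => h3 (mem_Nb.mpr ⟨c, hc, hh⟩)
    omega
  refine ⟨clz_eq h1.le ?_, nb⟩
  intro z hz a b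
  exact nb z a.le b (mem_Nb.mpr ⟨z, hZS hz, by omega, by omega⟩)

theorem part_props {k N R : ℕ} {r m : ℕ → ℕ → Bool} {Z S : Finset ℕ} (hZS : Z ⊆ S) (hR : k ≤ R)
    (hm : ∀ u w, u + k ≤ w → w < N → r u w = m (clz Z u) (clz Z w)) {s j : ℕ}
    (hp : DPart (Dst N r m Z (Nb S R)) N s j) (hN : s + j ≤ N) (hj : 2 ≤ j) :
    (∀ x, s ≤ x → x < s + j → x ∉ Nb S R ∧ clz Z x = clz Z s) ∧
    Irr (m (clz Z s) (clz Z s)) j (fun a b => r (s + a) (s + b)) := by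
  classical
  obtain ⟨h1, h2, h3, h4⟩ := hp
  have hs : ∀ u w, Eb r m Z (Nb S R) u w → w < N → u < s → s ≤ w → False :=
    (mem_filter.mp h1).2
  have he : ∀ u w, Eb r m Z (Nb S R) u w → w < N → u < s + j → s + j ≤ w → False := by
    intro u w a b c d
    rcases h3 with h3 | h3
    · exact (mem_filter.mp h3).2 u w a b c d
    · omega
  have hx : ∀ x, s < x → x < s + j → ∃ u w, Eb r m Z (Nb S R) u w ∧ w < N ∧ s ≤ u ∧ u < x ∧
      x ≤ w ∧ w < s + j := by
    intro x a b
    have := h4 x a b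
    simp only [Dst, mem_filter, mem_range, not_and] at this
    have := this (by omega)
    push Not at this
    obtain ⟨u, w, c1, c2, c3, c4, -⟩ := this
    refine ⟨u, w, c1, c2, ?_, c3, c4, ?_⟩
    · by_contra hcon
      exact hs u w c1 c2 (by omega) (by omega)
    · by_contra hcon
      exact he u w c1 c2 (by omega) (by omega)
  have nb : ∀ x, s ≤ x → x < s + j → x ∉ Nb S R := by
    intro x a b
    rcases a.eq_or_lt with a | a
    · obtain ⟨u, w, c1, c2, c3, c4, c5, c6⟩ := hx (s + 1) (by omega) (by omega)
      have : u = x := by omega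
      rw [← this]; exact c1.2.1
    · obtain ⟨u, w, c1, c2, c3, c4, c5, c6⟩ := hx x a b
      exact (Eb_mid hZS hR hm c1 c2).2 x c4.le c5
  have hcl : ∀ d, d < j → clz Z (s + d) = clz Z s := by
    intro d
    induction d with
    | zero => intro _; rfl
    | succ d ih =>
      intro hd
      rw [← ih (by omega)]
      obtain ⟨u, w, c1, c2, c3, c4, c5, c6⟩ := hx (s + (d + 1)) (by omega) (by omega)
      have e := (Eb_mid hZS hR hm c1 c2).1
      rw [clz_mid e (x := s + (d + 1)) (by omega) (by omega),
        clz_mid e (x := s + d) (by omega) (by omega)]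
  have hcl' : ∀ x, s ≤ x → x < s + j → clz Z x = clz Z s := by
    intro x a b
    have := hcl (x - s) (by omega)
    rwa [show s + (x - s) = x by omega] at this
  refine ⟨fun x a b => ⟨nb x a b, hcl' x a b⟩, ?_⟩
  intro g hg0 hg
  obtain ⟨u, w, c1, c2, c3, c4, c5, c6⟩ := hx (s + g) (by omega) (by omega)
  refine ⟨u - s, w - s, by omega, by omega, by omega, ?_⟩
  simp only
  rw [show s + (u - s) = u by omega, show s + (w - s) = w by omega]
  have := c1.2.2.2
  rwa [hcl' u c3 (by omega), hcl' w (by omega) c6] at this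

theorem part_cross {N : ℕ} {r m : ℕ → ℕ → Bool} {Z V0 : Finset ℕ} {u w d : ℕ}
    (hd : d ∈ Dst N r m Z V0) (h1 : u < d) (h2 : d ≤ w) (hw : w < N) (hu : u ∉ V0) (hw0 : w ∉ V0) :
    r u w = m (clz Z u) (clz Z w) := by
  classical
  by_contra hcon
  exact (mem_filter.mp hd).2 u w ⟨by omega, hu, hw0, hcon⟩ hw h1 h2

theorem zero_Dst {N : ℕ} {r m : ℕ → ℕ → Bool} {Z V0 : Finset ℕ} (hN : 0 < N) :
    0 ∈ Dst N r m Z V0 := by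
  classical
  simp only [Dst, mem_filter, mem_range]
  exact ⟨hN, fun _ _ _ _ h => by omega⟩

theorem Dst_lt {N : ℕ} {r m : ℕ → ℕ → Bool} {Z V0 : Finset ℕ} : ∀ d ∈ Dst N r m Z V0, d < N := by
  classical
  intro d hd
  simp only [Dst, mem_filter, mem_range] at hd
  exact hd.1

theorem part_size {k N R : ℕ} {r m : ℕ → ℕ → Bool} {Z S : Finset ℕ} (hZS : Z ⊆ S) (hR : k ≤ R)
    (hk1 : 1 ≤ k)
    (hm : ∀ u w, u + k ≤ w → w < N → r u w = m (clz Z u) (clz Z w))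
    (hbad : ∀ X, BadX k N r Z m X → X 0 ∈ Nb S R) {s j : ℕ}
    (hp : DPart (Dst N r m Z (Nb S R)) N s j) (hN : s + j ≤ N) : j ≤ k := by
  by_contra hcon
  obtain ⟨p1, p2⟩ := part_props hZS hR hm hp hN (by omega)
  obtain ⟨f, f1, f2, f3⟩ := irr_sub _ (k + 1) j (by omega) _ p2
  have q0 := p1 (s + f 0) (by omega) (by have := f2 0 (by omega); omega)
  apply q0.1
  apply hbad (fun a => s + f a)
  refine ⟨?_, ?_, ?_, ?_⟩
  · intro a b hab hb
    have := f1 a b hab (by omega)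
    simp only; omega
  · have := f2 k (by omega)
    simp only; omega
  · simp only
    rw [q0.2, (p1 (s + f k) (by omega) (by have := f2 k (by omega); omega)).2]
  · simp only
    rw [q0.2]
    exact f3

theorem rep_has {P : HerProp} {K t N : ℕ} {r : ℕ → ℕ → Bool} (h : Has P N r) (hK : 0 < K)
    (e : Bool) (B : ℕ → ℕ → Bool)
    (X : ℕ → ℕ → ℕ) (hX : ∀ i a b, i < t → a < b → b < K → X i a < X i b)
    (hXX : ∀ i j a b, i < j → j < t → a < K → b < K → X i a < X j b ∧ r (X i a) (X j b) = e)
    (hN : ∀ i a, i < t → a < K → X i a < N)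
    (hXB : ∀ i a b, i < t → a < b → b < K → r (X i a) (X i b) = B a b) :
    Has P (t * K) (rep e K B) := by
  have hmod : ∀ u, u % K < K := fun u => Nat.mod_lt u hK
  have hdiv : ∀ u, u < t * K → u / K < t := fun u hu =>
    Nat.div_lt_of_lt_mul (by rwa [mul_comm] at hu)
  have hcase : ∀ u v, u < v → u / K < v / K ∨
      (u / K = v / K ∧ u % K < v % K) := by
    intro u v huv
    have h1 : u / K ≤ v / K := Nat.div_le_div_right huv.le
    rcases h1.lt_or_eq with h2 | h2
    · left; exact h2
    · right
      refine ⟨h2, ?_⟩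
      have e1 := Nat.div_add_mod u K
      have e2 := Nat.div_add_mod v K
      rw [h2] at e1
      omega
  refine h.sub (fun u => X (u / K) (u % K)) ?_ ?_ ?_
  · intro u v huv hv
    rcases hcase u v huv with h2 | ⟨h2, h3⟩
    · exact (hXX _ _ _ _ h2 (hdiv v hv) (hmod u) (hmod v)).1
    · simp only [h2]
      exact hX _ _ _ (hdiv v hv) h3 (hmod v)
  · intro u hu
    exact hN _ _ (hdiv u hu) (hmod u)
  · intro u v huv hv
    rcases hcase u v huv with h2 | ⟨h2, h3⟩
    · simp only [rep, h2.ne, if_false]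
      exact (hXX _ _ _ _ h2 (hdiv v hv) (hmod u) (hmod v)).2.symm
    · simp only [rep, h2, if_true]
      exact (hXB _ _ _ (hdiv v hv) h3 (hmod v)).symm

theorem part_disj {D : Finset ℕ} {N s s' j j' : ℕ} (h : DPart D N s j) (h' : DPart D N s' j')
    (hlt : s < s') : s + j ≤ s' := by
  by_contra hcon
  exact h.2.2.2 s' hlt (by omega) h'.1

theorem type_bound {P : HerProp} {k n0 : ℕ} (hn0 : 1 ≤ n0)
    (hsp : speed P n0 < 2 ^ (n0 - 1)) (C : ℕ) :
    ∃ C', ∀ N r, Has P N r → ∀ (Z : Finset ℕ) (m : ℕ → ℕ → Bool), Z.card ≤ C →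
      (∀ u w, u + k ≤ w → w < N → r u w = m (clz Z u) (clz Z w)) →
      ∀ (S : Finset ℕ) (R : ℕ), Z ⊆ S → k ≤ R → ∀ j, 2 ≤ j → j ≤ k → ∀ W : Finset ℕ,
      (∀ s ∈ W, ∃ s', s' < s ∧ DPart (Dst N r m Z (Nb S R)) N s' j ∧
        DPart (Dst N r m Z (Nb S R)) N s j ∧ s + j ≤ N ∧ clz Z s' = clz Z s ∧
        (∀ x, s' < x → x < s → ¬ DPart (Dst N r m Z (Nb S R)) N x j) ∧
        ¬ Agr j (fun a b => r (s' + a) (s' + b)) (fun a b => r (s + a) (s + b))) →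
      W.card ≤ C' := by
  classical
  refine ⟨Fintype.card (Fin (C + 1) × (Fin k → Fin k → Bool) × (Fin k → Fin k → Bool)) *
    (2 * n0), ?_⟩
  intro N r h Z m hZ hm S R hZS hR j hj2 hjk W hW
  by_contra hcon
  rw [not_le] at hcon
  choose! q hq1 hq2 hq3 hq4 hq5 hq6 hq7 using hW
  obtain ⟨⟨c, A, B⟩, g, g1, g2, g3⟩ := pigeon
    (κ := Fin (C + 1) × (Fin k → Fin k → Bool) × (Fin k → Fin k → Bool)) W
    (fun s => (Fin.ofNat _ (clz Z s), fun a b => r (q s + a) (q s + b),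
      fun a b => r (s + a) (s + b))) (2 * n0) hcon
  have hc : ∀ i, i < 2 * n0 → clz Z (g i) = c := by
    intro i hi
    have := g3 i hi
    simp only [Prod.mk.injEq] at this
    have := congrArg Fin.val this.1
    simp only [Fin.ofNat] at this
    rwa [Nat.mod_eq_of_lt] at this
    have := clz_le Z (g i)
    omega
  have hA : ∀ i, i < 2 * n0 → ∀ a b, a < k → b < k →
      r (q (g i) + a) (q (g i) + b) = r (q (g 0) + a) (q (g 0) + b) := by
    intro i hi a b ha hb
    have e1 := g3 i hi
    have e2 := g3 0 (by omega)
    simp only [Prod.mk.injEq] at e1 e2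
    have := congrFun (congrFun (e1.2.1.trans e2.2.1.symm) ⟨a, ha⟩) ⟨b, hb⟩
    exact this
  have hB : ∀ i, i < 2 * n0 → ∀ a b, a < k → b < k →
      r (g i + a) (g i + b) = r (g 0 + a) (g 0 + b) := by
    intro i hi a b ha hb
    have e1 := g3 i hi
    have e2 := g3 0 (by omega)
    simp only [Prod.mk.injEq] at e1 e2
    have := congrFun (congrFun (e1.2.2.trans e2.2.2.symm) ⟨a, ha⟩) ⟨b, hb⟩
    exact this
  -- part properties
  have hqN : ∀ i, i < 2 * n0 → q (g i) + j ≤ g i := fun i hi =>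
    part_disj (hq2 _ (g2 i hi)) (hq3 _ (g2 i hi)) (hq1 _ (g2 i hi))
  have hgN : ∀ i, i < 2 * n0 → g i + j ≤ N := fun i hi => hq4 _ (g2 i hi)
  have pq : ∀ i, i < 2 * n0 → _ := fun i hi =>
    part_props hZS hR hm (hq2 _ (g2 i hi)) (by have := hqN i hi; have := hgN i hi; omega) hj2
  have pg : ∀ i, i < 2 * n0 → _ := fun i hi =>
    part_props hZS hR hm (hq3 _ (g2 i hi)) (hgN i hi) hj2
  have hcq : ∀ i, i < 2 * n0 → clz Z (q (g i)) = c := fun i hi => by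
    rw [hq5 _ (g2 i hi), hc i hi]
  have hsep : ∀ i i', i < i' → i' < n0 → g (2 * i) + j ≤ q (g (2 * i')) := by
    intro i i' hii hi'
    have e1 := g1 (2 * i) (2 * i + 1) (by omega) (by omega)
    have e2 : g (2 * i + 1) < g (2 * i') := g1 _ _ (by omega) (by omega)
    have e3 : g (2 * i + 1) ≤ q (g (2 * i')) := by
      by_contra hlt
      exact hq6 _ (g2 (2 * i') (by omega)) (g (2 * i + 1)) (by omega) e2
        (hq3 _ (g2 (2 * i + 1) (by omega)))
    have e4 := part_disj (hq3 _ (g2 (2 * i) (by omega))) (hq3 _ (g2 (2 * i + 1) (by omega))) e1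
    omega
  apply not_le.mpr hsp
  refine alt_le_speed P (m c c) j (fun a b => r (q (g 0) + a) (q (g 0) + b))
    (fun a b => r (g 0 + a) (g 0 + b)) ?_ ?_ (hq7 _ (g2 0 (by omega))) n0 ?_
  · have := (pq 0 (by omega)).2
    rwa [hcq 0 (by omega)] at this
  · have := (pg 0 (by omega)).2
    rwa [hc 0 (by omega)] at this
  · set Y : ℕ → ℕ → ℕ := fun i y => if y < j then q (g (2 * i)) + y else g (2 * i) + (y - j) with hY
    have Yr : ∀ i y, i < n0 → y < 2 * j → q (g (2 * i)) ≤ Y i y ∧ Y i y < g (2 * i) + j := by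
      intro i y hi hy
      have := hqN (2 * i) (by omega)
      simp only [hY]; split_ifs <;> omega
    have Yp : ∀ i y, i < n0 → y < 2 * j → Y i y ∉ Nb S R ∧ clz Z (Y i y) = c := by
      intro i y hi hy
      simp only [hY]; split_ifs with hh
      · have := (pq (2 * i) (by omega)).1 (q (g (2 * i)) + y) (by omega) (by omega)
        rwa [hcq _ (by omega)] at this
      · have := (pg (2 * i) (by omega)).1 (g (2 * i) + (y - j)) (by omega) (by omega)
        rwa [hc _ (by omega)] at this
    apply rep_has h (by omega) (m c c) _ Y
    · intro i a b hi hab hb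
      have := hqN (2 * i) (by omega)
      simp only [hY]; split_ifs <;> omega
    · intro i i' a b hii hi' ha hb
      have y1 := Yr i a (by omega) ha
      have y2 := Yr i' b hi' hb
      have y3 := hsep i i' hii hi'
      have y4 := hgN (2 * i') (by omega)
      refine ⟨by omega, ?_⟩
      rw [part_cross (hq2 _ (g2 (2 * i') (by omega))).1 (by omega) y2.1 (by omega)
        (Yp i a (by omega) ha).1 (Yp i' b hi' hb).1, (Yp i a (by omega) ha).2, (Yp i' b hi' hb).2]
    · intro i a hi ha
      have := Yr i a hi ha
      have := hgN (2 * i) (by omega)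
      omega
    · intro i a b hi hab hb
      simp only [cat]
      by_cases hbj : b < j
      · have haj : a < j := by omega
        simp only [hY, hbj, haj, if_true]
        exact hA _ (by omega) _ _ (by omega) (by omega)
      · by_cases haj : a < j
        · have hja : ¬ j ≤ a := by omega
          simp only [hbj, hja, if_false]
          have y1 := Yp i a hi (by omega)
          have y2 := Yp i b hi (by omega)
          have y3 := hgN (2 * i) (by omega)
          have y4 := hqN (2 * i) (by omega)
          rw [part_cross (hq3 _ (g2 (2 * i) (by omega))).1 _ _ _ y1.1 y2.1, y1.2, y2.2]
          · simp only [hY, haj, if_true]; omega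
          · simp only [hY, hbj, if_false]; omega
          · simp only [hY, hbj, if_false]; omega
        · have hja : j ≤ a := by omega
          simp only [hY, hbj, haj, hja, if_false, if_true]
          exact hB _ (by omega) _ _ (by omega) (by omega)

/-- the coded description of a graph -/
def Spec (k N : ℕ) (Z Zt V D : Finset ℕ) (m : ℕ → ℕ → Bool) (τ : ℕ → ℕ → ℕ → ℕ → Bool)
    (ex : ℕ → ℕ → Bool) (r : ℕ → ℕ → Bool) : Prop :=
  ∀ u w, u < w → w < N →
    (u ∈ V → w ∈ V → r u w = ex (clz V u) (clz V w)) ∧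
    (∀ s j, j ≤ k → DPart D N s j → s ≤ u → w < s + j → ¬ (u ∈ V ∧ w ∈ V) →
      r u w = τ (clz Zt s) j (u - s) (w - s)) ∧
    ((∀ s j, j ≤ k → DPart D N s j → s ≤ u → w < s + j → False) → ¬ (u ∈ V ∧ w ∈ V) →
      r u w = m (clz Z u) (clz Z w))

theorem clz_inj {V : Finset ℕ} {u v : ℕ} (hu : u ∈ V) (hv : v ∈ V) (h : clz V u = clz V v) :
    u = v := by
  rcases lt_trichotomy u v with h1 | h1 | h1
  · exact (clz_no h hv h1 le_rfl).elim
  · exact h1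
  · exact (clz_no h.symm hu h1 le_rfl).elim

theorem type_same {k N : ℕ} {r : ℕ → ℕ → Bool} {Z Zt D : Finset ℕ} (hZ : Z ⊆ Zt) (hD : ∀ d ∈ D, d < N)
    (hZt : ∀ j, 2 ≤ j → j ≤ k → ∀ s s', s' < s → DPart D N s' j → DPart D N s j → clz Z s' = clz Z s →
      (∀ x, s' < x → x < s → ¬ DPart D N x j) →
      ¬ Agr j (fun a b => r (s' + a) (s' + b)) (fun a b => r (s + a) (s + b)) → s ∈ Zt)
    (j : ℕ) (hjk : j ≤ k) (s' : ℕ) (hs' : DPart D N s' j) :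
    ∀ s, s' ≤ s → DPart D N s j → clz Zt s' = clz Zt s →
      Agr j (fun a b => r (s' + a) (s' + b)) (fun a b => r (s + a) (s + b)) := by
  classical
  by_cases hj2 : 2 ≤ j
  swap
  · intro s _ _ _ a b hab hb; omega
  intro s
  induction s using Nat.strong_induction_on with
  | _ s ih =>
    intro hss hs hcl
    rcases hss.eq_or_lt with e | hlt
    · rw [e]; intro a b _ _; rfl
    have hp : DPart D N (Nat.findGreatest (fun x => DPart D N x j) (s - 1)) j :=
      Nat.findGreatest_spec (P := fun x => DPart D N x j) (show s' ≤ s - 1 by omega) hs'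
    have hle : s' ≤ Nat.findGreatest (fun x => DPart D N x j) (s - 1) :=
      Nat.le_findGreatest (by omega) hs'
    have hle2 : Nat.findGreatest (fun x => DPart D N x j) (s - 1) ≤ s - 1 := Nat.findGreatest_le _
    have hno : ∀ x, Nat.findGreatest (fun x => DPart D N x j) (s - 1) < x → x < s →
        ¬ DPart D N x j := fun x h1 h2 =>
      Nat.findGreatest_is_greatest (P := fun x => DPart D N x j) h1 (by omega)
    set p := Nat.findGreatest (fun x => DPart D N x j) (s - 1) with hpdef
    have c1 := clz_mid hcl hle (by omega)
    have a1 := ih p (by omega) hle hp c1.symm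
    have a2 : Agr j (fun a b => r (p + a) (p + b)) (fun a b => r (s + a) (s + b)) := by
      by_contra hcon
      have := hZt j hj2 hjk s p (by omega) hp hs (clz_sub hZ (by rw [c1, hcl])) hno hcon
      exact clz_no hcl this hlt le_rfl
    intro a b hab hb
    exact (a1 a b hab hb).trans (a2 a b hab hb)

theorem structure_thm {P : HerProp} {k t n0 : ℕ} (hk1 : 1 ≤ k) (hn0 : 1 ≤ n0)
    (hsp : speed P n0 < 2 ^ (n0 - 1)) (hk : NoRep P k t) :
    ∃ C, ∀ N r, Has P N r → ∃ (Z Zt V D : Finset ℕ) (m : ℕ → ℕ → Bool)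
      (τ : ℕ → ℕ → ℕ → ℕ → Bool) (ex : ℕ → ℕ → Bool),
      Z.card ≤ C ∧ Zt.card ≤ C ∧ V.card ≤ C ∧ (∀ d ∈ D, d < N) ∧
      (∀ x, x < N → ∃ d ∈ D, d ≤ x ∧ x < d + k) ∧ Spec k N Z Zt V D m τ ex r := by
  classical
  obtain ⟨C3, hC3⟩ := classes hk1 hn0 hsp hk
  obtain ⟨CQ, hCQ⟩ := bad_bound hk C3
  obtain ⟨CT, hCT⟩ := type_bound (k := k) hn0 hsp C3
  set R := k * k + k + 1 with hR
  refine ⟨C3 + (k + 1) * CT + (C3 + CQ) * (2 * (R + k) + 1), fun N r h => ?_⟩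
  obtain ⟨Z, m, hZ, hm⟩ := hC3 N r h
  set Q := (range N).filter (fun q => ∃ X, BadX k N r Z m X ∧ X 0 / R = q) with hQ
  have hQc : Q.card ≤ CQ := hCQ N r h Z m hZ hm Q (fun q hq => (mem_filter.mp hq).2)
  set S := Z ∪ Q.image (fun q => q * R) with hS
  have hSc : S.card ≤ C3 + CQ := (card_union_le _ _).trans
    (Nat.add_le_add hZ (card_image_le.trans hQc))
  have hZS : Z ⊆ S := subset_union_left
  have hkR : k ≤ R := by omega
  have hbad : ∀ X, BadX k N r Z m X → X 0 ∈ Nb S R := by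
    intro X hX
    have m1 := Nat.lt_div_mul_add (a := X 0) (b := R) (by omega)
    have m2 := Nat.div_mul_le_self (X 0) R
    refine mem_Nb.mpr ⟨X 0 / R * R, ?_, by omega, by omega⟩
    rw [hS, mem_union]
    right
    rw [mem_image]
    refine ⟨X 0 / R, ?_, rfl⟩
    rw [hQ, mem_filter, mem_range]
    have := hX.span hm 0 (by omega)
    exact ⟨lt_of_le_of_lt (Nat.div_le_self _ _) this.2.2, X, hX, rfl⟩
  set D := Dst N r m Z (Nb S R) with hD
  have hsize : ∀ s j, DPart D N s j → s + j ≤ N → j ≤ k := fun s j hp hN =>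
    part_size hZS hkR hk1 hm hbad hp hN
  have hDlt : ∀ d ∈ D, d < N := Dst_lt
  have hpN : ∀ s j, DPart D N s j → s + j ≤ N := by
    intro s j hp
    rcases hp.2.2.1 with h1 | h1
    · exact (hDlt _ h1).le
    · exact h1.le
  set W : ℕ → Finset ℕ := fun j => (range N).filter (fun s => 2 ≤ j ∧ j ≤ k ∧
    ∃ s', s' < s ∧ DPart D N s' j ∧
        DPart D N s j ∧ s + j ≤ N ∧ clz Z s' = clz Z s ∧
        (∀ x, s' < x → x < s → ¬ DPart D N x j) ∧
        ¬ Agr j (fun a b => r (s' + a) (s' + b)) (fun a b => r (s + a) (s + b))) with hW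
  have hWc : ∀ j, (W j).card ≤ CT := by
    intro j
    by_cases hj : 2 ≤ j ∧ j ≤ k
    · exact hCT N r h Z m hZ hm S R hZS hkR j hj.1 hj.2 (W j)
        (fun s hs => (mem_filter.mp hs).2.2.2)
    · have : W j = ∅ := by
        rw [hW]
        simp only
        rw [filter_eq_empty_iff]
        intro s _ hs
        exact hj ⟨hs.1, hs.2.1⟩
      rw [this]; simp
  set Zt := Z ∪ (range (k + 1)).biUnion W with hZt
  have hZtc : Zt.card ≤ C3 + (k + 1) * CT := by
    refine (card_union_le _ _).trans (Nat.add_le_add hZ ?_)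
    have := card_biUnion_le_card_mul (range (k + 1)) W CT (fun j _ => hWc j)
    simpa using this
  set V := Nb S (R + k) with hV
  have hVc : V.card ≤ (C3 + CQ) * (2 * (R + k) + 1) :=
    (card_Nb _ _).trans (Nat.mul_le_mul_right _ hSc)
  have hsame := type_same (k := k) (N := N) (r := r) (Z := Z) (Zt := Zt) (D := D)
    subset_union_left hDlt (by
      intro j hj2 hjk s s' h1 h2 h3 h4 h5 h6
      rw [hZt, mem_union]
      right
      rw [mem_biUnion]
      refine ⟨j, by simp; omega, ?_⟩
      rw [hW, mem_filter, mem_range]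
      have := hpN s j h3
      exact ⟨by omega, hj2, hjk, s', h1, h2, h3, this, h4, h5, h6⟩)
  refine ⟨Z, Zt, V, D, m,
    fun c j a b => decide (∃ s, DPart D N s j ∧ clz Zt s = c ∧ r (s + a) (s + b) = true),
    fun c d => decide (∃ u w, u ∈ V ∧ w ∈ V ∧ clz V u = c ∧ clz V w = d ∧ r u w = true),
    by omega, by omega, by omega, hDlt, ?_, ?_⟩
  · intro x hx
    obtain ⟨s, j, h1, h2, h3, h4⟩ := part_cover (D := D) (zero_Dst (by omega)) hx hDlt
    have := hsize s j h1 h4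
    exact ⟨s, h1.1, h2, by omega⟩
  · intro u w huw hw
    refine ⟨?_, ?_, ?_⟩
    · intro hu hw'
      rw [Bool.eq_iff_iff, decide_eq_true_iff]
      constructor
      · intro h1; exact ⟨u, w, hu, hw', rfl, rfl, h1⟩
      · rintro ⟨u', w', h1, h2, h3, h4, h5⟩
        rw [← clz_inj h1 hu h3, ← clz_inj h2 hw' h4]; exact h5
    · intro s j hjk hp hsu hws _
      rw [Bool.eq_iff_iff, decide_eq_true_iff]
      constructor
      · intro h1
        refine ⟨s, hp, rfl, ?_⟩
        rwa [show s + (u - s) = u by omega, show s + (w - s) = w by omega]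
      · rintro ⟨s', hp', hc, h1⟩
        have : r (s' + (u - s)) (s' + (w - s)) = r (s + (u - s)) (s + (w - s)) := by
          rcases le_total s' s with hh | hh
          · exact hsame j hjk s' hp' s hh hp hc (u - s) (w - s) (by omega) (by omega)
          · exact (hsame j hjk s hp s' hh hp' hc.symm (u - s) (w - s) (by omega) (by omega)).symm
        rw [this, show s + (u - s) = u by omega, show s + (w - s) = w by omega] at h1
        exact h1
    · intro hno hnV
      by_cases hlong : u + k ≤ w
      · exact hm u w hlong hw
      have hu0 : u ∉ Nb S R := by
        intro hu
        obtain ⟨c, hc, c1, c2⟩ := mem_Nb.mp hu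
        exact hnV ⟨mem_Nb.mpr ⟨c, hc, by omega, by omega⟩, mem_Nb.mpr ⟨c, hc, by omega, by omega⟩⟩
      have hw0 : w ∉ Nb S R := by
        intro hu
        obtain ⟨c, hc, c1, c2⟩ := mem_Nb.mp hu
        exact hnV ⟨mem_Nb.mpr ⟨c, hc, by omega, by omega⟩, mem_Nb.mpr ⟨c, hc, by omega, by omega⟩⟩
      obtain ⟨s, j, h1, h2, h3, h4⟩ := part_cover (D := D) (x := w) (zero_Dst (by omega)) hw hDlt
      by_cases hsu : s ≤ u
      · exact (hno s j (hsize s j h1 h4) h1 hsu h3).elim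
      · exact part_cross h1.1 (by omega) h2 hw hu0 hw0

/-- sets of part starts with parts of size at most `k` -/
def DD (k : ℕ) : ℕ → Finset (Finset ℕ)
  | 0 => {∅}
  | n + 1 => (range k).biUnion (fun i => if i ≤ n then (DD k (n - i)).image (insert (n - i)) else ∅)
decreasing_by omega

theorem DD_card (k n : ℕ) : (DD k n).card ≤ genFib k n := by
  induction n using Nat.strong_induction_on with
  | _ n ih =>
    cases n with
    | zero => simp [DD, genFib]
    | succ n =>
      rw [DD, genFib]
      refine card_biUnion_le.trans (sum_le_sum fun i _ => ?_)
      split_ifs with hi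
      · exact card_image_le.trans (ih (n - i) (by omega))
      · simp

theorem mem_DD (k n : ℕ) (D : Finset ℕ) (h1 : ∀ d ∈ D, d < n)
    (h2 : ∀ x, x < n → ∃ d ∈ D, d ≤ x ∧ x < d + k) : D ∈ DD k n := by
  induction n using Nat.strong_induction_on generalizing D with
  | _ n ih =>
    cases n with
    | zero =>
      simp only [DD, mem_singleton]
      rw [eq_empty_iff_forall_notMem]
      intro d hd; have := h1 d hd; omega
    | succ n =>
      obtain ⟨d0, hd0, -, -⟩ := h2 n (by omega)
      obtain ⟨d, hd, hmax⟩ := D.exists_max_image id ⟨d0, hd0⟩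
      simp only [id] at hmax
      obtain ⟨d', hd', e1, e2⟩ := h2 n (by omega)
      have := hmax d' hd'
      have hdn := h1 d hd
      rw [DD, mem_biUnion]
      refine ⟨n - d, by simp; omega, ?_⟩
      rw [if_pos (by omega), mem_image]
      rw [show n - (n - d) = d by omega]
      refine ⟨D.erase d, ih d (by omega) _ ?_ ?_, insert_erase hd⟩
      · intro x hx
        have := hmax x (mem_of_mem_erase hx)
        have := ne_of_mem_erase hx
        omega
      · intro x hx
        obtain ⟨y, hy, e3, e4⟩ := h2 x (by omega)
        exact ⟨y, mem_erase.mpr ⟨by omega, hy⟩, e3, e4⟩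

/-- decoding a small set -/
def Zof (C n : ℕ) (f : Fin C → Fin (n + 1)) : Finset ℕ :=
  (univ.image (fun i => (f i : ℕ))).filter (fun x => x < n)

theorem exists_Zof (C n : ℕ) (Z : Finset ℕ) (hZ : Z.card ≤ C) :
    ∃ f, Zof C n f = Z.filter (fun x => x < n) := by
  obtain ⟨g, g1, g2, g3⟩ := enum_exists Z
  refine ⟨fun i => if h : (i : ℕ) < Z.card ∧ g i < n then ⟨g i, by omega⟩ else ⟨n, by omega⟩, ?_⟩
  ext x
  simp only [Zof, mem_filter, mem_image, mem_univ, true_and]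
  constructor
  · rintro ⟨⟨i, hi⟩, hx⟩
    refine ⟨?_, hx⟩
    split_ifs at hi with hc
    · simp only at hi; rw [← hi]; exact g2 _ hc.1
    · simp only at hi; omega
  · rintro ⟨hx, hxn⟩
    obtain ⟨i, hi, rfl⟩ := g3 x hx
    refine ⟨⟨⟨i, by omega⟩, ?_⟩, hxn⟩
    simp [hi, hxn]

theorem clz_filter (Z : Finset ℕ) {n u : ℕ} (hu : u < n) :
    clz (Z.filter (fun x => x < n)) u = clz Z u := by
  unfold clz
  congr 1
  ext x
  simp only [mem_filter]
  constructor
  · rintro ⟨⟨h1, _⟩, h2⟩; exact ⟨h1, h2⟩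
  · rintro ⟨h1, h2⟩; exact ⟨⟨h1, by omega⟩, h2⟩

theorem Spec.agr {k N : ℕ} {Z Zt V D : Finset ℕ} {m : ℕ → ℕ → Bool}
    {τ : ℕ → ℕ → ℕ → ℕ → Bool} {ex r r' : ℕ → ℕ → Bool} (h : Spec k N Z Zt V D m τ ex r)
    (h' : Spec k N Z Zt V D m τ ex r') : Agr N r r' := by
  intro u w huw hw
  obtain ⟨a1, a2, a3⟩ := h u w huw hw
  obtain ⟨b1, b2, b3⟩ := h' u w huw hw
  by_cases hV : u ∈ V ∧ w ∈ V
  · rw [a1 hV.1 hV.2, b1 hV.1 hV.2]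
  · by_cases hp : ∃ s j, j ≤ k ∧ DPart D N s j ∧ s ≤ u ∧ w < s + j
    · obtain ⟨s, j, h1, h2, h3, h4⟩ := hp
      rw [a2 s j h1 h2 h3 h4 hV, b2 s j h1 h2 h3 h4 hV]
    · have : ∀ s j, j ≤ k → DPart D N s j → s ≤ u → w < s + j → False :=
        fun s j h1 h2 h3 h4 => hp ⟨s, j, h1, h2, h3, h4⟩
      rw [a3 this hV, b3 this hV]

theorem Spec.filter {k N : ℕ} {Z Zt V D : Finset ℕ} {m : ℕ → ℕ → Bool}
    {τ : ℕ → ℕ → ℕ → ℕ → Bool} {ex r : ℕ → ℕ → Bool} (h : Spec k N Z Zt V D m τ ex r)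
    (m' : ℕ → ℕ → Bool) (τ' : ℕ → ℕ → ℕ → ℕ → Bool) (ex' : ℕ → ℕ → Bool) (C : ℕ)
    (hZ : Z.card ≤ C) (hZt : Zt.card ≤ C) (hV : V.card ≤ C)
    (hm : ∀ a b, a ≤ C → b ≤ C → m' a b = m a b) (hex : ∀ a b, a ≤ C → b ≤ C → ex' a b = ex a b)
    (hτ : ∀ a j b c, a ≤ C → j ≤ k → b < k → c < k → τ' a j b c = τ a j b c) :
    Spec k N (Z.filter (fun x => x < N)) (Zt.filter (fun x => x < N)) (V.filter (fun x => x < N))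
      D m' τ' ex' r := by
  intro u w huw hw
  obtain ⟨a1, a2, a3⟩ := h u w huw hw
  have hu : u < N := by omega
  have mu : u ∈ V.filter (fun x => x < N) ↔ u ∈ V := by simp [hu]
  have mw : w ∈ V.filter (fun x => x < N) ↔ w ∈ V := by simp [hw]
  rw [mu, mw]
  refine ⟨?_, ?_, ?_⟩
  · intro h1 h2
    rw [a1 h1 h2, clz_filter _ hu, clz_filter _ hw, hex]
    · exact (clz_le _ _).trans hV
    · exact (clz_le _ _).trans hV
  · intro s j h1 h2 h3 h4 h5
    rw [a2 s j h1 h2 h3 h4 h5, clz_filter _ (by omega), hτ _ _ _ _ _ h1 (by omega) (by omega)]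
    exact (clz_le _ _).trans hZt
  · intro h1 h2
    rw [a3 h1 h2, clz_filter _ hu, clz_filter _ hw, hm]
    · exact (clz_le _ _).trans hZ
    · exact (clz_le _ _).trans hZ

theorem upper_bound {P : HerProp} {k t n0 : ℕ} (hk1 : 1 ≤ k) (hn0 : 1 ≤ n0)
    (hsp : speed P n0 < 2 ^ (n0 - 1)) (hk : NoRep P k t) :
    ∃ c C, ∀ n, speed P n ≤ c * (n + 1) ^ C * genFib k n := by
  classical
  obtain ⟨C, hC⟩ := structure_thm hk1 hn0 hsp hk
  let Y := (Fin (C + 1) → Fin (C + 1) → Bool) ×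
    (Fin (C + 1) → Fin (k + 1) → Fin (k + 1) → Fin (k + 1) → Bool) ×
    (Fin (C + 1) → Fin (C + 1) → Bool)
  refine ⟨Fintype.card Y, 3 * C, fun n => ?_⟩
  let X := (Fin C → Fin (n + 1)) × (Fin C → Fin (n + 1)) × (Fin C → Fin (n + 1))
  have hX : Fintype.card X = (n + 1) ^ (3 * C) := by
    simp only [X, Fintype.card_prod, Fintype.card_fun, Fintype.card_fin]
    ring
  have hmain : speed P n ≤ ((univ : Finset (Y × X)) ×ˢ DD k n).card := by
    apply speed_le_card _ P n (fun a r => Spec k n (Zof C n a.1.2.1) (Zof C n a.1.2.2.1)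
      (Zof C n a.1.2.2.2) a.2 (fun c d => a.1.1.1 (Fin.ofNat _ c) (Fin.ofNat _ d))
      (fun c j x y => a.1.1.2.1 (Fin.ofNat _ c) (Fin.ofNat _ j) (Fin.ofNat _ x) (Fin.ofNat _ y))
      (fun c d => a.1.1.2.2 (Fin.ofNat _ c) (Fin.ofNat _ d)) r)
    · intro r hr
      obtain ⟨Z, Zt, V, D, m, τ, ex, h1, h2, h3, h4, h5, h6⟩ := hC n r hr
      obtain ⟨f1, e1⟩ := exists_Zof C n Z h1
      obtain ⟨f2, e2⟩ := exists_Zof C n Zt h2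
      obtain ⟨f3, e3⟩ := exists_Zof C n V h3
      refine ⟨(((fun c d => m c d, fun c j x y => τ c j x y, fun c d => ex c d), (f1, f2, f3)), D),
        ?_, ?_⟩
      · simp only [mem_product, mem_univ, true_and]
        exact mem_DD k n D h4 h5
      · simp only
        rw [e1, e2, e3]
        have hof : ∀ K a, a ≤ K → ((Fin.ofNat (K + 1) a : Fin (K + 1)) : ℕ) = a := by
          intro K a ha
          simp only [Fin.ofNat]
          exact Nat.mod_eq_of_lt (by omega)
        refine h6.filter _ _ _ C h1 h2 h3 ?_ ?_ ?_
        · intro a b ha hb; simp only [hof C a ha, hof C b hb]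
        · intro a b ha hb; simp only [hof C a ha, hof C b hb]
        · intro a j b c ha hj hb hc
          simp only [hof C a ha, hof k j hj, hof k b hb.le, hof k c hc.le]
    · intro a _ r r' h h'
      exact h.agr h'
  refine hmain.trans ?_
  rw [card_product, card_univ, Fintype.card_prod, hX]
  exact Nat.mul_le_mul_left _ (DD_card k n)

/-- the gap `v, v+1` is not a twin gap -/
def NT (n : ℕ) (r : ℕ → ℕ → Bool) (v : ℕ) : Prop :=
  ∃ u, u < n ∧ u ≠ v ∧ u ≠ v + 1 ∧ sy r u v ≠ sy r u (v + 1)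

theorem nt_bound {P : HerProp} {t n0 : ℕ} (hn0 : 1 ≤ n0)
    (hsp : speed P n0 < 2 ^ (n0 - 1)) (hk : NoRep P 1 t) :
    ∃ C, ∀ n r, Has P n r → ∀ W : Finset ℕ, (∀ v ∈ W, v + 1 < n ∧ NT n r v) → W.card ≤ C := by
  classical
  obtain ⟨C, hC⟩ := structure_thm le_rfl hn0 hsp hk
  refine ⟨3 * C, fun n r h W hW => ?_⟩
  obtain ⟨Z, Zt, V, D, m, τ, ex, h1, h2, h3, h4, h5, h6⟩ := hC n r h
  have key : ∀ u w, u < w → w < n → ¬ (u ∈ V ∧ w ∈ V) → r u w = m (clz Z u) (clz Z w) := by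
    intro u w huw hw hV
    apply (h6 u w huw hw).2.2 _ hV
    intro s j hj _ hs hws
    omega
  have hsub : W ⊆ Z.image (fun z => z - 1) ∪ V ∪ V.image (fun z => z - 1) := by
    intro v hv
    obtain ⟨hvn, u, hun, hu1, hu2, hu3⟩ := hW v hv
    simp only [mem_union, mem_image]
    by_contra hcon
    push Not at hcon
    obtain ⟨⟨c1, c2⟩, c3⟩ := hcon
    have d1 : v + 1 ∉ Z := fun hz => c1 (v + 1) hz (by omega)
    have d3 : v + 1 ∉ V := fun hz => c3 (v + 1) hz (by omega)
    have hcl : clz Z v = clz Z (v + 1) := clz_eq (by omega) (fun z hz a b => by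
      have : z = v + 1 := by omega
      exact d1 (this ▸ hz))
    apply hu3
    rcases Nat.lt_or_ge u v with huv | huv
    · rw [sy_lt huv, sy_lt (by omega), key u v huv (by omega) (fun hh => c2 hh.2),
        key u (v + 1) (by omega) hvn (fun hh => d3 hh.2), hcl]
    · rw [sy_gt (by omega), sy_gt (by omega), key v u (by omega) hun (fun hh => c2 hh.1),
        key (v + 1) u (by omega) hun (fun hh => d3 hh.1), hcl]
  have e1 := card_le_card hsub
  have e2 := card_union_le (Z.image (fun z => z - 1) ∪ V) (V.image (fun z => z - 1))
  have e3 := card_union_le (Z.image (fun z => z - 1)) V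
  have e4 : (Z.image (fun z => z - 1)).card ≤ Z.card := card_image_le
  have e5 : (V.image (fun z => z - 1)).card ≤ V.card := card_image_le
  omega

theorem tw_chain {n : ℕ} {r : ℕ → ℕ → Bool} {x y u : ℕ} (hxy : x ≤ y)
    (h : ∀ v, x ≤ v → v < y → ¬ NT n r v) (hun : u < n) (hu : u < x ∨ y < u) :
    sy r u x = sy r u y := by
  obtain ⟨d, rfl⟩ := Nat.exists_eq_add_of_le hxy
  clear hxy
  induction d with
  | zero => rfl
  | succ d ih =>
    rw [ih (fun v a b => h v a (by omega)) (by omega)]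
    by_contra hcon
    exact h (x + d) (by omega) (by omega) ⟨u, hun, by omega, by omega, hcon⟩

theorem tw_inner {n : ℕ} {r : ℕ → ℕ → Bool} {a e : ℕ} (he : e ≤ n)
    (h : ∀ v, a ≤ v → v + 1 < e → ¬ NT n r v) {x y : ℕ} (hx : a ≤ x) (hxy : x < y) (hy : y < e) :
    r x y = r a (a + 1) := by
  have e1 : sy r y a = sy r y x := tw_chain hx (fun v p q => h v p (by omega)) (by omega) (by omega)
  have e2 : sy r a (a + 1) = sy r a y :=
    tw_chain (by omega) (fun v p q => h v (by omega) (by omega)) (by omega) (by omega)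
  rw [sy_lt (by omega), sy_lt (by omega)] at e2
  rw [sy_gt (by omega), sy_gt hxy] at e1
  rw [e2, e1]

theorem tw_outer {n : ℕ} {r : ℕ → ℕ → Bool} {a e u : ℕ}
    (h : ∀ v, a ≤ v → v + 1 < e → ¬ NT n r v) {x y : ℕ} (hx : a ≤ x) (hxe : x < e) (hy : a ≤ y)
    (hye : y < e) (hu : u < a ∨ e ≤ u) (hun : u < n) : sy r u x = sy r u y := by
  rcases le_total x y with hh | hh
  · exact tw_chain hh (fun v p q => h v (by omega) (by omega)) hun (by omega)
  · exact (tw_chain hh (fun v p q => h v (by omega) (by omega)) hun (by omega)).symm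

theorem fam_emb {P : HerProp} {N : ℕ} {r : ℕ → ℕ → Bool} (h : Has P N r) (n : ℕ)
    (f : ℕ → ℕ → ℕ) (hf : ∀ i x y, i < n → x < y → y < n → f i x < f i y)
    (hN : ∀ i x, i < n → x < n → f i x < N)
    (hd : ∀ i j, i < j → j < n → ∃ x y, x < y ∧ y < n ∧
      r (f i x) (f i y) ≠ r (f j x) (f j y)) : n ≤ speed P n := by
  have := card_le_speed (range n) P n (fun i r' => r' = fun x y => r (f i x) (f i y)) ?_ ?_
  · simpa using this
  · intro i hi
    rw [mem_range] at hi
    exact ⟨_, h.sub (f i) (fun x y => hf i x y hi) (fun x => hN i x hi) (fun _ _ _ _ => rfl), rfl⟩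
  · intro i hi j hj r1 r2 h1 h2 hagr
    rw [mem_range] at hi hj
    subst h1 h2
    rcases lt_trichotomy i j with hij | hij | hij
    · obtain ⟨x, y, hxy, hy, hne⟩ := hd i j hij hj
      exact (hne (hagr x y hxy hy)).elim
    · exact hij
    · obtain ⟨x, y, hxy, hy, hne⟩ := hd j i hij hi
      exact (hne (hagr x y hxy hy).symm).elim

theorem bool_ne3 {x y z : Bool} (h1 : x ≠ y) (h2 : z ≠ y) : x = z := by
  cases x <;> cases y <;> cases z <;> simp at h1 h2 ⊢

section clean
variable {P : HerProp} {N n a b : ℕ} {r : ℕ → ℕ → Bool} {α : Bool}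

/-- two homogeneous blocks of the same colour -/
def HB (n a b : ℕ) (r : ℕ → ℕ → Bool) (α : Bool) : Prop :=
  ∀ x y, x < y → ((a ≤ x ∧ x < a + n) ∨ (b ≤ x ∧ x < b + n)) →
    ((a ≤ y ∧ y < a + n) ∨ (b ≤ y ∧ y < b + n)) → r x y = α

theorem one_left (h : Has P N r) (hab : a + n ≤ b) (hbN : b + n ≤ N)
    {x : ℕ} (hx : x < a) {cA cB : Bool} (hne : cA ≠ cB)
    (hA : ∀ y, a ≤ y → y < a + n → r x y = cA) (hB : ∀ y, b ≤ y → y < b + n → r x y = cB) :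
    n ≤ speed P n := by
  apply fam_emb h n (fun i p => if p = 0 then x else if p ≤ i then a + p else b + p)
  · intro i p q hi hpq hq
    split_ifs <;> omega
  · intro i p hi hp
    split_ifs <;> omega
  · intro i j hij hj
    refine ⟨0, j, by omega, hj, ?_⟩
    have h1 : j ≠ 0 := by omega
    have h2 : ¬ j ≤ i := by omega
    simp only [h1, h2, if_true, if_false, le_refl]
    rw [hB (b + j) (by omega) (by omega), hA (a + j) (by omega) (by omega)]
    exact hne.symm

theorem one_right (h : Has P N r) (hab : a + n ≤ b)
    {x : ℕ} (hx : b + n ≤ x) (hxN : x < N) {cA cB : Bool} (hne : cA ≠ cB)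
    (hA : ∀ y, a ≤ y → y < a + n → r y x = cA) (hB : ∀ y, b ≤ y → y < b + n → r y x = cB) :
    n ≤ speed P n := by
  apply fam_emb h n (fun i p => if p = n - 1 then x else if p < i then a + p else b + p)
  · intro i p q hi hpq hq
    split_ifs <;> omega
  · intro i p hi hp
    split_ifs <;> omega
  · intro i j hij hj
    refine ⟨i, n - 1, by omega, by omega, ?_⟩
    have h1 : i ≠ n - 1 := by omega
    simp only [h1, hij, if_true, if_false, lt_irrefl]
    rw [hB (b + i) (by omega) (by omega), hA (a + i) (by omega) (by omega)]
    exact hne.symm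

theorem one_mid (h : Has P N r) (hH : HB n a b r α) (hbN : b + n ≤ N)
    {x : ℕ} (hx : a + n ≤ x) (hxb : x < b) {cA cB : Bool} (hne : cA ≠ cB)
    (hA : ∀ y, a ≤ y → y < a + n → r y x = cA) (hB : ∀ y, b ≤ y → y < b + n → r x y = cB) :
    n ≤ speed P n := by
  apply fam_emb h n (fun i p => if p = i then x else if p < i then a + p else b + p)
  · intro i p q hi hpq hq
    split_ifs <;> omega
  · intro i p hi hp
    split_ifs <;> omega
  · intro i j hij hj
    by_cases hc : cA = α
    · refine ⟨i, n - 1, by omega, by omega, ?_⟩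
      have h1 : n - 1 ≠ i := by omega
      have h2 : ¬ n - 1 < i := by omega
      have h3 : i ≠ j := by omega
      simp only [h1, h2, h3, hij, if_true, if_false]
      rw [hB _ (by omega) (by omega)]
      split_ifs with g1 g2
      · rw [hA _ (by omega) (by omega)]; exact hne.symm
      · omega
      · rw [hH _ _ (by omega) (by omega) (by omega), ← hc]; exact hne.symm
    · refine ⟨0, j, by omega, by omega, ?_⟩
      have h1 : 0 ≠ j := by omega
      have h2 : 0 < j := by omega
      have h3 : j ≠ i := by omega
      have h4 : ¬ j < i := by omega
      simp only [h1, h2, h3, h4, if_true, if_false]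
      rw [hA _ (by omega) (by omega)]
      split_ifs with g1 g2
      · rw [hB _ (by omega) (by omega)]; exact hne.symm
      · rw [hH _ _ (by omega) (by omega) (by omega)]; exact fun e => hc e.symm
      · omega

theorem star_mid (h : Has P N r) (hn : 3 ≤ n) (hH : HB n a b r α) (hbN : b + n ≤ N)
    {x : ℕ} (hx : a + n ≤ x) (hxb : x < b) {c : Bool} (hne : c ≠ α)
    (hA : ∀ y, a ≤ y → y < a + n → r y x = c) (hB : ∀ y, b ≤ y → y < b + n → r x y = c) :
    n ≤ speed P n := by
  apply fam_emb h n (fun i p => if p = i then x else if p < i then a + p else b + p)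
  · intro i p q hi hpq hq
    split_ifs <;> omega
  · intro i p hi hp
    split_ifs <;> omega
  · intro i j hij hj
    have h3 : i ≠ j := by omega
    by_cases hi0 : i = 0
    · by_cases hj1 : j = 1
      · refine ⟨0, 2, by omega, by omega, ?_⟩
        subst hi0 hj1
        simp
        rw [hB _ (by omega) (by omega), hH _ _ (by omega) (by omega) (by omega)]; exact hne
      · refine ⟨0, 1, by omega, by omega, ?_⟩
        have g1 : 1 < j := by omega
        have g2 : 0 < j := by omega
        have g3 : 1 ≠ j := by omega
        have g4 : 0 ≠ j := by omega
        subst hi0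
        simp [g1, g2, g3, g4]
        rw [hB _ (by omega) (by omega), hH _ _ (by omega) (by omega) (by omega)]; exact hne
    · refine ⟨0, i, by omega, by omega, ?_⟩
      have g1 : 0 ≠ i := by omega
      have g2 : 0 < i := by omega
      have g3 : 0 ≠ j := by omega
      have g4 : 0 < j := by omega
      simp only [g1, g2, g3, g4, h3, hij, if_true, if_false]
      rw [hA _ (by omega) (by omega), hH _ _ (by omega) (by omega) (by omega)]; exact hne

theorem pair_left (h : Has P N r) (hab : a + n ≤ b) (hbN : b + n ≤ N)
    {x y : ℕ} (hx : x < a) (hy : a + n ≤ y) (hyb : y < b) {c : Bool} (hne : r x y ≠ c)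
    (hA : ∀ y, a ≤ y → y < a + n → r x y = c) (hB : ∀ y, b ≤ y → y < b + n → r x y = c) :
    n ≤ speed P n := by
  apply fam_emb h n (fun i p => if p = 0 then x else if p = i + 1 then y else
    if p ≤ i then a + p else b + p)
  · intro i p q hi hpq hq
    split_ifs <;> omega
  · intro i p hi hp
    split_ifs <;> omega
  · intro i j hij hj
    refine ⟨0, i + 1, by omega, by omega, ?_⟩
    have h1 : i + 1 ≠ 0 := by omega
    have h2 : i + 1 ≠ j + 1 := by omega
    have h3 : i + 1 ≤ j := by omega
    simp only [h1, h2, h3, if_true, if_false]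
    rw [hA (a + (i + 1)) (by omega) (by omega)]
    exact hne

theorem pair_right (h : Has P N r) (hab : a + n ≤ b)
    {x y : ℕ} (hx : b + n ≤ x) (hxN : x < N) (hy : a + n ≤ y) (hyb : y < b) {c : Bool}
    (hne : r y x ≠ c)
    (hA : ∀ y, a ≤ y → y < a + n → r y x = c) :
    n ≤ speed P n := by
  apply fam_emb h n (fun i p => if p = n - 1 then x else if p = i then y else
    if p < i then a + p else b + p)
  · intro i p q hi hpq hq
    split_ifs <;> omega
  · intro i p hi hp
    split_ifs <;> omega
  · intro i j hij hj
    refine ⟨i, n - 1, by omega, by omega, ?_⟩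
    have h1 : i ≠ n - 1 := by omega
    have h2 : i ≠ j := by omega
    simp only [h1, h2, hij, if_true, if_false]
    rw [hA (a + i) (by omega) (by omega)]
    exact hne

theorem pair_mid (h : Has P N r) (hH : HB n a b r α) (hbN : b + n ≤ N)
    {x y : ℕ} (hx : a + n ≤ x) (hxy : x < y) (hyb : y < b) (hne : r x y ≠ α)
    (hxA : ∀ z, a ≤ z → z < a + n → r z x = α) :
    n ≤ speed P n := by
  apply fam_emb h n (fun i p => if i = n - 1 then a + p else if p = i then x else
    if p = i + 1 then y else if p < i then a + p else b + p)
  · intro i p q hi hpq hq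
    split_ifs <;> omega
  · intro i p hi hp
    split_ifs <;> omega
  · intro i j hij hj
    refine ⟨i, i + 1, by omega, by omega, ?_⟩
    have h1 : i ≠ n - 1 := by omega
    have h2 : i ≠ j := by omega
    have h3 : i ≠ j + 1 := by omega
    have h5 : i + 1 ≠ j + 1 := by omega
    have h6 : i + 1 ≠ i := by omega
    simp only [h1, h2, h3, h5, h6, hij, if_true, if_false]
    split_ifs with g1 g2 g3
    · rw [hH (a + i) (a + (i + 1)) (by omega) (by omega) (by omega)]; exact hne
    · rw [hxA (a + i) (by omega) (by omega)]; exact hne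
    · rw [hH (a + i) (a + (i + 1)) (by omega) (by omega) (by omega)]; exact hne
    · omega

theorem two_clean (h : Has P N r) (hn : 3 ≤ n) (hH : HB n a b r α) (hbN : b + n ≤ N)
    {u v : ℕ} (hv : a + n ≤ v) (hvb : v + 1 < b) (huN : u < N) (hu1 : u ≠ v) (hu2 : u ≠ v + 1)
    (huA : ¬ (a ≤ u ∧ u < a + n)) (huB : ¬ (b ≤ u ∧ u < b + n))
    (hne : sy r u v ≠ sy r u (v + 1)) (cA cB : ℕ → Bool)
    (hcA : ∀ s, s = u ∨ s = v ∨ s = v + 1 → ∀ y, a ≤ y → y < a + n → sy r s y = cA s)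
    (hcB : ∀ s, s = u ∨ s = v ∨ s = v + 1 → ∀ y, b ≤ y → y < b + n → sy r s y = cB s) :
    n ≤ speed P n := by
  have mA : ∀ s, s = u ∨ s = v ∨ s = v + 1 → a + n ≤ s → ∀ y, a ≤ y → y < a + n → r y s = cA s := by
    intro s hs h1 y h2 h3
    rw [← hcA s hs y h2 h3, sy_gt (by omega)]
  have mB : ∀ s, s = u ∨ s = v ∨ s = v + 1 → s < b → ∀ y, b ≤ y → y < b + n → r s y = cB s := by
    intro s hs h1 y h2 h3
    rw [← hcB s hs y h2 h3, sy_lt (by omega)]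
  -- middle vertices
  have mid : ∀ s, s = u ∨ s = v ∨ s = v + 1 → a + n ≤ s → s < b →
      (cA s = α ∧ cB s = α) ∨ n ≤ speed P n := by
    intro s hs h1 h2
    by_cases hc : cA s = cB s
    · by_cases hα : cA s = α
      · left; exact ⟨hα, hc ▸ hα⟩
      · right
        exact star_mid h hn hH hbN h1 h2 hα (mA s hs h1) (by rw [hc]; exact mB s hs h2)
    · right
      exact one_mid h hH hbN h1 h2 hc (mA s hs h1) (mB s hs h2)
  rcases mid v (by simp) hv (by omega) with hcv | hh
  swap
  · exact hh
  rcases mid (v + 1) (by simp) (by omega) (by omega) with hcv' | hh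
  swap
  · exact hh
  by_cases hul : u < a
  · have a1 : ∀ y, a ≤ y → y < a + n → r u y = cA u := fun y h1 h2 => by
      rw [← hcA u (by simp) y h1 h2, sy_lt (by omega)]
    have a2 := mB u (by simp) (by omega)
    by_cases hc : cA u = cB u
    · rw [sy_lt (by omega), sy_lt (by omega)] at hne
      rcases bool_two (e := cA u) hne with g | g
      · exact pair_left h (by omega) hbN hul hv (by omega) g a1 (by rw [hc]; exact a2)
      · exact pair_left h (by omega) hbN hul (by omega) hvb g a1 (by rw [hc]; exact a2)
    · exact one_left h (by omega) hbN hul hc a1 a2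
  by_cases hur : b + n ≤ u
  · have a1 := mA u (by simp) (by omega)
    have a2 : ∀ y, b ≤ y → y < b + n → r y u = cB u := fun y h1 h2 => by
      rw [← hcB u (by simp) y h1 h2, sy_gt (by omega)]
    by_cases hc : cA u = cB u
    · rw [sy_gt (by omega), sy_gt (by omega)] at hne
      rcases bool_two (e := cA u) hne with g | g
      · exact pair_right h (by omega) hur huN hv (by omega) g a1
      · exact pair_right h (by omega) hur huN (by omega) hvb g a1
    · exact one_right h (by omega) hur huN hc a1 a2
  have hu3 : a + n ≤ u := by omega
  have hu4 : u < b := by omega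
  rcases mid u (by simp) hu3 hu4 with hcu | hh
  swap
  · exact hh
  have fin : ∀ y, y = v ∨ y = v + 1 → sy r u y ≠ α → n ≤ speed P n := by
    intro y hy hyα
    have hcy : cA y = α := by rcases hy with rfl | rfl; exacts [hcv.1, hcv'.1]
    rcases lt_or_gt_of_ne (show u ≠ y by omega) with hlt | hlt
    · rw [sy_lt hlt] at hyα
      exact pair_mid h hH hbN hu3 hlt (by omega) hyα (by rw [← hcu.1]; exact mA u (by simp) hu3)
    · rw [sy_gt hlt] at hyα
      exact pair_mid h hH hbN (by omega) hlt hu4 hyα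
        (by rw [← hcy]; exact mA y (by omega) (by omega))
  rcases bool_two (e := α) hne with g | g
  · exact fin v (by simp) g
  · exact fin (v + 1) (by simp) g
end clean

theorem tw_any {n : ℕ} {r : ℕ → ℕ → Bool} {a e u : ℕ} (he : e ≤ n)
    (h : ∀ v, a ≤ v → v + 1 < e → ¬ NT n r v) {x y : ℕ} (hx : a ≤ x) (hxe : x < e) (hy : a ≤ y)
    (hye : y < e) (hun : u < n) (hux : u ≠ x) (huy : u ≠ y) : sy r u x = sy r u y := by
  by_cases hu : u < a ∨ e ≤ u
  · exact tw_outer h hx hxe hy hye hu hun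
  have key : ∀ z, a ≤ z → z < e → u ≠ z → sy r u z = r a (a + 1) := by
    intro z h1 h2 h3
    rcases lt_or_gt_of_ne h3 with hlt | hlt
    · rw [sy_lt hlt, tw_inner he h (by omega) hlt (by omega)]
    · rw [sy_gt hlt, tw_inner he h (by omega) hlt (by omega)]
  rw [key x hx hxe hux, key y hy hye huy]

theorem two_blocks {P : HerProp} {N : ℕ} {r : ℕ → ℕ → Bool} (h : Has P N r) (n : ℕ) {a b v : ℕ}
    (hA : ∀ w, a ≤ w → w + 1 < a + (n + 2) → ¬ NT N r w)
    (hB : ∀ w, b ≤ w → w + 1 < b + (n + 2) → ¬ NT N r w)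
    (hbN : b + (n + 2) ≤ N) (hv1 : a + (n + 2) ≤ v + 1) (hv2 : v + 1 ≤ b) (hNT : NT N r v) :
    n ≤ speed P n := by
  obtain ⟨u, huN, hu1, hu2, hne⟩ := hNT
  rcases Nat.lt_or_ge n 3 with hn | hn
  · interval_cases n
    · omega
    · refine fam_emb h 1 (fun _ _ => 0) (fun _ _ _ _ _ _ => ?_) (fun _ _ _ _ => ?_)
        (fun _ _ _ _ => ?_) <;> omega
    · refine fam_emb h 2 (fun i p => if p = 0 then min u (v + i) else max u (v + i)) ?_ ?_ ?_
      · intro i x y hi hxy hy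
        have : x = 0 := by omega
        have : y = 1 := by omega
        subst x; subst y
        simp only [if_true, one_ne_zero, if_false]
        have : i = 0 ∨ i = 1 := by omega
        rcases this with rfl | rfl <;> omega
      · intro i x hi hx
        split_ifs <;> omega
      · intro i j hij hj
        have : i = 0 := by omega
        have : j = 1 := by omega
        subst i; subst j
        refine ⟨0, 1, by omega, by omega, ?_⟩
        simp only [if_true, one_ne_zero, if_false]
        have key : ∀ x, u ≠ x → r (min u x) (max u x) = sy r u x := by
          intro x hx
          rcases lt_or_gt_of_ne hx with hlt | hlt
          · rw [sy_lt hlt, min_eq_left hlt.le, max_eq_right hlt.le]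
          · rw [sy_gt hlt, min_eq_right hlt.le, max_eq_left hlt.le]
        rw [key _ (by omega), key _ (by omega)]
        exact hne
  have inA : ∀ x y, a ≤ x → x < y → y < a + (n + 2) → r x y = r a (a + 1) :=
    fun x y h1 h2 h3 => tw_inner (by omega) hA h1 h2 h3
  have inB : ∀ x y, b ≤ x → x < y → y < b + (n + 2) → r x y = r b (b + 1) :=
    fun x y h1 h2 h3 => tw_inner (by omega) hB h1 h2 h3
  have inAB : ∀ x y, a ≤ x → x < a + (n + 2) → b ≤ y → y < b + (n + 2) → r x y = r a b := by
    intro x y h1 h2 h3 h4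
    have e1 : sy r y x = sy r y a :=
      tw_any (by omega) hA h1 h2 le_rfl (by omega) (by omega) (by omega) (by omega)
    have e2 : sy r a y = sy r a b :=
      tw_any (by omega) hB h3 h4 le_rfl (by omega) (by omega) (by omega) (by omega)
    rw [sy_gt (by omega), sy_gt (by omega)] at e1
    rw [sy_lt (by omega), sy_lt (by omega)] at e2
    rw [e1, e2]
  by_cases c1 : r a (a + 1) = r a b
  swap
  · exact one_left h (a := a + 1) (b := b + 1) (x := a) (by omega) (by omega) (by omega) c1
      (fun y h1 h2 => inA _ _ (by omega) (by omega) (by omega))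
      (fun y h1 h2 => inAB _ _ (by omega) (by omega) (by omega) (by omega))
  by_cases c2 : r a b = r b (b + 1)
  swap
  · exact one_right h (a := a + 1) (b := b + 1) (x := b + (n + 1)) (by omega) (by omega) (by omega)
      c2 (fun y h1 h2 => inAB _ _ (by omega) (by omega) (by omega) (by omega))
      (fun y h1 h2 => inB _ _ (by omega) (by omega) (by omega))
  have hHB : HB n (a + 1) (b + 1) r (r a b) := by
    intro x y hxy hx hy
    rcases hx with hx | hx <;> rcases hy with hy | hy
    · rw [inA x y (by omega) (by omega) (by omega), c1]
    · exact inAB x y (by omega) (by omega) (by omega) (by omega)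
    · omega
    · rw [inB x y (by omega) (by omega) (by omega), c2]
  obtain ⟨u', g1, g2, g3, g4, g5, g6⟩ : ∃ u', u' < N ∧ u' ≠ v ∧ u' ≠ v + 1 ∧
      ¬ (a + 1 ≤ u' ∧ u' < a + 1 + n) ∧ ¬ (b + 1 ≤ u' ∧ u' < b + 1 + n) ∧
      sy r u' v ≠ sy r u' (v + 1) := by
    by_cases c3 : a ≤ u ∧ u < a + (n + 2)
    · refine ⟨a, by omega, by omega, by omega, by omega, by omega, ?_⟩
      rw [sy_comm (r := r) u v, sy_comm (r := r) u (v + 1),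
        tw_any (by omega) hA c3.1 c3.2 le_rfl (by omega) (by omega) hu1.symm (by omega),
        tw_any (by omega) hA c3.1 c3.2 le_rfl (by omega) (by omega) hu2.symm (by omega)] at hne
      rwa [sy_comm (r := r) a v, sy_comm (r := r) a (v + 1)]
    by_cases c4 : b ≤ u ∧ u < b + (n + 2)
    · refine ⟨b + (n + 1), by omega, by omega, by omega, by omega, by omega, ?_⟩
      rw [sy_comm (r := r) u v, sy_comm (r := r) u (v + 1),
        tw_any (y := b + (n + 1)) (by omega) hB c4.1 c4.2 (by omega) (by omega) (by omega)
          hu1.symm (by omega),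
        tw_any (y := b + (n + 1)) (by omega) hB c4.1 c4.2 (by omega) (by omega) (by omega)
          hu2.symm (by omega)] at hne
      rwa [sy_comm (r := r) _ v, sy_comm (r := r) _ (v + 1)]
    · exact ⟨u, huN, hu1, hu2, by omega, by omega, hne⟩
  refine two_clean h hn hHB (by omega) (by omega) (by omega) g1 g2 g3 g4 g5 g6
    (fun s => sy r s (a + 1)) (fun s => sy r s (b + 1)) ?_ ?_
  · intro s hs y h1 h2
    exact tw_any (by omega) hA (by omega) (by omega) (by omega) (by omega) (by omega) (by omega)
      (by omega)
  · intro s hs y h1 h2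
    exact tw_any (by omega) hB (by omega) (by omega) (by omega) (by omega) (by omega) (by omega)
      (by omega)

/-- forward difference -/
def Dl (f : ℕ → ℤ) : ℕ → ℤ := fun n => f (n + 1) - f n

/-- the `K`-th difference eventually vanishes -/
def EvP : ℕ → (ℕ → ℤ) → Prop
  | 0, f => ∃ N, ∀ n, N ≤ n → f n = 0
  | K + 1, f => EvP K (Dl f)

theorem EvP.congr {K : ℕ} : ∀ {f g : ℕ → ℤ}, EvP K f → (∃ N, ∀ n, N ≤ n → f n = g n) → EvP K g := by
  induction K with
  | zero =>
    rintro f g ⟨N, h⟩ ⟨N', h'⟩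
    exact ⟨max N N', fun n hn => by rw [← h' n (by omega), h n (by omega)]⟩
  | succ K ih =>
    rintro f g h ⟨N', h'⟩
    refine ih (f := Dl f) h ⟨N', fun n hn => ?_⟩
    simp only [Dl, h' n hn, h' (n + 1) (by omega)]

theorem EvP.succ {K : ℕ} : ∀ {f : ℕ → ℤ}, EvP K f → EvP (K + 1) f := by
  induction K with
  | zero =>
    rintro f ⟨N, h⟩
    exact ⟨N, fun n hn => by simp only [Dl, h n hn, h (n + 1) (by omega), sub_zero]⟩
  | succ K ih => exact fun {f} h => ih (f := Dl f) h

theorem EvP.mono {K L : ℕ} {f : ℕ → ℤ} (h : EvP K f) (hKL : K ≤ L) : EvP L f := by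
  induction hKL with
  | refl => exact h
  | step _ ih => exact ih.succ

theorem EvP.add {K : ℕ} : ∀ {f g : ℕ → ℤ}, EvP K f → EvP K g → EvP K (fun n => f n + g n) := by
  induction K with
  | zero =>
    rintro f g ⟨N, h⟩ ⟨N', h'⟩
    exact ⟨max N N', fun n hn => by simp only [h' n (by omega), h n (by omega), add_zero]⟩
  | succ K ih =>
    intro f g h h'
    refine (ih (f := Dl f) (g := Dl g) h h').congr ⟨0, fun n _ => ?_⟩
    simp only [Dl]; ring

theorem EvP.neg {K : ℕ} : ∀ {f : ℕ → ℤ}, EvP K f → EvP K (fun n => - f n) := by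
  induction K with
  | zero =>
    rintro f ⟨N, h⟩
    exact ⟨N, fun n hn => by simp only [h n (by omega), neg_zero]⟩
  | succ K ih =>
    intro f h
    refine (ih (f := Dl f) h).congr ⟨0, fun n _ => ?_⟩
    simp only [Dl]; ring

theorem EvP.up {K : ℕ} : ∀ {f : ℕ → ℤ}, EvP K f → EvP K (fun n => f (n + 1)) := by
  induction K with
  | zero =>
    rintro f ⟨N, h⟩
    exact ⟨N, fun n hn => h (n + 1) (by omega)⟩
  | succ K ih => exact fun {f} h => ih (f := Dl f) h

theorem EvP.down {K : ℕ} : ∀ {f : ℕ → ℤ}, EvP K (fun n => f (n + 1)) → EvP K f := by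
  induction K with
  | zero =>
    rintro f ⟨N, h⟩
    refine ⟨N + 1, fun n hn => ?_⟩
    obtain ⟨m, rfl⟩ : ∃ m, n = m + 1 := ⟨n - 1, by omega⟩
    exact h m (by omega)
  | succ K ih => exact fun {f} h => ih (f := Dl f) h

/-- eventually polynomial -/
def IsP (f : ℕ → ℤ) : Prop := ∃ K, EvP K f

theorem IsP.congr {f g : ℕ → ℤ} (h : IsP f) (h' : ∃ N, ∀ n, N ≤ n → f n = g n) : IsP g :=
  ⟨h.choose, h.choose_spec.congr h'⟩

theorem IsP.zero : IsP (fun _ => 0) := ⟨0, 0, fun _ _ => rfl⟩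

theorem IsP.add {f g : ℕ → ℤ} (hf : IsP f) (hg : IsP g) : IsP (fun n => f n + g n) := by
  obtain ⟨K, hK⟩ := hf
  obtain ⟨L, hL⟩ := hg
  exact ⟨max K L, (hK.mono (le_max_left _ _)).add (hL.mono (le_max_right _ _))⟩

theorem IsP.sub {f g : ℕ → ℤ} (hf : IsP f) (hg : IsP g) : IsP (fun n => f n - g n) := by
  obtain ⟨L, hL⟩ := hg
  exact (hf.add ⟨L, hL.neg⟩).congr ⟨0, fun n _ => by ring⟩

theorem IsP.sum {ι : Type*} (s : Finset ι) (f : ι → ℕ → ℤ) (h : ∀ i ∈ s, IsP (f i)) :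
    IsP (fun n => ∑ i ∈ s, f i n) := by
  classical
  induction s using Finset.induction_on with
  | empty => simpa using IsP.zero
  | insert a s ha ih =>
    simp only [Finset.sum_insert ha]
    exact (h a (by simp)).add (ih (fun i hi => h i (by simp [hi])))

theorem IsP.down (i : ℕ) : ∀ {f : ℕ → ℤ}, IsP (fun n => f (n + i)) → IsP f := by
  induction i with
  | zero => exact fun {f} h => h
  | succ i ih =>
    intro f h
    have : IsP (fun n => f (n + 1)) := by
      apply ih
      exact h.congr ⟨0, fun n _ => by ring_nf⟩
    obtain ⟨K, hK⟩ := this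
    exact ⟨K, hK.down⟩

theorem IsP.shb {f : ℕ → ℤ} (h : IsP f) (i : ℕ) : IsP (fun n => if i ≤ n then f (n - i) else 0) := by
  apply IsP.down i
  exact h.congr ⟨0, fun n _ => by simp⟩

theorem IsP.psum {f : ℕ → ℤ} (h : IsP f) : IsP (fun n => ∑ i ∈ range (n + 1), f i) := by
  obtain ⟨K, hK⟩ := h
  refine ⟨K + 1, ?_⟩
  refine EvP.congr (K := K) hK.up ⟨0, fun n _ => ?_⟩
  simp only [Dl]
  rw [sum_range_succ _ (n + 1)]; ring

theorem EvP.form {K : ℕ} : ∀ {f : ℕ → ℤ}, EvP K f → ∃ (K N : ℕ) (a : ℕ → ℤ), ∀ n : ℕ, N ≤ n →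
    f n = ∑ i ∈ Finset.range (K + 1), a i * (n.choose i : ℤ) := by
  induction K with
  | zero =>
    rintro f ⟨N, h⟩
    exact ⟨0, N, fun _ => 0, fun n hn => by simp [h n hn]⟩
  | succ K ih =>
    intro f h
    obtain ⟨K', N, a, ha⟩ := ih (f := Dl f) h
    have hc : ∀ m, f (N + m) - ∑ i ∈ range (K' + 1), a i * ((N + m).choose (i + 1) : ℤ) =
        f N - ∑ i ∈ range (K' + 1), a i * (N.choose (i + 1) : ℤ) := by
      intro m
      induction m with
      | zero => simp
      | succ m ihm =>
        rw [← ihm]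
        have := ha (N + m) (by omega)
        simp only [Dl] at this
        have e : ∀ i, (((N + (m + 1)).choose (i + 1) : ℕ) : ℤ) =
            ((N + m).choose i : ℤ) + ((N + m).choose (i + 1) : ℤ) := by
          intro i
          rw [← add_assoc, Nat.choose_succ_succ]; push_cast; rfl
        simp only [e, mul_add, sum_add_distrib]
        rw [← this, ← add_assoc]; ring
    refine ⟨K' + 1, N, fun i => if i = 0 then
      f N - ∑ i ∈ range (K' + 1), a i * (N.choose (i + 1) : ℤ) else a (i - 1), fun n hn => ?_⟩
    obtain ⟨m, rfl⟩ := Nat.exists_eq_add_of_le hn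
    rw [sum_range_succ']
    simp only [Nat.add_eq_zero_iff, one_ne_zero, and_false, if_false, Nat.add_sub_cancel, if_true,
      Nat.choose_zero_right]
    rw [← hc m]; push_cast; ring

theorem EvP.bdd {K : ℕ} : ∀ {f : ℕ → ℤ} {C : ℤ}, EvP K f → (∀ n, |f n| ≤ C) →
    ∃ (c : ℤ) (N : ℕ), ∀ n, N ≤ n → f n = c := by
  induction K with
  | zero => rintro f C ⟨N, h⟩ _; exact ⟨0, N, h⟩
  | succ K ih =>
    intro f C h hC
    obtain ⟨d, N, hd⟩ := ih (f := Dl f) (C := 2 * C) h (fun n => by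
      have h1 := abs_le.1 (hC n)
      have h2 := abs_le.1 (hC (n + 1))
      simp only [Dl]
      rw [abs_le]; constructor <;> linarith)
    have hm : ∀ m : ℕ, f (N + m) = f N + m * d := by
      intro m
      induction m with
      | zero => simp
      | succ m ihm =>
        have := hd (N + m) (by omega)
        simp only [Dl] at this
        rw [← add_assoc]; push_cast; linarith
    have hd0 : d = 0 := by
      by_contra hne
      have hC0 : 0 ≤ C := le_trans (abs_nonneg _) (hC 0)
      have h1 := abs_le.1 (hC N)
      have h2 := hC (N + (2 * C + 1).toNat)
      rw [hm, abs_le] at h2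
      have h3 : (((2 * C + 1).toNat : ℕ) : ℤ) = 2 * C + 1 := Int.toNat_of_nonneg (by omega)
      rw [h3] at h2
      rcases lt_or_gt_of_ne hne with g | g
      · nlinarith
      · nlinarith
    refine ⟨f N, N, fun n hn => ?_⟩
    obtain ⟨m, rfl⟩ := Nat.exists_eq_add_of_le hn
    rw [hm, hd0]; simp

/-- number of tuples of total sum `n` in `A` -/
noncomputable def fcnt {Q : ℕ} (A : Set (Fin Q → ℕ)) (n : ℕ) : ℕ :=
  by classical exact ((Finset.Nat.antidiagonalTuple Q n).filter (fun s => s ∈ A)).card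

theorem fcnt_eq {Q : ℕ} (A : Set (Fin Q → ℕ)) [DecidablePred (fun s => s ∈ A)] (n : ℕ) :
    fcnt A n = ((Finset.Nat.antidiagonalTuple Q n).filter (fun s => s ∈ A)).card := by
  unfold fcnt; congr

theorem slices_stab {Q : ℕ} (A : ℕ → Set (Fin Q → ℕ)) (hA : ∀ i, IsLowerSet (A i))
    (hd : Antitone A) : ∃ m, ∀ i, m ≤ i → A i = A m := by
  by_contra hcon
  push Not at hcon
  have : ∀ m, ∃ i, m ≤ i ∧ ∃ x, x ∈ A m ∧ x ∉ A i := by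
    intro m
    obtain ⟨i, hi, hne⟩ := hcon m
    refine ⟨i, hi, ?_⟩
    by_contra hc
    push Not at hc
    exact hne (le_antisymm (hd hi) hc)
  choose I hI x hx hx' using this
  have hwqo : WellQuasiOrdered (α := Fin Q → ℕ) (· ≤ ·) := wellQuasiOrdered_le
  have hmono : Monotone (fun k => I^[k] 0) := by
    apply monotone_nat_of_le_succ
    intro k
    rw [Function.iterate_succ_apply']
    exact hI _
  obtain ⟨k, l, hkl, hle⟩ := hwqo (fun k => x (I^[k] 0))
  have h1 : x (I^[l] 0) ∈ A (I^[k + 1] 0) := hd (hmono hkl) (hx _)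
  have h2 := hA _ hle h1
  rw [Function.iterate_succ_apply'] at h2
  exact hx' _ h2

theorem fcnt_succ {Q : ℕ} (A : Set (Fin (Q + 1) → ℕ)) (n : ℕ) :
    fcnt A n = ∑ i ∈ range (n + 1), fcnt {t : Fin Q → ℕ | Fin.cons i t ∈ A} (n - i) := by
  classical
  rw [← Finset.Nat.sum_antidiagonal_eq_sum_range_succ_mk (fun p : ℕ × ℕ =>
    fcnt {t : Fin Q → ℕ | Fin.cons p.1 t ∈ A} p.2)]
  have hd : ∀ p ∈ antidiagonal n, fcnt {t : Fin Q → ℕ | Fin.cons p.1 t ∈ A} p.2 =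
      (((Finset.Nat.antidiagonalTuple (Q + 1) n).filter (fun s => s ∈ A)).filter
        (fun s => (s 0, ∑ i, s (Fin.succ i)) = p)).card := by
    intro p hp
    rw [fcnt_eq]
    rw [HasAntidiagonal.mem_antidiagonal] at hp
    apply Finset.card_bij (fun t _ => (Fin.cons p.1 t : Fin (Q + 1) → ℕ))
    · intro t ht
      simp only [mem_filter, Finset.Nat.mem_antidiagonalTuple, Set.mem_ofPred_eq] at ht ⊢
      refine ⟨⟨?_, ht.2⟩, ?_⟩
      · rw [Fin.sum_univ_succ]; simp [ht.1, hp]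
      · simp [ht.1]
    · intro t _ t' _ he
      exact (Fin.cons_inj.1 he).2
    · intro s hs
      simp only [mem_filter, Finset.Nat.mem_antidiagonalTuple] at hs
      obtain ⟨⟨h1, h2⟩, h3⟩ := hs
      subst h3
      refine ⟨Fin.tail s, ?_, Fin.cons_self_tail s⟩
      simp only [mem_filter, Finset.Nat.mem_antidiagonalTuple, Set.mem_ofPred_eq,
        Fin.cons_self_tail]
      exact ⟨rfl, h2⟩
  rw [sum_congr rfl hd, fcnt_eq]
  apply Finset.card_eq_sum_card_fiberwise
  intro s hs
  simp only [coe_filter, Finset.Nat.mem_antidiagonalTuple, Set.mem_ofPred_eq] at hs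
  simp only [Finset.mem_coe, HasAntidiagonal.mem_antidiagonal]
  rw [← hs.1, Fin.sum_univ_succ]

theorem fcnt_isP : ∀ {Q : ℕ} (A : Set (Fin Q → ℕ)), IsLowerSet A → IsP (fun n => (fcnt A n : ℤ)) := by
  intro Q
  induction Q with
  | zero =>
    intro A _
    refine ⟨0, 1, fun n hn => ?_⟩
    classical
    obtain ⟨m, rfl⟩ : ∃ m, n = m + 1 := ⟨n - 1, by omega⟩
    simp only [fcnt_eq]
    simp
  | succ Q ih =>
    intro A hA
    set B : ℕ → Set (Fin Q → ℕ) := fun i => {t : Fin Q → ℕ | Fin.cons i t ∈ A} with hBdef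
    have hB : ∀ i, IsLowerSet (B i) := by
      intro i s t hst hs
      exact hA (Fin.cons_le_cons.2 ⟨le_rfl, hst⟩) hs
    have hanti : Antitone B := by
      intro i j hij t ht
      exact hA (Fin.cons_le_cons.2 ⟨hij, le_rfl⟩) ht
    obtain ⟨m, hm⟩ := slices_stab B hB hanti
    have h1 := (ih (B m) (hB m)).psum
    have h2 := IsP.sum (range m) (fun i n => if i ≤ n then
      ((fcnt (B i) (n - i) : ℤ) - fcnt (B m) (n - i)) else 0)
      (fun i _ => ((ih (B i) (hB i)).sub (ih (B m) (hB m))).shb i)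
    refine (h1.add h2).congr ⟨m, fun n hn => ?_⟩
    rw [fcnt_succ A n]
    push_cast
    have e1 : ∑ i ∈ range (n + 1), (fcnt (B m) i : ℤ) =
        ∑ i ∈ range (n + 1), (fcnt (B m) (n - i) : ℤ) := by
      rw [← Finset.sum_range_reflect]
      apply sum_congr rfl
      intro i hi
      congr 2
    have e2 : ∑ i ∈ range m, (if i ≤ n then
        ((fcnt (B i) (n - i) : ℤ) - fcnt (B m) (n - i)) else 0) =
        ∑ i ∈ range (n + 1), ((fcnt (B i) (n - i) : ℤ) - fcnt (B m) (n - i)) := by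
      rw [← Finset.sum_subset (s₁ := range m) (s₂ := range (n + 1))]
      · apply sum_congr rfl
        intro i hi
        rw [mem_range] at hi
        rw [if_pos (by omega)]
      · intro i hi
        rw [mem_range] at hi ⊢; omega
      · intro i _ hi
        rw [mem_range, not_lt] at hi
        rw [hm i hi, sub_self]
    rw [e1, e2, ← sum_add_distrib]
    apply sum_congr rfl
    intro i _
    ring

section codes
open Classical in
/-- block index of the vertex `x` -/
noncomputable def bl (n : ℕ) (r : ℕ → ℕ → Bool) (x : ℕ) : ℕ := Nat.count (fun v => NT n r v) x

theorem bl_zero {n : ℕ} {r : ℕ → ℕ → Bool} : bl n r 0 = 0 := by simp [bl]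

theorem bl_succ_pos {n : ℕ} {r : ℕ → ℕ → Bool} {x : ℕ} (h : NT n r x) :
    bl n r (x + 1) = bl n r x + 1 := by
  classical
  simp [bl, Nat.count_succ, h]

theorem bl_succ_neg {n : ℕ} {r : ℕ → ℕ → Bool} {x : ℕ} (h : ¬ NT n r x) :
    bl n r (x + 1) = bl n r x := by
  classical
  simp [bl, Nat.count_succ, h]

theorem bl_mono {n : ℕ} {r : ℕ → ℕ → Bool} {x y : ℕ} (h : x ≤ y) : bl n r x ≤ bl n r y := by
  classical
  exact Nat.count_monotone _ h

theorem bl_lt {n : ℕ} {r : ℕ → ℕ → Bool} {x y : ℕ} (h : bl n r x < bl n r y) :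
    ∃ v, x ≤ v ∧ v < y ∧ NT n r v := by
  by_contra hcon
  push Not at hcon
  have : ∀ d, x + d ≤ y → bl n r (x + d) = bl n r x := by
    intro d
    induction d with
    | zero => intro _; rfl
    | succ d ih =>
      intro hd
      rw [← add_assoc, bl_succ_neg (hcon _ (by omega) (by omega)), ih (by omega)]
  have hxy : x ≤ y := by
    by_contra hc
    have := bl_mono (n := n) (r := r) (show y ≤ x by omega)
    omega
  have := this (y - x) (by omega)
  rw [Nat.add_sub_cancel' hxy] at this
  omega

theorem bl_eq_not {n : ℕ} {r : ℕ → ℕ → Bool} {x y v : ℕ} (h : bl n r x = bl n r y) (h1 : x ≤ v)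
    (h2 : v < y) : ¬ NT n r v := by
  intro hv
  have e1 := bl_succ_pos hv
  have e2 := bl_mono (n := n) (r := r) h1
  have e3 := bl_mono (n := n) (r := r) (show v + 1 ≤ y from h2)
  omega

theorem same_block {n : ℕ} {r : ℕ → ℕ → Bool} {x y u : ℕ} (h : bl n r x = bl n r y) (hx : x < n)
    (hy : y < n) (hu : u < n) (hux : u ≠ x) (huy : u ≠ y) : sy r u x = sy r u y := by
  rcases le_total x y with hh | hh
  · exact tw_any (a := x) (e := y + 1) (by omega) (fun v h1 h2 => bl_eq_not h h1 (by omega)) le_rfl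
      (by omega) hh (by omega) hu hux huy
  · exact tw_any (a := y) (e := x + 1) (by omega) (fun v h1 h2 => bl_eq_not h.symm h1 (by omega)) hh
      (by omega) le_rfl (by omega) hu hux huy

theorem bl_col {n : ℕ} {r : ℕ → ℕ → Bool} {a b a' b' : ℕ} (hab : a ≠ b) (hab' : a' ≠ b')
    (ha : a < n) (hb : b < n) (ha' : a' < n) (hb' : b' < n) (h1 : bl n r a = bl n r a')
    (h2 : bl n r b = bl n r b') : sy r a b = sy r a' b' := by
  by_cases c1 : a' = b
  · by_cases c2 : a = b'
    · subst c1 c2; exact sy_comm _ _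
    · rw [same_block h2 hb hb' ha hab c2, sy_comm a b',
        same_block h1 ha ha' hb' (Ne.symm c2) (Ne.symm hab'), sy_comm]
  · rw [sy_comm a b, same_block h1 ha ha' hb (Ne.symm hab) (Ne.symm c1), sy_comm b a',
      same_block h2 hb hb' ha' c1 hab']

open Classical in
/-- block sizes -/
noncomputable def bT (n : ℕ) (r : ℕ → ℕ → Bool) (i : ℕ) : ℕ :=
  ((range n).filter (fun x => bl n r x = i)).card

open Classical in
/-- block colours -/
noncomputable def bM (n : ℕ) (r : ℕ → ℕ → Bool) (i j : ℕ) : Bool :=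
  decide (∃ x y, x < y ∧ y < n ∧ bl n r x = i ∧ bl n r y = j ∧ r x y = true)

theorem bM_spec {n : ℕ} {r : ℕ → ℕ → Bool} {x y : ℕ} (hxy : x < y) (hy : y < n) :
    r x y = bM n r (bl n r x) (bl n r y) := by
  cases hr : r x y with
  | true =>
    symm; simp only [bM, decide_eq_true_eq]
    exact ⟨x, y, hxy, hy, rfl, rfl, hr⟩
  | false =>
    symm; simp only [bM, decide_eq_false_iff_not]
    rintro ⟨x', y', h1, h2, h3, h4, h5⟩
    have := bl_col (n := n) (r := r) (a := x) (b := y) (a' := x') (b' := y') (by omega) (by omega)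
      (by omega) hy (by omega) h2 h3.symm h4.symm
    rw [sy_lt hxy, sy_lt h1, hr, h5] at this
    exact absurd this (by simp)

theorem sy_agr {n : ℕ} {r r' : ℕ → ℕ → Bool} (h : Agr n r r') {x y : ℕ} (hx : x < n) (hy : y < n)
    (hne : x ≠ y) : sy r x y = sy r' x y := by
  rcases lt_or_gt_of_ne hne with g | g
  · rw [sy_lt g, sy_lt g, h x y g hy]
  · rw [sy_gt g, sy_gt g, h y x g hx]

theorem NT_agr {n : ℕ} {r r' : ℕ → ℕ → Bool} (h : Agr n r r') {v : ℕ} (hv : v + 1 < n) :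
    NT n r v ↔ NT n r' v := by
  unfold NT
  apply exists_congr
  intro u
  constructor
  · rintro ⟨h1, h2, h3, h4⟩
    rw [sy_agr h h1 (by omega) h2, sy_agr h h1 hv h3] at h4
    exact ⟨h1, h2, h3, h4⟩
  · rintro ⟨h1, h2, h3, h4⟩
    rw [← sy_agr h h1 (by omega) h2, ← sy_agr h h1 hv h3] at h4
    exact ⟨h1, h2, h3, h4⟩

theorem bl_unique {n : ℕ} {r : ℕ → ℕ → Bool} (L : ℕ → ℕ) (h0 : 0 < n → L 0 = 0)
    (h1 : ∀ x, x + 1 < n → NT n r x → L (x + 1) = L x + 1)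
    (h2 : ∀ x, x + 1 < n → ¬ NT n r x → L (x + 1) = L x) : ∀ x, x < n → bl n r x = L x := by
  intro x
  induction x with
  | zero => intro hx; rw [bl_zero, h0 hx]
  | succ x ih =>
    intro hx
    by_cases h : NT n r x
    · rw [bl_succ_pos h, h1 x hx h, ih (by omega)]
    · rw [bl_succ_neg h, h2 x hx h, ih (by omega)]

theorem bl_agr {n : ℕ} {r r' : ℕ → ℕ → Bool} (h : Agr n r r') : ∀ x, x < n →
    bl n r x = bl n r' x := by
  apply bl_unique
  · intro _; exact bl_zero
  · intro x hx hN; exact bl_succ_pos ((NT_agr h hx).1 hN)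
  · intro x hx hN; exact bl_succ_neg (fun hh => hN ((NT_agr h hx).2 hh))

theorem bT_agr {n : ℕ} {r r' : ℕ → ℕ → Bool} (h : Agr n r r') (i : ℕ) : bT n r i = bT n r' i := by
  classical
  simp only [bT]
  congr 1
  apply filter_congr
  intro x hx
  rw [mem_range] at hx
  rw [bl_agr h x hx]

theorem bM_agr {n : ℕ} {r r' : ℕ → ℕ → Bool} (h : Agr n r r') (i j : ℕ) :
    bM n r i j = bM n r' i j := by
  classical
  simp only [bM]
  congr 1
  apply propext
  constructor
  · rintro ⟨x, y, h1, h2, h3, h4, h5⟩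
    exact ⟨x, y, h1, h2, by rw [← bl_agr h x (by omega), h3], by rw [← bl_agr h y h2, h4],
      by rw [← h x y h1 h2, h5]⟩
  · rintro ⟨x, y, h1, h2, h3, h4, h5⟩
    exact ⟨x, y, h1, h2, by rw [bl_agr h x (by omega), h3], by rw [bl_agr h y h2, h4],
      by rw [h x y h1 h2, h5]⟩

theorem bT_cum {n : ℕ} {r : ℕ → ℕ → Bool} (k : ℕ) :
    ∑ i ∈ range k, bT n r i = ((range n).filter (fun x => bl n r x < k)).card := by
  classical
  rw [Finset.card_eq_sum_card_fiberwise (f := fun x => bl n r x) (t := range k)]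
  · apply sum_congr rfl
    intro i hi
    rw [mem_range] at hi
    simp only [bT, filter_filter]
    congr 1
    apply filter_congr
    intro x _
    constructor
    · intro h; exact ⟨by omega, h⟩
    · intro h; exact h.2
  · intro x hx
    simp only [coe_filter, Set.mem_ofPred_eq] at hx
    simp only [Finset.mem_coe, mem_range]
    exact hx.2

theorem bl_lt_iff {n : ℕ} {r : ℕ → ℕ → Bool} {x k : ℕ} (hx : x < n) :
    bl n r x < k ↔ x < ∑ i ∈ range k, bT n r i := by
  classical
  rw [bT_cum]
  constructor
  · intro h
    have : range (x + 1) ⊆ (range n).filter (fun x => bl n r x < k) := by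
      intro y hy
      rw [mem_range] at hy
      rw [mem_filter, mem_range]
      exact ⟨by omega, lt_of_le_of_lt (bl_mono (by omega)) h⟩
    have := card_le_card this
    rw [card_range] at this
    omega
  · intro h
    by_contra hc
    have : (range n).filter (fun x => bl n r x < k) ⊆ range x := by
      intro y hy
      rw [mem_filter, mem_range] at hy
      rw [mem_range]
      by_contra hyx
      have := bl_mono (n := n) (r := r) (show x ≤ y by omega)
      omega
    have := card_le_card this
    rw [card_range] at this
    omega

theorem code_inj {n Q : ℕ} {r r' : ℕ → ℕ → Bool} (hQ : ∀ x, x < n → bl n r x < Q)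
    (hQ' : ∀ x, x < n → bl n r' x < Q)
    (hT : ∀ i, i < Q → bT n r i = bT n r' i)
    (hM : ∀ i j, i < Q → j < Q → bM n r i j = bM n r' i j) : Agr n r r' := by
  have hbl : ∀ x, x < n → bl n r x = bl n r' x := by
    intro x hx
    have key : ∀ k, k ≤ Q → (bl n r x < k ↔ bl n r' x < k) := by
      intro k hk
      rw [bl_lt_iff hx, bl_lt_iff hx, sum_congr rfl (fun i hi => hT i (by
        rw [mem_range] at hi; omega))]
    have a1 := hQ x hx
    have a2 := hQ' x hx
    have k1 := key (bl n r x + 1) (by omega)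
    have k2 := key (bl n r' x + 1) (by omega)
    omega
  intro x y hxy hy
  rw [bM_spec (r := r) hxy hy, bM_spec (r := r') hxy hy, ← hbl x (by omega), ← hbl y hy]
  exact hM _ _ (hQ x (by omega)) (hQ y hy)

theorem bT_sum {n Q : ℕ} {r : ℕ → ℕ → Bool} (hQ : ∀ x, x < n → bl n r x < Q) :
    ∑ i ∈ range Q, bT n r i = n := by
  classical
  rw [bT_cum, filter_true_of_mem, card_range]
  intro x hx
  exact hQ x (mem_range.1 hx)
end codes

theorem bl_hit {n : ℕ} {r : ℕ → ℕ → Bool} (x i : ℕ) (hi : i ≤ bl n r x) :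
    ∃ y, y ≤ x ∧ bl n r y = i := by
  induction x with
  | zero => rw [bl_zero] at hi; exact ⟨0, le_rfl, by rw [bl_zero]; omega⟩
  | succ x ih =>
    by_cases h : i ≤ bl n r x
    · obtain ⟨y, h1, h2⟩ := ih h
      exact ⟨y, by omega, h2⟩
    · refine ⟨x + 1, le_rfl, ?_⟩
      by_cases hN : NT n r x
      · rw [bl_succ_pos hN] at hi ⊢; omega
      · rw [bl_succ_neg hN] at hi; omega

theorem shrink {P : HerProp} {n Q : ℕ} {r : ℕ → ℕ → Bool} (h : Has P n r)
    (hQ : ∀ x, x < n → bl n r x < Q) (T' : ℕ → ℕ) (hle : ∀ i, i < Q → T' i ≤ bT n r i)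
    (h1 : ∀ i, i < Q → 1 ≤ bT n r i → 1 ≤ T' i) (h2 : ∀ i, i < Q → 2 ≤ bT n r i → 2 ≤ T' i) :
    ∃ n' r', Has P n' r' ∧ (∀ i, i < Q → bT n' r' i = T' i) ∧
      (∀ i j, i < Q → j < Q → bM n' r' i j = bM n r i j) := by
  classical
  have hF : ∀ i, ∃ F : Finset ℕ, i < Q → F ⊆ (range n).filter (fun x => bl n r x = i) ∧
      F.card = T' i := by
    intro i
    by_cases hi : i < Q
    · obtain ⟨F, hF1, hF2⟩ := Finset.exists_subset_card_eq
        (s := (range n).filter (fun x => bl n r x = i)) (n := T' i)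
        (by have := hle i hi; simp only [bT] at this; convert this)
      exact ⟨F, fun _ => ⟨hF1, hF2⟩⟩
    · exact ⟨∅, fun hh => absurd hh hi⟩
  choose F hF using hF
  set S := (range Q).biUnion F with hS
  have hFm : ∀ i, i < Q → ∀ y ∈ F i, y < n ∧ bl n r y = i := by
    intro i hi y hy
    have := (hF i hi).1 hy
    rw [mem_filter, mem_range] at this
    exact this
  have hSn : ∀ y ∈ S, y < n := by
    intro y hy
    rw [hS, mem_biUnion] at hy
    obtain ⟨i, hi, hy⟩ := hy
    exact (hFm i (mem_range.1 hi) y hy).1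
  have hSF : ∀ i, i < Q → ∀ y, y ∈ F i ↔ y ∈ S ∧ bl n r y = i := by
    intro i hi y
    constructor
    · intro hy
      exact ⟨by rw [hS, mem_biUnion]; exact ⟨i, mem_range.2 hi, hy⟩, (hFm i hi y hy).2⟩
    · rintro ⟨hy, he⟩
      rw [hS, mem_biUnion] at hy
      obtain ⟨j, hj, hy⟩ := hy
      have := (hFm j (mem_range.1 hj) y hy).2
      rw [he] at this
      rw [this]; exact hy
  have pick1 : ∀ x, x < n → ∃ y ∈ S, bl n r y = bl n r x := by
    intro x hx
    have hq := hQ x hx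
    have : 1 ≤ bT n r (bl n r x) := by
      simp only [bT]
      apply Finset.card_pos.2
      exact ⟨x, by rw [mem_filter, mem_range]; exact ⟨hx, rfl⟩⟩
    have := h1 _ hq this
    rw [← (hF _ hq).2] at this
    obtain ⟨y, hy⟩ := Finset.card_pos.1 this
    exact ⟨y, (hSF _ hq y).1 hy⟩
  have pick2 : ∀ x y, x < n → y < n → x ≠ y → bl n r x = bl n r y →
      ∀ z, ∃ w ∈ S, w ≠ z ∧ bl n r w = bl n r x := by
    intro x y hx hy hxy he z
    have hq := hQ x hx
    have : 2 ≤ bT n r (bl n r x) := by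
      simp only [bT]
      apply Finset.one_lt_card.2
      exact ⟨x, by rw [mem_filter, mem_range]; exact ⟨hx, rfl⟩, y,
        by rw [mem_filter, mem_range]; exact ⟨hy, he.symm⟩, hxy⟩
    have := h2 _ hq this
    rw [← (hF _ hq).2] at this
    obtain ⟨w, hw, hwz⟩ := Finset.exists_mem_ne this z
    have := (hSF _ hq w).1 hw
    exact ⟨w, this.1, hwz, this.2⟩
  obtain ⟨g, g1, g2, g3⟩ := enum_exists S
  have gn : ∀ x, x < S.card → g x < n := fun x hx => hSn _ (g2 x hx)
  set r' : ℕ → ℕ → Bool := fun x y => r (g x) (g y) with hr'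
  have hsy : ∀ x y, x < S.card → y < S.card → x ≠ y → sy r' x y = sy r (g x) (g y) := by
    intro x y hx hy hxy
    rcases lt_or_gt_of_ne hxy with hh | hh
    · rw [sy_lt hh, sy_lt (g1 x y hh hy)]
    · rw [sy_gt hh, sy_gt (g1 y x hh hx)]
  have eqcase : ∀ x, x + 1 < S.card → bl n r (g x) = bl n r (g (x + 1)) → ¬ NT S.card r' x := by
    rintro x hx he ⟨u, hu, hu1, hu2, hu3⟩
    rw [hsy u x hu (by omega) hu1, hsy u (x + 1) hu hx hu2] at hu3
    exact hu3 (same_block he (gn _ (by omega)) (gn _ hx) (gn _ hu)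
      (fun hh => hu1 (mono_inj g1 hu (by omega) hh)) (fun hh => hu2 (mono_inj g1 hu hx hh)))
  have necase : ∀ x, x + 1 < S.card → bl n r (g x) ≠ bl n r (g (x + 1)) →
      bl n r (g (x + 1)) = bl n r (g x) + 1 ∧ NT S.card r' x := by
    intro x hx hne
    have hgl := g1 x (x + 1) (by omega) hx
    have hm := bl_mono (n := n) (r := r) hgl.le
    have hsucc : bl n r (g (x + 1)) = bl n r (g x) + 1 := by
      by_contra hc
      obtain ⟨y, hy1, hy2⟩ := bl_hit (n := n) (r := r) (g (x + 1)) (bl n r (g x) + 1) (by omega)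
      have := gn _ hx
      obtain ⟨s, hs1, hs2⟩ := pick1 y (by omega)
      obtain ⟨k, hk1, hk2⟩ := g3 s hs1
      subst hk2
      rcases Nat.lt_or_ge x k with hxk | hxk
      · have := bl_mono (n := n) (r := r) (mono_le g1 (show x + 1 ≤ k by omega) hk1)
        omega
      · have := bl_mono (n := n) (r := r) (mono_le g1 hxk (by omega))
        omega
    refine ⟨hsucc, ?_⟩
    obtain ⟨v, hv1, hv2, hNT⟩ := bl_lt (n := n) (r := r) (x := g x) (y := g (x + 1)) (by omega)
    have e0 := bl_succ_pos hNT
    have e1 := bl_mono (n := n) (r := r) hv1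
    have e2 := bl_mono (n := n) (r := r) (show v + 1 ≤ g (x + 1) by omega)
    have gx1 := gn _ hx
    have gx0 := gn x (by omega)
    obtain ⟨u, hu, hu1, hu2, hu3⟩ := hNT
    have hw : ∃ w ∈ S, w ≠ g x ∧ w ≠ g (x + 1) ∧ bl n r w = bl n r u := by
      by_cases c1 : bl n r u = bl n r v
      · obtain ⟨w, w1, w2, w3⟩ := pick2 u v hu (by omega) hu1 c1 (g x)
        exact ⟨w, w1, w2, fun hh => by rw [hh] at w3; omega, w3⟩
      by_cases c2 : bl n r u = bl n r (v + 1)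
      · obtain ⟨w, w1, w2, w3⟩ := pick2 u (v + 1) hu (by omega) hu2 c2 (g (x + 1))
        exact ⟨w, w1, fun hh => by rw [hh] at w3; omega, w2, w3⟩
      · obtain ⟨w, w1, w3⟩ := pick1 u hu
        exact ⟨w, w1, fun hh => by rw [hh] at w3; omega, fun hh => by rw [hh] at w3; omega, w3⟩
    obtain ⟨w, w1, w2, w3, w4⟩ := hw
    obtain ⟨k, hk1, rfl⟩ := g3 w w1
    have k1 : k ≠ x := fun hh => w2 (by rw [hh])
    have k2 : k ≠ x + 1 := fun hh => w3 (by rw [hh])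
    refine ⟨k, hk1, k1, k2, ?_⟩
    rw [hsy k x hk1 (by omega) k1, hsy k (x + 1) hk1 hx k2]
    rw [bl_col (n := n) (r := r) (a := g k) (b := g x) (a' := u) (b' := v) w2 hu1 (gn _ hk1)
      (by omega) hu (by omega) w4 (by omega),
      bl_col (n := n) (r := r) (a := g k) (b := g (x + 1)) (a' := u) (b' := v + 1) w3 hu2 (gn _ hk1)
      (by omega) hu (by omega) w4 (by omega)]
    exact hu3
  have hbl : ∀ x, x < S.card → bl S.card r' x = bl n r (g x) := by
    apply bl_unique (L := fun x => bl n r (g x))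
    · intro h0
      have := gn 0 h0
      obtain ⟨s, hs1, hs2⟩ := pick1 0 (by omega)
      obtain ⟨k, hk1, rfl⟩ := g3 s hs1
      have := bl_mono (n := n) (r := r) (mono_le g1 (Nat.zero_le k) hk1)
      rw [bl_zero] at hs2
      omega
    · intro x hx hN
      by_cases he : bl n r (g x) = bl n r (g (x + 1))
      · exact absurd hN (eqcase x hx he)
      · exact (necase x hx he).1
    · intro x hx hN
      by_contra he
      exact hN (necase x hx (fun hh => he hh.symm)).2
  refine ⟨S.card, r', h.sub g g1 gn (fun _ _ _ _ => rfl), ?_, ?_⟩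
  · intro i hi
    rw [← (hF i hi).2]
    simp only [bT]
    have : F i = ((range S.card).filter (fun x => bl S.card r' x = i)).image g := by
      ext y
      rw [hSF i hi, mem_image]
      constructor
      · rintro ⟨hy, he⟩
        obtain ⟨k, hk1, rfl⟩ := g3 y hy
        exact ⟨k, by rw [mem_filter, mem_range, hbl k hk1]; exact ⟨hk1, he⟩, rfl⟩
      · rintro ⟨k, hk, rfl⟩
        rw [mem_filter, mem_range] at hk
        rw [hbl k hk.1] at hk
        exact ⟨g2 k hk.1, hk.2⟩
    rw [this, card_image_of_injOn]
    intro x hx y hy hxy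
    simp only [coe_filter, Set.mem_ofPred_eq, mem_range] at hx hy
    exact mono_inj g1 hx.1 hy.1 hxy
  · intro i j hi hj
    simp only [bM]
    congr 1
    apply propext
    constructor
    · rintro ⟨x, y, hxy, hy, e1, e2, e3⟩
      rw [hbl x (by omega)] at e1
      rw [hbl y hy] at e2
      exact ⟨g x, g y, g1 x y hxy hy, gn y hy, e1, e2, e3⟩
    · rintro ⟨x, y, hxy, hy, e1, e2, e3⟩
      have hx : x < n := by omega
      obtain ⟨s, hs1, hs2⟩ := pick1 x hx
      have ht : ∃ t ∈ S, t ≠ s ∧ bl n r t = bl n r y := by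
        by_cases c : bl n r y = bl n r x
        · exact pick2 y x hy hx (by omega) c s
        · obtain ⟨t, t1, t2⟩ := pick1 y hy
          exact ⟨t, t1, fun hh => by rw [hh] at t2; omega, t2⟩
      obtain ⟨t, ht1, hts, ht2⟩ := ht
      obtain ⟨k, hk1, rfl⟩ := g3 s hs1
      obtain ⟨l, hl1, rfl⟩ := g3 t ht1
      have hc := bl_col (n := n) (r := r) (a := g k) (b := g l) (a' := x) (b' := y) (Ne.symm hts)
        (by omega) (gn _ hk1) (gn _ hl1) hx hy hs2 ht2
      rw [sy_lt hxy, e3] at hc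
      rcases Nat.lt_or_ge k l with hkl | hkl
      · refine ⟨k, l, hkl, hl1, by rw [hbl k hk1, hs2, e1], by rw [hbl l hl1, ht2, e2], ?_⟩
        rw [sy_lt (g1 k l hkl hl1)] at hc
        exact hc
      · have hlk : l < k := by
          rcases hkl.eq_or_lt with hh | hh
          · exact absurd (by rw [hh]) hts
          · exact hh
        have m1 := bl_mono (n := n) (r := r) (g1 l k hlk hk1).le
        have m2 := bl_mono (n := n) (r := r) hxy.le
        refine ⟨l, k, hlk, hk1, by rw [hbl l hl1]; omega, by rw [hbl k hk1]; omega, ?_⟩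
        rw [sy_gt (g1 l k hlk hk1)] at hc
        exact hc

theorem bl_bound {P : HerProp} {t n0 : ℕ} (hn0 : 1 ≤ n0)
    (hsp : speed P n0 < 2 ^ (n0 - 1)) (hk : NoRep P 1 t) :
    ∃ Q, ∀ n r, Has P n r → ∀ x, x < n → bl n r x < Q := by
  classical
  obtain ⟨C, hC⟩ := nt_bound hn0 hsp hk
  refine ⟨C + 1, fun n r h x hx => ?_⟩
  have := hC n r h ((range x).filter (fun v => NT n r v)) (fun v hv => by
    rw [mem_filter, mem_range] at hv
    exact ⟨by omega, hv.2⟩)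
  simp only [bl, Nat.count_eq_card_filter_range]
  omega

/-- code of a graph -/
def CodeOf (Q n : ℕ) (r : ℕ → ℕ → Bool)
    (I : (Fin Q → Fin Q → Bool) × (Fin Q → Fin 3)) (s : Fin Q → ℕ) : Prop :=
  (∀ i j : Fin Q, bM n r i j = I.1 i j) ∧
    ∀ i : Fin Q, bT n r i = (I.2 i : ℕ) + s i ∧ ((I.2 i : ℕ) ≠ 2 → s i = 0)

/-- size vectors realised with a given type -/
def CodeSet (P : HerProp) (Q : ℕ) (I : (Fin Q → Fin Q → Bool) × (Fin Q → Fin 3)) :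
    Set (Fin Q → ℕ) := {s | ∃ n r, Has P n r ∧ CodeOf Q n r I s}

theorem codeSet_lower {P : HerProp} {Q : ℕ} (hQ : ∀ n r, Has P n r → ∀ x, x < n → bl n r x < Q)
    (I : (Fin Q → Fin Q → Bool) × (Fin Q → Fin 3)) : IsLowerSet (CodeSet P Q I) := by
  rintro s s' hss ⟨n, r, h, hM, hT⟩
  obtain ⟨n', r', h', hT', hM'⟩ := shrink h (hQ n r h)
    (fun i => if hi : i < Q then (I.2 ⟨i, hi⟩ : ℕ) + s' ⟨i, hi⟩ else 0)
    (fun i hi => by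
      have := hT ⟨i, hi⟩
      have := hss ⟨i, hi⟩
      simp only [hi, dite_true]; simp only at *; omega)
    (fun i hi hh => by
      have := hT ⟨i, hi⟩
      simp only [hi, dite_true]; simp only at *; omega)
    (fun i hi hh => by
      have := hT ⟨i, hi⟩
      simp only [hi, dite_true]; simp only at *; omega)
  refine ⟨n', r', h', fun i j => ?_, fun i => ⟨?_, fun hi => ?_⟩⟩
  · rw [hM' i j i.2 j.2, hM i j]
  · rw [hT' i i.2]; simp
  · have := (hT i).2 hi
    have : s' i ≤ s i := hss i
    omega

theorem codeOf_exists {Q n : ℕ} (r : ℕ → ℕ → Bool) : ∃ I s, CodeOf Q n r I s := by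
  refine ⟨⟨fun i j => bM n r i j, fun i => ⟨min (bT n r i) 2, by omega⟩⟩, fun i => bT n r i - 2,
    fun i j => rfl, fun i => ⟨?_, fun h => ?_⟩⟩
  · simp only; omega
  · simp only at h ⊢; omega

theorem codeOf_sum {Q n : ℕ} {r : ℕ → ℕ → Bool} (hQ : ∀ x, x < n → bl n r x < Q)
    {I : (Fin Q → Fin Q → Bool) × (Fin Q → Fin 3)} {s : Fin Q → ℕ} (h : CodeOf Q n r I s) :
    ∑ i, (I.2 i : ℕ) + ∑ i, s i = n := by
  rw [← sum_add_distrib, ← bT_sum hQ, Finset.sum_range]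
  apply sum_congr rfl
  intro i _
  exact ((h.2 i).1).symm

theorem speed_code {P : HerProp} {Q : ℕ} (hQ : ∀ n r, Has P n r → ∀ x, x < n → bl n r x < Q)
    (n : ℕ) : speed P n = ∑ I : (Fin Q → Fin Q → Bool) × (Fin Q → Fin 3),
      if ∑ i, (I.2 i : ℕ) ≤ n then fcnt (CodeSet P Q I) (n - ∑ i, (I.2 i : ℕ)) else 0 := by
  classical
  set A : Finset (Σ _ : (Fin Q → Fin Q → Bool) × (Fin Q → Fin 3), (Fin Q → ℕ)) :=
    Finset.univ.sigma (fun I => if ∑ i, (I.2 i : ℕ) ≤ n then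
      (Finset.Nat.antidiagonalTuple Q (n - ∑ i, (I.2 i : ℕ))).filter (fun s => s ∈ CodeSet P Q I)
      else ∅) with hA
  have hmem : ∀ a, a ∈ A ↔ ∑ i, (a.1.2 i : ℕ) + ∑ i, a.2 i = n ∧ a.2 ∈ CodeSet P Q a.1 := by
    intro a
    rw [hA, mem_sigma]
    split_ifs with hh
    · rw [mem_filter, Finset.Nat.mem_antidiagonalTuple]
      simp only [mem_univ, true_and]
      apply and_congr_left
      intro _
      omega
    · simp only [mem_univ, true_and, notMem_empty, false_iff]
      rintro ⟨h1, _⟩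
      omega
  have hcard : A.card = ∑ I : (Fin Q → Fin Q → Bool) × (Fin Q → Fin 3),
      if ∑ i, (I.2 i : ℕ) ≤ n then fcnt (CodeSet P Q I) (n - ∑ i, (I.2 i : ℕ)) else 0 := by
    rw [hA, card_sigma]
    apply sum_congr rfl
    intro I _
    split_ifs
    · rw [fcnt_eq]
    · rfl
  rw [← hcard]
  apply le_antisymm
  · apply speed_le_card A P n (fun a r => Has P n r ∧ CodeOf Q n r a.1 a.2)
    · intro r h
      obtain ⟨I, s, hc⟩ := codeOf_exists (Q := Q) (n := n) r
      exact ⟨⟨I, s⟩, (hmem _).2 ⟨codeOf_sum (hQ n r h) hc, n, r, h, hc⟩, h, hc⟩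
    · rintro ⟨I, s⟩ _ r r' ⟨h, hc⟩ ⟨h', hc'⟩
      apply code_inj (hQ n r h) (hQ n r' h')
      · intro i hi
        exact (hc.2 ⟨i, hi⟩).1.trans (hc'.2 ⟨i, hi⟩).1.symm
      · intro i j hi hj
        exact (hc.1 ⟨i, hi⟩ ⟨j, hj⟩).trans (hc'.1 ⟨i, hi⟩ ⟨j, hj⟩).symm
  · apply card_le_speed A P n (fun a r => CodeOf Q n r a.1 a.2)
    · intro a ha
      obtain ⟨hs, m, r, h, hc⟩ := (hmem a).1 ha
      have := codeOf_sum (hQ m r h) hc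
      have hmn : m = n := by omega
      subst hmn
      exact ⟨r, h, hc⟩
    · rintro ⟨⟨M, c⟩, s⟩ _ ⟨⟨M', c'⟩, s'⟩ _ r r' h h' hagr
      have hM : M = M' := by
        funext i j
        have e1 := h.1 i j
        have e2 := h'.1 i j
        rw [bM_agr hagr] at e1
        exact e1.symm.trans e2
      have key : ∀ i, (c i : ℕ) = c' i ∧ s i = s' i := by
        intro i
        have e1 := h.2 i
        have e2 := h'.2 i
        rw [bT_agr hagr] at e1
        have := (c i).2
        have := (c' i).2
        simp only at e1 e2
        omega
      have hc : c = c' := by funext i; exact Fin.ext (key i).1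
      have hs : s = s' := by funext i; exact (key i).2
      rw [hM, hc, hs]

theorem fcnt_bdd {Q L : ℕ} (A : Set (Fin Q → ℕ))
    (h : ∀ s ∈ A, ∀ i j : Fin Q, i ≠ j → s i < L ∨ s j < L) (n : ℕ) :
    fcnt A n ≤ (L + 1) ^ Q := by
  classical
  rw [fcnt_eq]
  have : (Finset.univ : Finset (Fin Q → Fin (L + 1))).card = (L + 1) ^ Q := by simp
  rw [← this]
  apply Finset.card_le_card_of_injOn (fun s j => ⟨min (s j) L, by omega⟩)
  · intro s _; simp
  · intro s hs s' hs' he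
    simp only [coe_filter, Set.mem_ofPred_eq, Finset.Nat.mem_antidiagonalTuple] at hs hs'
    have hmin : ∀ j, min (s j) L = min (s' j) L := by
      intro j
      have := congrFun he j
      simpa [Fin.ext_iff] using this
    by_cases hbig : ∃ j, L ≤ s j
    · obtain ⟨j, hj⟩ := hbig
      have ho : ∀ i, i ≠ j → s i = s' i := by
        intro i hi
        have := h s hs.2 i j hi
        have := hmin i
        omega
      have e1 := Finset.add_sum_erase univ s (mem_univ j)
      have e2 := Finset.add_sum_erase univ s' (mem_univ j)
      have e3 : ∑ i ∈ univ.erase j, s i = ∑ i ∈ univ.erase j, s' i :=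
        sum_congr rfl (fun i hi => ho i (ne_of_mem_erase hi))
      funext i
      by_cases hi : i = j
      · subst hi; omega
      · exact ho i hi
    · push Not at hbig
      funext i
      have := hbig i
      have := hmin i
      omega

theorem block_start {n m i : ℕ} {r : ℕ → ℕ → Bool} (hm : 1 ≤ m) (h : m ≤ bT n r i) :
    ∃ a, ∀ k, k < m → a + k < n ∧ bl n r (a + k) = i := by
  classical
  simp only [bT] at h
  set B := (range n).filter (fun x => bl n r x = i) with hB
  have hne : B.Nonempty := Finset.card_pos.1 (by omega)
  have hmem : ∀ x, x ∈ B ↔ x < n ∧ bl n r x = i := fun x => by rw [hB, mem_filter, mem_range]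
  refine ⟨B.min' hne, fun k hk => ?_⟩
  have h0 := (hmem _).1 (B.min'_mem hne)
  by_contra hc
  have : B ⊆ Finset.Ico (B.min' hne) (B.min' hne + k) := by
    intro x hx
    have hx1 := B.min'_le x hx
    rw [Finset.mem_Ico]
    refine ⟨hx1, ?_⟩
    by_contra hxk
    have hx2 := (hmem x).1 hx
    apply hc
    have m1 := bl_mono (n := n) (r := r) (show B.min' hne ≤ B.min' hne + k by omega)
    have m2 := bl_mono (n := n) (r := r) (show B.min' hne + k ≤ x by omega)
    omega
  have := card_le_card this
  rw [Nat.card_Ico] at this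
  omega

theorem two_big {P : HerProp} {N : ℕ} {r : ℕ → ℕ → Bool} (h : Has P N r) (n : ℕ) {i j : ℕ}
    (hij : i < j) (hi : n + 2 ≤ bT N r i) (hj : n + 2 ≤ bT N r j) : n ≤ speed P n := by
  obtain ⟨a, ha⟩ := block_start (by omega) hi
  obtain ⟨b, hb⟩ := block_start (by omega) hj
  have ha1 := ha (n + 1) (by omega)
  have hb0 := hb 0 (by omega)
  have hb1 := hb (n + 1) (by omega)
  rw [add_zero] at hb0
  obtain ⟨v, hv1, hv2, hv3⟩ := bl_lt (n := N) (r := r) (x := a + (n + 1)) (y := b) (by omega)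
  refine two_blocks h n (a := a) (b := b) (v := v) ?_ ?_ (by omega) (by omega) (by omega) hv3
  · intro w h1 h2
    obtain ⟨k, rfl⟩ := Nat.exists_eq_add_of_le h1
    exact bl_eq_not (x := a + k) (y := a + (k + 1))
      ((ha k (by omega)).2.trans (ha (k + 1) (by omega)).2.symm) le_rfl (by omega)
  · intro w h1 h2
    obtain ⟨k, rfl⟩ := Nat.exists_eq_add_of_le h1
    exact bl_eq_not (x := b + k) (y := b + (k + 1))
      ((hb k (by omega)).2.trans (hb (k + 1) (by omega)).2.symm) le_rfl (by omega)

theorem poly_case {P : HerProp} {t n0 : ℕ} (hn0 : 1 ≤ n0)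
    (hsp : speed P n0 < 2 ^ (n0 - 1)) (hk : NoRep P 1 t) :
    ((∃ C : ℕ, ∀ n : ℕ, speed P n ≤ C) ∧ ∃ M N : ℕ, ∀ n : ℕ, N ≤ n → speed P n = M) ∨
    ((∃ (K N : ℕ) (a : ℕ → ℤ), ∀ n : ℕ, N ≤ n →
        (speed P n : ℤ) = ∑ i ∈ Finset.range (K + 1), a i * (n.choose i : ℤ)) ∧
      ∀ n : ℕ, n ≤ speed P n) := by
  classical
  obtain ⟨Q, hQ⟩ := bl_bound hn0 hsp hk
  have hP : IsP (fun n => (speed P n : ℤ)) := by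
    refine (IsP.sum (Finset.univ : Finset ((Fin Q → Fin Q → Bool) × (Fin Q → Fin 3)))
      (fun I n => if ∑ i, (I.2 i : ℕ) ≤ n then
        (fcnt (CodeSet P Q I) (n - ∑ i, (I.2 i : ℕ)) : ℤ) else 0)
      (fun I _ => (fcnt_isP _ (codeSet_lower hQ I)).shb _)).congr ⟨0, fun n _ => ?_⟩
    rw [speed_code hQ n]
    push_cast
    rfl
  obtain ⟨K, hK⟩ := hP
  by_cases hL : ∃ L, ∀ I, ∀ s ∈ CodeSet P Q I, ∀ i j : Fin Q, i ≠ j → s i < L ∨ s j < L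
  · left
    obtain ⟨L, hL⟩ := hL
    have hb : ∃ C : ℕ, ∀ n : ℕ, speed P n ≤ C := by
      refine ⟨∑ I : (Fin Q → Fin Q → Bool) × (Fin Q → Fin 3), (L + 1) ^ Q, fun n => ?_⟩
      rw [speed_code hQ n]
      apply sum_le_sum
      intro I _
      split_ifs
      · exact fcnt_bdd _ (hL I) _
      · exact Nat.zero_le _
    refine ⟨hb, ?_⟩
    obtain ⟨C, hC⟩ := hb
    obtain ⟨c, N, hc⟩ := hK.bdd (C := C) (fun n => by
      rw [abs_of_nonneg (by positivity)]
      exact_mod_cast hC n)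
    refine ⟨speed P N, N, fun n hn => ?_⟩
    have e1 := hc n hn
    have e2 := hc N le_rfl
    exact_mod_cast e1.trans e2.symm
  · right
    push Not at hL
    refine ⟨hK.form, fun n => ?_⟩
    obtain ⟨I, s, ⟨N, r, h, hc⟩, i, j, hij, hi, hj⟩ := hL (n + 2)
    have e1 := (hc.2 i).1
    have e2 := (hc.2 j).1
    rcases lt_or_gt_of_ne hij with g | g
    · exact two_big h n (i := i) (j := j) g (by omega) (by omega)
    · exact two_big h n (i := j) (j := i) g (by omega) (by omega)

theorem rep_agr {e : Bool} {K N : ℕ} {B B' : ℕ → ℕ → Bool} (hK : 0 < K) (h : Agr K B B') :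
    Agr N (rep e K B) (rep e K B') := by
  intro i j hij _
  unfold rep
  split_ifs with he
  · apply h
    · have h1 := Nat.div_add_mod i K
      have h2 := Nat.div_add_mod j K
      rw [he] at h1
      omega
    · exact Nat.mod_lt _ hK
  · rfl

theorem norep_of {P : HerProp} {k : ℕ}
    (h : ¬ ∃ e B, Irr e (k + 1) B ∧ ∀ t, Has P (t * (k + 1)) (rep e (k + 1) B)) :
    ∃ t, NoRep P k t := by
  classical
  push Not at h
  have : ∀ x : Bool × (Fin (k + 1) → Fin (k + 1) → Bool), ∃ t,
      Irr x.1 (k + 1) (fun i j => x.2 (Fin.ofNat (k + 1) i) (Fin.ofNat (k + 1) j)) →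
      ¬ Has P (t * (k + 1)) (rep x.1 (k + 1)
        (fun i j => x.2 (Fin.ofNat (k + 1) i) (Fin.ofNat (k + 1) j))) := by
    intro x
    by_cases hi : Irr x.1 (k + 1) (fun i j => x.2 (Fin.ofNat (k + 1) i) (Fin.ofNat (k + 1) j))
    · obtain ⟨t, ht⟩ := h _ _ hi
      exact ⟨t, fun _ => ht⟩
    · exact ⟨0, fun hh => absurd hh hi⟩
  choose t ht using this
  refine ⟨Finset.univ.sup t, fun e B hB hH => ?_⟩
  set b : Fin (k + 1) → Fin (k + 1) → Bool := fun i j => B i j with hb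
  have hagr : Agr (k + 1) B (fun i j => b (Fin.ofNat (k + 1) i) (Fin.ofNat (k + 1) j)) := by
    intro i j hij hj
    simp only [hb, Fin.ofNat, Nat.mod_eq_of_lt hj, Nat.mod_eq_of_lt (lt_trans hij hj)]
  refine ht (e, b) (hB.congr hagr) ?_
  refine (hH.congr (rep_agr (by omega) hagr)).mono ?_
  exact Nat.mul_le_mul_right _ (Finset.le_sup (mem_univ (e, b)))

/-- **Theorem 1 (main theorem).**  If `P` is a hereditary property of ordered graphs then
(a) `|P_n|` is bounded and eventually constant; or (b) `|P_n|` agrees with a polynomial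
`Σ_i a_i (n choose i)` for all large `n`, and `|P_n| ≥ n` for all `n`; or
(c) `F_{n,k} ≤ |P_n| ≤ p(n)·F_{n,k}` for some `k ≥ 2` and polynomial `p`; or
(d) `|P_n| ≥ 2^{n-1}` for every `n`. -/
theorem hereditary_ordered_graph_speed_jumps (P : HerProp) :
    ((∃ C : ℕ, ∀ n : ℕ, speed P n ≤ C) ∧ ∃ M N : ℕ, ∀ n : ℕ, N ≤ n → speed P n = M) ∨
    ((∃ (K N : ℕ) (a : ℕ → ℤ), ∀ n : ℕ, N ≤ n →
        (speed P n : ℤ) = ∑ i ∈ Finset.range (K + 1), a i * (n.choose i : ℤ)) ∧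
      ∀ n : ℕ, n ≤ speed P n) ∨
    (∃ k : ℕ, 2 ≤ k ∧ ∃ p : Polynomial ℕ, ∀ n : ℕ,
        genFib k n ≤ speed P n ∧ speed P n ≤ p.eval n * genFib k n) ∨
    (∀ n : ℕ, 2 ^ (n - 1) ≤ speed P n) := by
  classical
  by_cases hemp : ∀ n r, ¬ Has P n r
  · left
    have h0 : ∀ n, speed P n = 0 := by
      intro n
      have := speed_le_card (∅ : Finset ℕ) P n (fun _ _ => True) (fun r h => absurd h (hemp n r))
        (by simp)
      simpa using this
    exact ⟨⟨0, fun n => (h0 n).le⟩, 0, 0, fun n _ => h0 n⟩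
  push Not at hemp
  obtain ⟨m, r, hm⟩ := hemp
  have hs0 : 1 ≤ speed P 0 := by
    have := card_le_speed ({0} : Finset ℕ) P 0 (fun _ _ => True)
      (fun _ _ => ⟨r, hm.mono (Nat.zero_le _), trivial⟩)
      (fun a ha b hb _ _ _ _ _ => by rw [mem_singleton] at ha hb; rw [ha, hb])
    simpa using this
  by_cases hd : ∀ n : ℕ, 2 ^ (n - 1) ≤ speed P n
  · right; right; right; exact hd
  push Not at hd
  obtain ⟨n0, hsp⟩ := hd
  have hn0 : 1 ≤ n0 := by
    by_contra hc
    have : n0 = 0 := by omega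
    subst this
    simp only [Nat.zero_sub, pow_zero] at hsp
    omega
  set R : ℕ → Prop := fun k => ∃ e B, Irr e k B ∧ ∀ t, Has P (t * k) (rep e k B) with hR
  have hnR : ¬ R (n0 + 1) := by
    rintro ⟨e, B, hB, hH⟩
    have h1 := genFib_le_speed P e (n0 + 1) B hB n0 (hH n0)
    have h2 := genFib_ge (n0 + 1) n0 (by omega)
    omega
  have hex : ∃ k, 1 ≤ k ∧ ¬ R (k + 1) := ⟨n0, hn0, hnR⟩
  obtain ⟨hk1, hkR⟩ := Nat.find_spec hex
  have hmin : ∀ j, j < Nat.find hex → ¬ (1 ≤ j ∧ ¬ R (j + 1)) := fun j hj => Nat.find_min hex hj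
  set k := Nat.find hex with hkdef
  obtain ⟨t, ht⟩ := norep_of hkR
  rcases Nat.lt_or_ge k 2 with hk2 | hk2
  · have hk : k = 1 := by omega
    rw [hk] at ht
    rcases poly_case hn0 hsp ht with h | h
    · exact Or.inl h
    · exact Or.inr (Or.inl h)
  · right; right; left
    have hRk : R k := by
      by_contra hc
      refine hmin (k - 1) (by omega) ⟨by omega, ?_⟩
      rw [Nat.sub_add_cancel (by omega)]
      exact hc
    obtain ⟨e, B, hB, hH⟩ := hRk
    obtain ⟨c, C, hcC⟩ := upper_bound hk1 hn0 hsp ht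
    refine ⟨k, hk2, Polynomial.C c * (Polynomial.X + 1) ^ C, fun n =>
      ⟨genFib_le_speed P e k B hB n (hH n), ?_⟩⟩
    have := hcC n
    simpa using this
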